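/- arXiv:2604.27235 — 2 statements merged into one kernel-verified Lean document; each statement's English description precedes it below -/
import Mathlib

section
/- Fix an odd prime power q and an integer m ≥ 0. Then the proportion of self-dual irreducible complex characters χ of GL_n(𝔽_q) whose degree χ(1) is divisible by 2^m, among all self-dual irreducible complex characters of GL_n(𝔽_q), tends to 1 as n → ∞. -/
open Filter Topology CategoryTheory Matrix

set_option linter.unusedSectionVars false

open Polynomial in
theorem exists_symm_form_quotient {F : Type} [Field F] (p : F[X]) (hp : Irreducible p) (e : ℕ) :
    ∃ B : (F[X] ⧸ Submodule.span F[X] {p ^ e}) →+ (F[X] ⧸ Submodule.span F[X] {p ^ e}) →+ F,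
      (∀ (c : F[X]) a b, B (c • a) b = B a (c • b)) ∧
      (∀ (c : F) a b, B a (C c • b) = c * B a b) ∧
      (∀ b, (∀ a, B a b = 0) → b = 0) := by
  classical
  let I : Ideal F[X] := Ideal.span {p ^ e}
  change ∃ B : (F[X] ⧸ I) →+ (F[X] ⧸ I) →+ F,
      (∀ (c : F[X]) a b, B (c • a) b = B a (c • b)) ∧
      (∀ (c : F) a b, B a (C c • b) = c * B a b) ∧
      (∀ b, (∀ a, B a b = 0) → b = 0)
  obtain ⟨l, hl⟩ : ∃ l : (F[X] ⧸ I) →ₗ[F] F, ∀ b : F[X] ⧸ I, (∀ a, l (a * b) = 0) → b = 0 := by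
    have key : ∀ b : F[X] ⧸ I, b ≠ 0 → ∃ a, a * b = Ideal.Quotient.mk I (p ^ (e - 1)) := by
      intro b hb
      obtain ⟨b, rfl⟩ := Ideal.Quotient.mk_surjective b
      have hb' : ¬ p ^ e ∣ b := by
        intro h
        exact hb (Ideal.Quotient.eq_zero_iff_mem.2 (Ideal.mem_span_singleton.2 h))
      obtain ⟨i, hi, hass⟩ := (dvd_prime_pow hp.prime e).1 (EuclideanDomain.gcd_dvd_right b (p^e))
      have hie : i ≤ e - 1 := by
        rcases Nat.lt_or_ge i e with h | h
        · omega
        · have : i = e := le_antisymm hi h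
          subst this
          exact absurd (hass.symm.dvd.trans (EuclideanDomain.gcd_dvd_left b (p^i))) hb'
      have h1 : EuclideanDomain.gcd b (p ^ e) ∣ p ^ (e - 1) := hass.dvd.trans (pow_dvd_pow p hie)
      obtain ⟨c, hc⟩ := h1
      rw [EuclideanDomain.gcd_eq_gcd_ab] at hc
      refine ⟨Ideal.Quotient.mk I (EuclideanDomain.gcdA b (p ^ e) * c), ?_⟩
      rw [← map_mul, Ideal.Quotient.eq, Ideal.mem_span_singleton, hc]
      exact ⟨-(EuclideanDomain.gcdB b (p ^ e) * c), by ring⟩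
    by_cases h0 : Ideal.Quotient.mk I (p ^ (e - 1)) = 0
    · refine ⟨0, fun b _ => ?_⟩
      by_contra hb
      obtain ⟨a, ha⟩ := key b hb
      have he : e ≠ 0 := by
        rintro rfl
        apply hb
        obtain ⟨b, rfl⟩ := Ideal.Quotient.mk_surjective b
        exact Ideal.Quotient.eq_zero_iff_mem.2 (Ideal.mem_span_singleton.2 (by simp))
      rw [Ideal.Quotient.eq_zero_iff_mem, Ideal.mem_span_singleton] at h0
      have := (pow_dvd_pow_iff hp.ne_zero hp.not_isUnit).1 h0
      omega
    · have h1 := mt (Module.forall_dual_apply_eq_zero_iff F (Ideal.Quotient.mk I (p ^ (e - 1)))).1 h0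
      push Not at h1
      obtain ⟨l, hl⟩ := h1
      refine ⟨l, fun b hb => ?_⟩
      by_contra hb0
      obtain ⟨a, ha⟩ := key b hb0
      exact hl (ha ▸ hb a)
  refine ⟨AddMonoidHom.mk' (fun a => AddMonoidHom.mk' (fun b => l (a * b)) ?_) ?_, ?_, ?_, ?_⟩
  · intro b c; simp [mul_add]
  · intro b c; ext d; simp [add_mul]
  · intro c a b
    exact congrArg l ((smul_mul_assoc c a b).trans (mul_smul_comm c a b).symm)
  · intro c a b
    have : a * (C c • b) = c • (a * b) := by
      rw [mul_smul_comm]; exact algebraMap_smul F[X] c (a * b)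
    simp [this]
  · intro b hb
    exact hl b hb

open Polynomial in
theorem exists_transpose_conj {F : Type} [Field F] {α : Type} [Fintype α] [DecidableEq α]
    (x : Matrix α α F) : ∃ S : Matrix α α F, IsUnit S ∧ S * x = xᵀ * S := by
  classical
  let T := Matrix.toLin' x
  obtain ⟨ι, _, p, hp, e, ⟨φ⟩⟩ := Module.equiv_directSum_of_isTorsion
    (Module.AEval.isTorsion_of_finiteDimensional F (α → F) T)
  choose B hB1 hB2 hB3 using fun i => exists_symm_form_quotient (p i) (hp i) (e i)
  let o : (α → F) ≃ₗ[F] Module.AEval F (α → F) T := Module.AEval.of F (α → F) T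
  have hoX : ∀ v, o (x *ᵥ v) = (X : F[X]) • o v :=
    fun v => (Module.AEval.X_smul_of (R := F) (a := T) v).symm
  have hoC : ∀ (c : F) v, o (c • v) = (C c : F[X]) • o v := by
    intro c v; rw [map_smul, Module.AEval.C_smul]
  let β : (α → F) →ₗ[F] (α → F) →ₗ[F] F := LinearMap.mk₂ F
    (fun u v => ∑ k, B k (φ (o u) k) (φ (o v) k))
    (by intro u u' v; simp [Finset.sum_add_distrib])
    (by
      intro c u v
      simp only [hoC, map_smul, DirectSum.smul_apply, hB1, hB2, Finset.mul_sum, smul_eq_mul])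
    (by intro u v v'; simp [Finset.sum_add_distrib])
    (by
      intro c u v
      simp only [hoC, map_smul, DirectSum.smul_apply, hB2, Finset.mul_sum, smul_eq_mul])
  have hβ : ∀ u v, β u v = ∑ k, B k (φ (o u) k) (φ (o v) k) := fun u v => rfl
  have hβx : ∀ u v, β (x *ᵥ u) v = β u (x *ᵥ v) := by
    intro u v
    simp only [hβ, hoX, map_smul, DirectSum.smul_apply, hB1]
  have hβn : ∀ v, (∀ u, β u v = 0) → v = 0 := by
    intro v hv
    have h1 : φ (o v) = 0 := by
      refine DFinsupp.ext fun k => ?_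
      refine hB3 k _ fun a => ?_
      obtain ⟨w, hw⟩ := φ.surjective (DirectSum.of (fun i => F[X] ⧸ Submodule.span F[X] {p i ^ e i}) k a)
      obtain ⟨u, rfl⟩ := o.surjective w
      have := hv u
      rw [hβ, hw, Finset.sum_eq_single k] at this
      · rwa [DirectSum.of_eq_same] at this
      · intro i _ hi
        rw [DirectSum.of_eq_of_ne _ _ _ hi]; simp
      · simp
    simpa using h1
  let S : Matrix α α F := Matrix.of fun i j => β (Pi.single i 1) (Pi.single j 1)
  have hS : ∀ u v, β u v = u ⬝ᵥ (S *ᵥ v) := by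
    intro u v
    rw [LinearMap.pi_apply_eq_sum_univ (β u) v, dotProduct]
    have : ∀ i : α, (β u) (fun j => if i = j then 1 else 0) = ∑ k, u k * S k i := by
      intro i
      have h2 : (fun j => if i = j then (1:F) else 0) = Pi.single i 1 := by
        ext j; simp [Pi.single_apply, eq_comm]
      have h3 := LinearMap.pi_apply_eq_sum_univ (β.flip (Pi.single i 1)) u
      rw [h2, ← LinearMap.flip_apply, h3]
      refine Finset.sum_congr rfl fun k _ => ?_
      have h2 : (fun j => if k = j then (1:F) else 0) = Pi.single k 1 := by
        ext j; simp [Pi.single_apply, eq_comm]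
      rw [h2]; rfl
    simp only [this, mulVec, dotProduct, Finset.mul_sum, smul_eq_mul]
    rw [Finset.sum_comm]
    refine Finset.sum_congr rfl fun k _ => Finset.sum_congr rfl fun i _ => by ring
  refine ⟨S, ?_, ?_⟩
  · rw [← Matrix.mulVec_injective_iff_isUnit]
    refine (injective_iff_map_eq_zero S.mulVecLin).2 fun v hv => hβn v fun u => ?_
    rw [hS]
    have hv : S *ᵥ v = 0 := hv
    rw [hv, dotProduct_zero]
  · refine Matrix.ext_of_mulVec_single fun i => ?_
    refine dotProduct_eq _ _ fun v => ?_
    rw [dotProduct_comm, ← mulVec_mulVec, ← hS, ← hβx, hS, ← mulVec_mulVec, dotProduct_comm,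
      dotProduct_mulVec, mulVec_transpose]

/-- Families of functions on square matrices of all sizes that are invariant under conjugation and
reindexing. -/
def ClassFn (F : Type) [Field F] :
    Submodule ℂ (∀ (α : Type) [Fintype α], Matrix α α F → ℂ) where
  carrier := {f | ∀ (α β : Type) [Fintype α] [Fintype β] [DecidableEq α] [DecidableEq β]
    (P : Matrix α β F) (Q : Matrix β α F) (x : Matrix β β F), P * Q = 1 → Q * P = 1 →
      f α (P * x * Q) = f β x}
  add_mem' := by
    intro f g hf hg α β _ _ _ _ P Q x h1 h2
    simp only [Pi.add_apply, hf α β P Q x h1 h2, hg α β P Q x h1 h2]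
  zero_mem' := by
    intro α β _ _ _ _ P Q x h1 h2
    simp only [Pi.zero_apply]
  smul_mem' := by
    intro c f hf α β _ _ _ _ P Q x h1 h2
    simp only [Pi.smul_apply, hf α β P Q x h1 h2]

namespace ClassFn

variable {F : Type} [Field F]

instance : CoeFun (ClassFn F) (fun _ => ∀ (α : Type) [Fintype α], Matrix α α F → ℂ) :=
  ⟨fun f => f.1⟩

variable {α β γ : Type} [Fintype α] [Fintype β] [Fintype γ]
  [DecidableEq α] [DecidableEq β] [DecidableEq γ]

theorem apply_conj_rect (f : ClassFn F) {P : Matrix α β F} {Q : Matrix β α F} (x : Matrix β β F)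
    (h1 : P * Q = 1) (h2 : Q * P = 1) : f α (P * x * Q) = f β x :=
  f.2 α β P Q x h1 h2

theorem apply_conj (f : ClassFn F) {P Q : Matrix α α F} (x : Matrix α α F)
    (h1 : P * Q = 1) : f α (P * x * Q) = f α x :=
  f.2 α α P Q x h1 (mul_eq_one_comm.1 h1)

theorem apply_reindex (f : ClassFn F) (e : α ≃ β) (x : Matrix α α F) :
    f β (Matrix.reindex e e x) = f α x := by
  have h := apply_conj_rect f (P := (1 : Matrix α α F).submatrix e.symm id)
    (Q := (1 : Matrix α α F).submatrix id e.symm) x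
    (by ext i j; simp [Matrix.mul_apply, Matrix.one_apply])
    (by ext i j; simp [Matrix.mul_apply, Matrix.one_apply, Equiv.symm_apply_eq])
  rw [← h]
  refine congrArg (f β) ?_
  ext i j
  simp [Matrix.mul_apply, Matrix.one_apply]

theorem apply_transpose (f : ClassFn F) (x : Matrix α α F) : f α xᵀ = f α x := by
  obtain ⟨S, hS, h⟩ := exists_transpose_conj x
  have hd := (Matrix.isUnit_iff_isUnit_det S).1 hS
  rw [← apply_conj f (P := S) (Q := S⁻¹) x (mul_nonsing_inv S hd), h, mul_assoc, mul_nonsing_inv S hd,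
    mul_one]

variable [Fintype F]

open Classical in
/-- The operator `(mu y f) x = ∑ X, f [x X; 0 y]`. -/
noncomputable def mu (y : Matrix β β F) : ClassFn F →ₗ[ℂ] ClassFn F where
  toFun f := ⟨fun α _ x => ∑ X : Matrix α β F, f (α ⊕ β) (fromBlocks x X 0 y), by
    intro α γ _ _ _ _ P Q x h1 h2
    have hb : Function.Bijective (fun X : Matrix γ β F => P * X) := by
      refine Function.bijective_iff_has_inverse.2 ⟨fun X => Q * X, fun X => ?_, fun X => ?_⟩
      · simp [← Matrix.mul_assoc, h2]
      · simp [← Matrix.mul_assoc, h1]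
    have key : ∀ [Fintype (Matrix α β F)] [Fintype (Matrix γ β F)],
        ∑ X : Matrix γ β F, f (γ ⊕ β) (fromBlocks x X 0 y) =
          ∑ X : Matrix α β F, f (α ⊕ β) (fromBlocks (P * x * Q) X 0 y) := by
      intro _ _
      refine Fintype.sum_bijective _ hb _ _ fun X => ?_
      rw [← apply_conj_rect f (P := fromBlocks P 0 0 (1 : Matrix β β F)) (Q := fromBlocks Q 0 0 1)
        (fromBlocks x X 0 y)
        (by simp [fromBlocks_multiply, h1]) (by simp [fromBlocks_multiply, h2])]
      simp [fromBlocks_multiply]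
    beta_reduce
    convert key.symm⟩
  map_add' f g := by
    refine Subtype.ext (funext fun α => funext fun _ => funext fun x => ?_)
    exact Finset.sum_add_distrib (f := fun X => f (α ⊕ β) (fromBlocks x X 0 y))
      (g := fun X => g (α ⊕ β) (fromBlocks x X 0 y))
  map_smul' c f := by
    refine Subtype.ext (funext fun α => funext fun _ => funext fun x => ?_)
    exact (Finset.mul_sum _ (fun X => f (α ⊕ β) (fromBlocks x X 0 y)) c).symm

theorem mu_apply [Fintype (Matrix α β F)] (y : Matrix β β F) (f : ClassFn F) (x : Matrix α α F) :
    mu y f α x = ∑ X : Matrix α β F, f (α ⊕ β) (fromBlocks x X 0 y) := by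
  simp only [mu]
  refine Finset.sum_congr (by ext; simp) fun _ _ => rfl

theorem mu_swap (y : Matrix β β F) (f : ClassFn F) (x : Matrix α α F) :
    mu y f α x = mu x f β y := by
  rw [mu_apply, mu_apply]
  obtain ⟨S, hS, h⟩ := exists_transpose_conj x
  obtain ⟨R, hR, h'⟩ := exists_transpose_conj y
  have hS := (Matrix.isUnit_iff_isUnit_det S).1 hS
  have hR := (Matrix.isUnit_iff_isUnit_det R).1 hR
  have hb : Function.Bijective (fun X : Matrix α β F => R⁻¹ * Xᵀ * S) := by
    refine Function.bijective_iff_has_inverse.2 ⟨fun X => (R * X * S⁻¹)ᵀ, fun X => ?_, fun X => ?_⟩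
    · simp [← Matrix.mul_assoc, mul_nonsing_inv R hR, mul_nonsing_inv_cancel_right _ _ hS]
    · simp [← Matrix.mul_assoc, nonsing_inv_mul R hR, nonsing_inv_mul_cancel_right _ _ hS]
  refine Fintype.sum_bijective _ hb _ _ fun X => ?_
  rw [← apply_transpose f, ← apply_reindex f (Equiv.sumComm α β),
    ← apply_conj f (P := fromBlocks R⁻¹ 0 0 S⁻¹) (Q := fromBlocks R 0 0 S)
      _ (by simp [fromBlocks_multiply, nonsing_inv_mul R hR, nonsing_inv_mul S hS])]
  rw [fromBlocks_transpose]
  simp only [reindex_apply, Equiv.sumComm_symm, Equiv.sumComm_apply, fromBlocks_submatrix_sum_swap_sum_swap,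
    fromBlocks_multiply]
  simp only [Matrix.mul_zero, Matrix.zero_mul, transpose_zero, add_zero, zero_add]
  rw [mul_assoc R⁻¹, ← h', mul_assoc S⁻¹, ← h, nonsing_inv_mul_cancel_left R _ hR,
    nonsing_inv_mul_cancel_left S _ hS]

theorem mu_apply' [Fintype (Matrix α β F)] (x : Matrix α α F) (f : ClassFn F) (y : Matrix β β F) :
    mu x f β y = ∑ X : Matrix α β F, f (α ⊕ β) (fromBlocks x X 0 y) := by
  rw [← mu_swap, mu_apply]

theorem mu_comm (x : Matrix α α F) (z : Matrix γ γ F) (f : ClassFn F) :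
    mu x (mu z f) = mu z (mu x f) := by
  classical
  refine Subtype.ext (funext fun β => funext fun _ => funext fun y => ?_)
  rw [mu_apply' x, mu_apply z]
  simp only [mu_apply z, mu_apply' x]
  rw [← Fintype.sum_prod_type', ← Fintype.sum_prod_type']
  refine Fintype.sum_equiv
    ⟨fun p => (of fun j k => p.2 (Sum.inr j) k, fromCols p.1 (of fun i k => p.2 (Sum.inl i) k)),
      fun p => (p.2.submatrix id Sum.inl, fromRows (p.2.submatrix id Sum.inr) p.1),
      fun p => ?_, fun p => ?_⟩ _ _ fun p => ?_
  · refine Prod.ext ?_ ?_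
    · ext i j; rfl
    · ext (i | i) j <;> rfl
  · refine Prod.ext ?_ ?_
    · ext i j; rfl
    · ext i (j | j) <;> rfl
  · rw [← apply_reindex f (Equiv.sumAssoc α β γ)]
    refine congrArg (f _) ?_
    ext (i | i | i) (j | j | j) <;> rfl

end ClassFn

namespace Mirabolic

variable {F : Type} [Field F] {α β : Type} [Fintype α] [Fintype β] [DecidableEq α] [DecidableEq β]

/-- The block matrix `diag(P, 1)`. -/
def dg (P : Matrix α α F) : Matrix (α ⊕ Unit) (α ⊕ Unit) F := fromBlocks P 0 0 1

/-- The unipotent matrix with last column `w`. -/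
def col (w : Matrix α Unit F) : Matrix (α ⊕ Unit) (α ⊕ Unit) F := fromBlocks 1 w 0 1

/-- The permutation matrix swapping the last two coordinates. -/
def swp : Matrix ((β ⊕ Unit) ⊕ Unit) ((β ⊕ Unit) ⊕ Unit) F :=
  fromBlocks (fromBlocks 1 0 0 0) (fromRows 0 1) (fromCols 0 1) 0

omit [Fintype α] in
@[simp] theorem dg_one : dg (1 : Matrix α α F) = 1 := fromBlocks_one

omit [DecidableEq α] in
theorem dg_mul (P Q : Matrix α α F) : dg P * dg Q = dg (P * Q) := by
  simp [dg, fromBlocks_multiply]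

theorem col_mul (w w' : Matrix α Unit F) : col w * col w' = col (w + w') := by
  simp [col, fromBlocks_multiply, add_comm]

omit [Fintype α] in
@[simp] theorem col_zero : col (0 : Matrix α Unit F) = 1 := fromBlocks_one

theorem dg_mul_col (P : Matrix α α F) (w : Matrix α Unit F) :
    dg P * col w = col (P * w) * dg P := by
  simp [dg, col, fromBlocks_multiply]

theorem dg_mul_col' (P : Matrix α α F) (w : Matrix α Unit F) :
    dg P * col w = fromBlocks P (P * w) 0 1 := by
  simp [dg, col, fromBlocks_multiply]

theorem col_mul_dg (P : Matrix α α F) (w : Matrix α Unit F) :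
    col w * dg P = fromBlocks P w 0 1 := by
  simp [dg, col, fromBlocks_multiply]

theorem swp_mul_swp : (swp : Matrix ((β ⊕ Unit) ⊕ Unit) _ F) * swp = 1 := by
  ext ((i | i) | i) ((j | j) | j) <;>
    simp [swp, Matrix.mul_apply, Fintype.sum_sum_type, Matrix.one_apply]

theorem swp_mul_dg_dg (P : Matrix β β F) : swp * dg (dg P) = dg (dg P) * swp := by
  ext ((i | i) | i) ((j | j) | j) <;>
    simp [swp, dg, Matrix.mul_apply, Fintype.sum_sum_type, Matrix.one_apply]

theorem swp_mul_dg_col (w : Matrix β Unit F) :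
    swp * dg (col w) = col (fromRows w 0) * swp := by
  ext ((i | i) | i) ((j | j) | j) <;>
    simp [swp, dg, col, Matrix.mul_apply, Fintype.sum_sum_type, Matrix.one_apply]

theorem dg_col_mul_swp (w : Matrix β Unit F) :
    dg (col w) * swp = swp * col (fromRows w 0) := by
  calc dg (col w) * swp = swp * (swp * dg (col w)) * swp := by
        rw [← Matrix.mul_assoc, swp_mul_swp, Matrix.one_mul]
    _ = _ := by
        rw [swp_mul_dg_col, Matrix.mul_assoc, Matrix.mul_assoc, swp_mul_swp, Matrix.mul_one]

/-- Functions on matrices that are invariant under conjugation by `diag(P, 1)` and under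
multiplication by unipotent columns on both sides. -/
structure Good (φ : Matrix (α ⊕ Unit) (α ⊕ Unit) F → ℂ) : Prop where
  conj : ∀ (P P' : Matrix α α F) x, P * P' = 1 → φ (dg P * x * dg P') = φ x
  left : ∀ w x, φ (col w * x) = φ x
  right : ∀ w x, φ (x * col w) = φ x

theorem Good.swap {φ : Matrix (α ⊕ Unit) (α ⊕ Unit) F → ℂ} (h : Good φ) {P : Matrix α α F}
    (hP : IsUnit P) (x) : φ (x * dg P) = φ (dg P * x) := by
  have hd := (Matrix.isUnit_iff_isUnit_det P).1 hP
  rw [← h.conj P P⁻¹ (x * dg P) (mul_nonsing_inv P hd), Matrix.mul_assoc, Matrix.mul_assoc x,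
    dg_mul, mul_nonsing_inv P hd, dg_one, Matrix.mul_one]

theorem Good.step {φ : Matrix ((β ⊕ Unit) ⊕ Unit) ((β ⊕ Unit) ⊕ Unit) F → ℂ} (h : Good φ) :
    Good (fun z : Matrix (β ⊕ Unit) (β ⊕ Unit) F => φ (dg z * swp)) where
  conj P P' x hP := by
    rw [← dg_mul, ← dg_mul, Matrix.mul_assoc _ (dg (dg P')), ← swp_mul_dg_dg, ← Matrix.mul_assoc,
      Matrix.mul_assoc _ (dg x)]
    exact h.conj _ _ _ (by rw [dg_mul, hP, dg_one])
  left w x := by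
    have hu : IsUnit (col w) := IsUnit.of_mul_eq_one (col (-w)) (by rw [col_mul]; simp)
    rw [← dg_mul, Matrix.mul_assoc, ← h.swap hu, Matrix.mul_assoc, swp_mul_dg_col,
      ← Matrix.mul_assoc, dg_mul_col, Matrix.mul_assoc, h.left]
  right w x := by
    rw [← dg_mul, Matrix.mul_assoc, dg_col_mul_swp, ← Matrix.mul_assoc, h.right]

variable [Fintype F]

/-- Averages of a class function over unipotent columns, transported down a number of steps. -/
noncomputable def phi (f : ClassFn F) : ∀ (_ : ℕ) (α : Type) [Fintype α] [DecidableEq α],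
    Matrix (α ⊕ Unit) (α ⊕ Unit) F → ℂ
  | 0, _, _, _ => fun x => by
      classical exact ∑ w, f _ (x * col w)
  | Nat.succ j, α, _, _ => fun z => phi f j (α ⊕ Unit) (dg z * swp)

theorem phi_zero [DecidableEq F] (f : ClassFn F) (x : Matrix (α ⊕ Unit) (α ⊕ Unit) F) :
    phi f 0 α x = ∑ w, f _ (x * col w) := by
  rw [phi]

theorem good_phi (f : ClassFn F) (j : ℕ) : ∀ (α : Type) [Fintype α] [DecidableEq α],
    Good (phi f j α) := by
  classical
  induction j with
  | zero =>
    intro α _ _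
    have hr : ∀ w x, phi f 0 α (x * col w) = phi f 0 α x := by
      intro w x
      rw [phi_zero, phi_zero]
      refine Fintype.sum_equiv (Equiv.addLeft w) _ _ fun w' => ?_
      rw [Matrix.mul_assoc, col_mul]; rfl
    refine ⟨fun P P' x hP => ?_, fun w x => ?_, hr⟩
    · have hP' := mul_eq_one_comm.1 hP
      rw [phi_zero, phi_zero]
      refine Fintype.sum_equiv ⟨fun w => P' * w, fun w => P * w, fun w => ?_, fun w => ?_⟩ _ _ fun w => ?_
      · simp [← Matrix.mul_assoc, hP]
      · simp [← Matrix.mul_assoc, hP']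
      · rw [← ClassFn.apply_conj f (P := dg P) (Q := dg P') (x * _) (by rw [dg_mul, hP, dg_one]),
          Matrix.mul_assoc, Matrix.mul_assoc, dg_mul_col]
        simp [Matrix.mul_assoc]
    · rw [← hr w x, phi_zero, phi_zero]
      refine Fintype.sum_congr _ _ fun w' => ?_
      rw [← ClassFn.apply_conj f (P := col w) (Q := col (-w)) (x * _ * _) (by rw [col_mul]; simp)]
      simp only [Matrix.mul_assoc, col_mul]
      rw [show w + w' + -w = w' by abel]
  | succ j ih =>
    intro α _ _
    exact (ih (α ⊕ Unit)).step

/-- All matrices `[q w; 0 1]` with `q ∈ Q`. -/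
def ext [DecidableEq F] (Q : Finset (Matrix α α F)) :
    Finset (Matrix (α ⊕ Unit) (α ⊕ Unit) F) :=
  (Q ×ˢ Finset.univ).image fun p => fromBlocks p.1 p.2 0 1

omit [DecidableEq α] in
theorem mem_ext [DecidableEq F] [DecidableEq α] {Q : Finset (Matrix α α F)} {x} :
    x ∈ ext Q ↔ ∃ q ∈ Q, ∃ w, x = fromBlocks q w 0 1 := by
  simp only [ext, Finset.mem_image, Finset.mem_product, Finset.mem_univ, and_true, Prod.exists]
  constructor
  · rintro ⟨q, w, hq, rfl⟩; exact ⟨q, hq, w, rfl⟩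
  · rintro ⟨q, hq, w, rfl⟩; exact ⟨q, w, hq, rfl⟩

/-- A finite set of matrices that forms a group under multiplication. -/
structure IsGrp (Q : Finset (Matrix α α F)) : Prop where
  one : 1 ∈ Q
  mul : ∀ x ∈ Q, ∀ y ∈ Q, x * y ∈ Q
  inv : ∀ x ∈ Q, ∃ y ∈ Q, x * y = 1

theorem IsGrp.isUnit {Q : Finset (Matrix α α F)} (h : IsGrp Q) {x} (hx : x ∈ Q) : IsUnit x := by
  obtain ⟨y, -, hy⟩ := h.inv x hx
  exact IsUnit.of_mul_eq_one y hy

theorem IsGrp.sum_mul {Q : Finset (Matrix α α F)} (h : IsGrp Q) {x} (hx : x ∈ Q)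
    (φ : Matrix α α F → ℂ) : ∑ q ∈ Q, φ (x * q) = ∑ q ∈ Q, φ q := by
  obtain ⟨y, hy, hxy⟩ := h.inv x hx
  have hyx := mul_eq_one_comm.1 hxy
  refine Finset.sum_nbij' (fun q => x * q) (fun q => y * q) (fun q hq => h.mul _ hx _ hq)
    (fun q hq => h.mul _ hy _ hq) ?_ ?_ fun _ _ => rfl
  · intro q _; simp [← Matrix.mul_assoc, hyx]
  · intro q _; simp [← Matrix.mul_assoc, hxy]

theorem isGrp_ext [DecidableEq F] {Q : Finset (Matrix α α F)} (h : IsGrp Q) : IsGrp (ext Q) where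
  one := mem_ext.2 ⟨1, h.one, 0, fromBlocks_one.symm⟩
  mul x hx y hy := by
    obtain ⟨q, hq, w, rfl⟩ := mem_ext.1 hx
    obtain ⟨q', hq', w', rfl⟩ := mem_ext.1 hy
    exact mem_ext.2 ⟨q * q', h.mul _ hq _ hq', q * w' + w, by simp [fromBlocks_multiply]⟩
  inv x hx := by
    obtain ⟨q, hq, w, rfl⟩ := mem_ext.1 hx
    obtain ⟨q', hq', h1⟩ := h.inv q hq
    refine ⟨fromBlocks q' (-(q' * w)) 0 1, mem_ext.2 ⟨q', hq', _, rfl⟩, ?_⟩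
    simp [fromBlocks_multiply, ← Matrix.mul_assoc, h1]

/-- Every nonzero row is the last row of an invertible matrix conjugating `diag(q, 1)`, `q ∈ Q`,
into `ext Q`. -/
def RowProp [DecidableEq F] (Q : Finset (Matrix α α F)) : Prop :=
  ∀ r : α ⊕ Unit → F, r ≠ 0 → ∃ Y Y' : Matrix (α ⊕ Unit) (α ⊕ Unit) F,
    Y * Y' = 1 ∧ Y (Sum.inr ()) = r ∧ ∀ q ∈ Q, Y' * dg q * Y ∈ ext Q

omit [Fintype F] in
theorem exists_isUnit_row {ι : Type} [Fintype ι] [DecidableEq ι] (i : ι) (r : ι → F) (hr : r ≠ 0) :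
    ∃ Y Y' : Matrix ι ι F, Y * Y' = 1 ∧ Y i = r := by
  obtain ⟨j, hj⟩ := Function.ne_iff.1 hr
  let M : Matrix ι ι F := ((1 : Matrix ι ι F).updateCol j r)ᵀ
  have hM : M.det = r j := by
    rw [det_transpose, ← cramer_apply, cramer_one]; rfl
  have hd : IsUnit (M.submatrix (Equiv.swap i j) id).det := by
    rw [det_permute, hM]
    refine IsUnit.mul ?_ (isUnit_iff_ne_zero.2 hj)
    exact (Equiv.Perm.sign (Equiv.swap i j)).isUnit.map (Int.castRingHom F)
  refine ⟨_, _, mul_nonsing_inv _ hd, ?_⟩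
  ext k
  simp [M]

theorem rowProp_one [DecidableEq F] : RowProp ({1} : Finset (Matrix α α F)) := by
  intro r hr
  obtain ⟨Y, Y', h1, h2⟩ := exists_isUnit_row (Sum.inr ()) r hr
  refine ⟨Y, Y', h1, h2, fun q hq => ?_⟩
  rw [Finset.mem_singleton.1 hq, dg_one, Matrix.mul_one, mul_eq_one_comm.1 h1]
  exact mem_ext.2 ⟨1, by simp, 0, fromBlocks_one.symm⟩

omit [Fintype F] in
theorem exists_sum_mul_eq {r : α → F} (hr : r ≠ 0) (d : F) :
    ∃ w : Matrix α Unit F, ∑ i, r i * w i () = d := by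
  obtain ⟨i, hi⟩ := Function.ne_iff.1 hr
  refine ⟨of fun j _ => if j = i then (r i)⁻¹ * d else 0, ?_⟩
  simp [mul_inv_cancel_left₀ hi]

theorem rowProp_ext [DecidableEq F] {Q : Finset (Matrix α α F)} (h : RowProp Q) :
    RowProp (ext Q) := by
  intro r hr
  by_cases h0 : (fun i => r (Sum.inl i)) = 0
  · have hd : r (Sum.inr ()) ≠ 0 := by
      intro hd
      apply hr
      ext (i | i)
      · exact congrFun h0 i
      · exact hd
    refine ⟨fromBlocks 1 0 0 (of fun _ _ => r (Sum.inr ())),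
      fromBlocks 1 0 0 (of fun _ _ => (r (Sum.inr ()))⁻¹), ?_, ?_, ?_⟩
    · ext (i | i) (j | j) <;> simp [Matrix.mul_apply, hd, Matrix.one_apply]
    · ext (j | j)
      · simpa using (congrFun h0 j).symm
      · simp
    · intro q hq
      refine mem_ext.2 ⟨q, hq, 0, ?_⟩
      ext (i | i) (j | j) <;> simp [dg, Matrix.mul_apply, hd, Matrix.one_apply]
  · obtain ⟨Y, Y', h1, h2, h3⟩ := h _ h0
    obtain ⟨w, hw⟩ := exists_sum_mul_eq h0 (r (Sum.inr ()))
    refine ⟨swp * dg Y * col w, col (-w) * dg Y' * swp, ?_, ?_, ?_⟩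
    · calc _ = swp * (dg Y * (col w * col (-w)) * dg Y') * swp := by simp only [Matrix.mul_assoc]
        _ = 1 := by
          rw [col_mul, add_neg_cancel, col_zero, Matrix.mul_one, dg_mul, h1, dg_one,
            Matrix.mul_one, swp_mul_swp]
    · rw [Matrix.mul_assoc, dg_mul_col']
      have h2' : ∀ j, Y (Sum.inr ()) j = r (Sum.inl j) := fun j => congrFun h2 j
      ext (j | j)
      · simp [swp, ← h2', Matrix.mul_apply, fromRows, fromCols]
      · simp [swp, ← hw, ← h2', Matrix.mul_apply]
    · intro q hq
      obtain ⟨q0, hq0, w0, rfl⟩ := mem_ext.1 hq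
      have e1 : swp * dg (fromBlocks q0 w0 0 1) * swp = col (fromRows w0 0) * dg (dg q0) := by
        rw [← col_mul_dg, ← dg_mul, ← Matrix.mul_assoc, swp_mul_dg_col, Matrix.mul_assoc,
          Matrix.mul_assoc, ← swp_mul_dg_dg, ← Matrix.mul_assoc swp, swp_mul_swp, Matrix.one_mul]
      have e2 : col (-w) * dg Y' * swp * dg (fromBlocks q0 w0 0 1) * (swp * dg Y * col w)
        = col (-w) * (dg Y' * (swp * dg (fromBlocks q0 w0 0 1) * swp) * dg Y) * col w := by
        simp only [Matrix.mul_assoc]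
      rw [e2, e1, ← Matrix.mul_assoc (dg Y'), dg_mul_col, Matrix.mul_assoc (col (Y' * _)),
        dg_mul, Matrix.mul_assoc (col (Y' * _)), dg_mul, ← Matrix.mul_assoc (col (-w)), col_mul,
        Matrix.mul_assoc, dg_mul_col, ← Matrix.mul_assoc, col_mul, col_mul_dg]
      exact mem_ext.2 ⟨_, h3 q0 hq0, _, rfl⟩

theorem sum_phi_dg {Q : Finset (Matrix β β F)} [DecidableEq F] (hQ : IsGrp Q) (hrow : RowProp Q)
    {φ : Matrix ((β ⊕ Unit) ⊕ Unit) ((β ⊕ Unit) ⊕ Unit) F → ℂ} (h : Good φ)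
    (hclose : ∀ (x : Matrix (β ⊕ Unit) (β ⊕ Unit) F) (t : F), IsUnit x → t ≠ 0 →
      ∑ q ∈ ext Q, φ (fromBlocks (x * q) 0 0 (of fun _ _ => t)) = 0)
    (hstep : ∀ z : Matrix (β ⊕ Unit) (β ⊕ Unit) F, IsUnit z →
      ∑ q ∈ Q, φ (dg (z * dg q) * swp) = 0)
    (x : Matrix ((β ⊕ Unit) ⊕ Unit) ((β ⊕ Unit) ⊕ Unit) F) (hx : IsUnit x) :
    ∑ q ∈ ext Q, φ (x * dg q) = 0 := by
  have hQ' := isGrp_ext hQ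
  by_cases h0 : (fun i => x (Sum.inr ()) (Sum.inl i)) = 0
  · obtain ⟨x0, b, d, rfl⟩ : ∃ x0 b d, x = fromBlocks x0 b 0 (of fun _ _ => d) := by
      refine ⟨x.toBlocks₁₁, x.toBlocks₁₂, x (Sum.inr ()) (Sum.inr ()), ?_⟩
      ext (i | i) (j | j)
      · rfl
      · rfl
      · exact congrFun h0 j
      · rfl
    rw [isUnit_fromBlocks_zero₂₁] at hx
    have hd : d ≠ 0 := by
      have := (Matrix.isUnit_iff_isUnit_det _).1 hx.2
      simpa using this
    rw [← hclose x0 d hx.1 hd]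
    refine Finset.sum_congr rfl fun q _ => ?_
    rw [← h.left (b * (of fun _ _ => d⁻¹ : Matrix Unit Unit F)) (fromBlocks (x0 * q) 0 0 _)]
    have e : b * (of fun _ _ => d⁻¹ : Matrix Unit Unit F) * (of fun _ _ => d : Matrix Unit Unit F) = b := by
      ext i j; simp [Matrix.mul_apply, hd]
    simp [dg, col, fromBlocks_multiply, e]
  · obtain ⟨w, hw⟩ := exists_sum_mul_eq h0 (-x (Sum.inr ()) (Sum.inr ()))
    obtain ⟨Y, Y', hY, hYr, hYQ⟩ := hrow _ h0
    have hY' := mul_eq_one_comm.1 hY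
    set N := x * col w * dg Y' * swp with hN
    have hcw : IsUnit (col w) := IsUnit.of_mul_eq_one (col (-w)) (by rw [col_mul]; simp)
    have hdY : IsUnit (dg Y') := IsUnit.of_mul_eq_one (dg Y) (by rw [dg_mul, hY', dg_one])
    have hNu : IsUnit N := ((hx.mul hcw).mul hdY).mul (IsUnit.of_mul_eq_one _ swp_mul_swp)
    have hrow1 : (x * col w) (Sum.inr ()) = dg Y (Sum.inl (Sum.inr ())) := by
      ext (j | j)
      · simp [dg, col, Matrix.mul_apply, Matrix.one_apply, hYr]
      · simp [dg, col, Matrix.mul_apply, hw]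
    have hNr : N (Sum.inr ()) = (swp : Matrix ((β ⊕ Unit) ⊕ Unit) _ F) (Sum.inl (Sum.inr ())) := by
      have e : N (Sum.inr ()) = (x * col w) (Sum.inr ()) ᵥ* (dg Y' * swp) := by
        rw [hN, Matrix.mul_assoc]; rfl
      rw [e, hrow1]
      change (dg Y * (dg Y' * swp) : Matrix ((β ⊕ Unit) ⊕ Unit) ((β ⊕ Unit) ⊕ Unit) F) (Sum.inl (Sum.inr ())) = _
      rw [← Matrix.mul_assoc, dg_mul, hY, dg_one, Matrix.one_mul]
    obtain ⟨z, b, hzb⟩ : ∃ z b, N = fromBlocks z b 0 1 := by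
      refine ⟨N.toBlocks₁₁, N.toBlocks₁₂, ?_⟩
      ext (i | i) (j | j)
      · rfl
      · rfl
      · rw [hNr]; rcases j with j | j <;> simp [swp]
      · rw [hNr]; simp [swp]
    have hz : IsUnit z := by
      rw [hzb, isUnit_fromBlocks_zero₂₁] at hNu; exact hNu.1
    have hx1 : x * col w = col b * dg z * swp * dg Y := by
      rw [col_mul_dg, ← hzb, hN, Matrix.mul_assoc _ swp swp, swp_mul_swp, Matrix.mul_one,
        Matrix.mul_assoc, dg_mul, hY', dg_one, Matrix.mul_one]
    have hYu : IsUnit Y := IsUnit.of_mul_eq_one _ hY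
    have key : ∀ q ∈ ext Q, φ (x * dg q) = φ (dg (Y * q * z) * swp) := by
      intro q hq
      obtain ⟨q', -, hq'⟩ := hQ'.inv q hq
      rw [← h.right (q' * w), Matrix.mul_assoc, dg_mul_col, ← Matrix.mul_assoc q, hq',
        Matrix.one_mul, ← Matrix.mul_assoc, hx1, Matrix.mul_assoc _ (dg Y), dg_mul,
        h.swap (hYu.mul (hQ'.isUnit hq)), Matrix.mul_assoc (col b), ← Matrix.mul_assoc (dg _),
        dg_mul_col, Matrix.mul_assoc, h.left, ← Matrix.mul_assoc, dg_mul]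
    rw [Finset.sum_congr rfl key]
    have h1 : ∀ q' ∈ Q, ∑ q ∈ ext Q, φ (dg (Y * q * z) * swp) =
        ∑ q ∈ ext Q, φ (dg (Y * q * z * dg q') * swp) := by
      intro q' hq'
      rw [← hQ'.sum_mul (hYQ q' hq')]
      refine Finset.sum_congr rfl fun q _ => ?_
      rw [h.step.swap (hQ.isUnit hq')]
      congr 3
      simp only [← Matrix.mul_assoc, hY, Matrix.one_mul]
    have h2 := Finset.sum_congr rfl h1
    rw [Finset.sum_const, Finset.sum_comm (s := Q)] at h2
    rw [Finset.sum_eq_zero (s := ext Q)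
      fun q hq => hstep _ ((hYu.mul (hQ'.isUnit hq)).mul hz)] at h2
    exact (smul_eq_zero.1 h2).resolve_left (Finset.card_pos.2 ⟨1, hQ.one⟩).ne'

/-- The index types `Fin a ⊕ Unit ⊕ ⋯ ⊕ Unit`. -/
def T (a : ℕ) : ℕ → Type
  | 0 => Fin a
  | k + 1 => T a k ⊕ Unit

instance instFintypeT (a : ℕ) : ∀ k, Fintype (T a k)
  | 0 => inferInstanceAs (Fintype (Fin a))
  | k + 1 => @instFintypeSum _ _ (instFintypeT a k) _

instance instDecidableEqT (a : ℕ) : ∀ k, DecidableEq (T a k)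
  | 0 => inferInstanceAs (DecidableEq (Fin a))
  | k + 1 => @instDecidableEqSum _ _ (instDecidableEqT a k) _

/-- The iterated mirabolic unipotent groups. -/
def Qs (F : Type) [Field F] [Fintype F] [DecidableEq F] (a : ℕ) :
    ∀ k, Finset (Matrix (T a k) (T a k) F)
  | 0 => {1}
  | k + 1 => ext (Qs F a k)

variable [DecidableEq F]

theorem isGrp_Qs (a k : ℕ) : IsGrp (Qs F a k) := by
  induction k with
  | zero => exact ⟨by simp [Qs], by simp [Qs], by simp [Qs]⟩
  | succ k ih => exact isGrp_ext ih

theorem rowProp_Qs (a k : ℕ) : RowProp (Qs F a k) := by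
  induction k with
  | zero => exact rowProp_one
  | succ k ih => exact rowProp_ext ih

theorem sum_phi_Qs (f : ClassFn F) (a k : ℕ) : ∀ j,
    (∀ i ≤ k, ∀ (x : Matrix (T a i) (T a i) F) (t : F), IsUnit x → t ≠ 0 →
      ∑ q ∈ Qs F a i, phi f (j + k - i) (T a i) (fromBlocks (x * q) 0 0 (of fun _ _ => t)) = 0) →
    (∀ x : Matrix (T a 0 ⊕ Unit) (T a 0 ⊕ Unit) F, phi f (j + k) (T a 0) x = 0) →
    ∀ x : Matrix (T a k ⊕ Unit) (T a k ⊕ Unit) F, IsUnit x →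
      ∑ q ∈ Qs F a k, phi f j (T a k) (x * dg q) = 0 := by
  induction k with
  | zero =>
    intro j _ h x _
    exact Finset.sum_eq_zero fun q _ => h _
  | succ k ih =>
    intro j hc hb x hx
    refine sum_phi_dg (isGrp_Qs a k) (rowProp_Qs a k) (good_phi f j _) ?_ ?_ x hx
    · have := hc (k + 1) le_rfl
      rw [Nat.add_sub_cancel] at this
      exact this
    · refine ih (j + 1) ?_ ?_
      · intro i hi
        rw [show j + 1 + k - i = j + (k + 1) - i by omega]
        exact hc i (by omega)
      · rw [show j + 1 + k = j + (k + 1) by omega]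
        exact hb

end Mirabolic

namespace Mirabolic

variable {F : Type} [Field F] {α β : Type} [Fintype α] [Fintype β] [DecidableEq α] [DecidableEq β]

/-- The companion-type matrix with last column `t`. -/
def comp {j : ℕ} (t : Fin (j + 1) → F) : Matrix (Fin (j + 1)) (Fin (j + 1)) F :=
  of fun r k => if k = Fin.last j then t r else if (r : ℕ) = k + 1 then 1 else 0

/-- The matrix whose only nonzero column is the last one. -/
def lastCol (j : ℕ) (v : Matrix α Unit F) : Matrix α (Fin (j + 1)) F :=
  of fun i k => if k = Fin.last j then v i () else 0

/-- The matrix whose only nonzero row is the first one. -/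
def firstRow (j : ℕ) (c : Matrix Unit α F) : Matrix (Fin (j + 1)) α F :=
  of fun k i => if k = 0 then c () i else 0

/-- Moving a coordinate to the front of the second block. -/
def shiftEquiv (α : Type) (j : ℕ) : (α ⊕ Unit) ⊕ Fin (j + 1) ≃ α ⊕ Fin (j + 2) where
  toFun := Sum.elim (Sum.elim Sum.inl fun _ => Sum.inr 0) fun k => Sum.inr k.succ
  invFun := Sum.elim (fun i => Sum.inl (Sum.inl i))
    (Fin.cases (Sum.inl (Sum.inr ())) fun k => Sum.inr k)
  left_inv := by rintro ((i | i) | i) <;> simp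
  right_inv := by
    rintro (i | i)
    · simp
    · refine Fin.cases ?_ (fun k => ?_) i <;> simp

/-- Splitting off the last coordinate of a column into a vector of coefficients. -/
def splitEquiv (F α : Type) (j : ℕ) :
    Matrix (α ⊕ Unit) Unit F × (Fin j → F) ≃ Matrix α Unit F × (Fin (j + 1) → F) where
  toFun p := (of fun i k => p.1 (Sum.inl i) k, Fin.cons (p.1 (Sum.inr ()) ()) p.2)
  invFun p := (of fun i _ => Sum.elim (fun i => p.1 i ()) (fun _ => p.2 0) i, Fin.tail p.2)
  left_inv := by
    rintro ⟨w, u⟩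
    refine Prod.ext ?_ ?_
    · ext (i | i) k <;> rfl
    · simp
  right_inv := by
    rintro ⟨w, u⟩
    refine Prod.ext ?_ ?_
    · ext i k; rfl
    · simp

variable [Fintype F] [DecidableEq F]

theorem phi_eq (f : ClassFn F) (j : ℕ) : ∀ (α : Type) [Fintype α] [DecidableEq α]
    (A : Matrix α α F) (b : Matrix α Unit F) (c : Matrix Unit α F) (d : Matrix Unit Unit F),
    phi f j α (fromBlocks A b c d) = ∑ w : Matrix α Unit F, ∑ u : Fin j → F,
      f (α ⊕ Fin (j + 1)) (fromBlocks A (lastCol j (b + A * w)) (firstRow j c)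
        (comp (Fin.cons ((d + c * w) () ()) u))) := by
  induction j with
  | zero =>
    intro α _ _ A b c d
    rw [phi_zero]
    refine Finset.sum_congr rfl fun w _ => ?_
    rw [Fintype.sum_unique, ← ClassFn.apply_reindex f
      ((Equiv.refl α).sumCongr (Equiv.ofUnique Unit (Fin 1)))]
    refine congrArg (f _) ?_
    ext (i | i) (k | k)
    · simp [col, fromBlocks_multiply]
    · simp [col, fromBlocks_multiply, lastCol, Subsingleton.elim k 0, add_comm]
    · simp [col, fromBlocks_multiply, firstRow, Subsingleton.elim i 0]
    · simp [col, fromBlocks_multiply, comp, Subsingleton.elim i 0, Subsingleton.elim k 0, add_comm]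
  | succ j ih =>
    intro α _ _ A b c d
    have e : dg (fromBlocks A b c d) * swp = fromBlocks (fromBlocks A 0 c 0) (fromRows b d)
        (fromCols 0 1) 0 := by
      ext ((i | i) | i) ((k | k) | k) <;>
        simp [swp, dg, Matrix.mul_apply, Fintype.sum_sum_type, Matrix.one_apply]
    have e1 : phi f (j + 1) α (fromBlocks A b c d) =
      phi f j (α ⊕ Unit) (dg (fromBlocks A b c d) * swp) := rfl
    rw [e1, e, ih, ← Fintype.sum_prod_type', ← Fintype.sum_prod_type']
    refine Fintype.sum_equiv (splitEquiv F α j) _ _ ?_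
    rintro ⟨w, u⟩
    rw [← ClassFn.apply_reindex f (shiftEquiv α j)]
    refine congrArg (f _) ?_
    ext (i | i) (k | k)
    · simp [shiftEquiv]
    · refine Fin.cases ?_ (fun k => ?_) k
      · simp [shiftEquiv, lastCol, (Fin.last_pos).ne]
      · simp [shiftEquiv, lastCol, splitEquiv, Matrix.mul_apply, Fintype.sum_sum_type,
          ← Fin.succ_last]
    · refine Fin.cases ?_ (fun i => ?_) i
      · simp [shiftEquiv, firstRow]
      · simp [shiftEquiv, firstRow]
    · refine Fin.cases ?_ (fun k => ?_) k <;> refine Fin.cases ?_ (fun i => ?_) i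
      · simp [shiftEquiv, comp]
      · simp [shiftEquiv, comp, splitEquiv, firstRow]
      · simp [shiftEquiv, comp, splitEquiv, lastCol, Matrix.mul_apply, Fintype.sum_sum_type, ← Fin.succ_last]
      · have e2 : ((fromCols 0 1 : Matrix Unit (α ⊕ Unit) F) * w) () () = w (Sum.inr ()) () := by
          simp [Matrix.mul_apply, Fintype.sum_sum_type]
        simp [shiftEquiv, comp, splitEquiv, ← Fin.succ_last, e2]

end Mirabolic

namespace Mirabolic

variable {F : Type} [Field F] {α β : Type} [Fintype α] [Fintype β] [DecidableEq α] [DecidableEq β]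

/-- Prepending a zero column. -/
def padCol {j : ℕ} (Z : Matrix α (Fin j) F) : Matrix α (Fin (j + 1)) F :=
  of fun i k => (Fin.cons 0 (fun k => Z i k) : Fin (j + 1) → F) k

theorem mul_comp_castSucc {j : ℕ} (Z : Matrix α (Fin (j + 1)) F) (t : Fin (j + 1) → F) (i : α)
    (k : Fin j) : (Z * comp t) i k.castSucc = Z i k.succ := by
  rw [Matrix.mul_apply, Finset.sum_eq_single k.succ]
  · simp [comp]
  · intro b _ hb
    have : ¬ (b : ℕ) = k + 1 := fun h => hb (Fin.ext (by simpa using h))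
    simp [comp, this]
  · simp

/-- Parametrization of all rectangular matrices by a last column and a conjugating matrix. -/
def colParam (x : Matrix α α F) {j : ℕ} (t : Fin (j + 1) → F)
    (p : Matrix α Unit F × Matrix α (Fin j) F) : Matrix α (Fin (j + 1)) F :=
  lastCol j p.1 + padCol p.2 * comp t - x * padCol p.2

theorem colParam_sub (x : Matrix α α F) {j : ℕ} (t : Fin (j + 1) → F)
    (p p' : Matrix α Unit F × Matrix α (Fin j) F) :
    colParam x t (p - p') = colParam x t p - colParam x t p' := by
  have h1 : lastCol j (p - p').1 = lastCol j p.1 - lastCol j p'.1 := by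
    ext i k
    by_cases h : k = Fin.last j <;> simp [lastCol, h]
  have h2 : padCol (p - p').2 = padCol p.2 - padCol p'.2 := by
    ext i k
    refine Fin.cases ?_ (fun k => ?_) k <;> simp [padCol]
  simp only [colParam, h1, h2, Matrix.sub_mul, Matrix.mul_sub]
  abel

theorem colParam_injective (x : Matrix α α F) {j : ℕ} (t : Fin (j + 1) → F) :
    Function.Injective (colParam x t) := by
  intro p p' h
  have h0 : colParam x t (p - p') = 0 := by rw [colParam_sub, h, sub_self]
  rw [← sub_eq_zero]
  generalize p - p' = p at h0
  obtain ⟨w, Z⟩ := p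
  have hz : ∀ k i, padCol Z i k = 0 := by
    intro k
    induction k using Fin.induction with
    | zero => intro i; simp [padCol]
    | succ k ih =>
      intro i
      have := congrFun (congrFun h0 i) k.castSucc
      simp only [colParam, Matrix.sub_apply, Matrix.add_apply, mul_comp_castSucc] at this
      rw [Matrix.mul_apply, Finset.sum_eq_zero fun l _ => by rw [ih l, mul_zero]] at this
      simpa [lastCol, (Fin.castSucc_lt_last k).ne] using this
  have hZ : padCol Z = 0 := by ext i k; exact hz k i
  refine Prod.ext ?_ ?_
  · ext i u
    have := congrFun (congrFun h0 i) (Fin.last j)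
    simpa [colParam, hZ, lastCol] using this
  · ext i k
    simpa [padCol] using hz k.succ i

variable [Fintype F] [DecidableEq F]

theorem colParam_bijective (x : Matrix α α F) {j : ℕ} (t : Fin (j + 1) → F) :
    Function.Bijective (colParam x t) := by
  refine (Fintype.bijective_iff_injective_and_card _).2 ⟨colParam_injective x t, ?_⟩
  have h1 : ∀ (n : Type) [Fintype n] [DecidableEq n],
      Nat.card (Matrix α n F) = Nat.card F ^ (Fintype.card n * Fintype.card α) := by
    intro n _ _
    simp [Matrix, pow_mul]
  rw [← Nat.card_eq_fintype_card, ← Nat.card_eq_fintype_card, Nat.card_prod, h1, h1, h1, ← pow_add,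
    ← add_mul, Fintype.card_fin, Fintype.card_fin, Fintype.card_unit, add_comm]

theorem sum_fromBlocks_comp (f : ClassFn F) (x : Matrix α α F) {j : ℕ} (t : Fin (j + 1) → F) :
    ∑ X : Matrix α (Fin (j + 1)) F, f (α ⊕ Fin (j + 1)) (fromBlocks x X 0 (comp t)) =
      (Fintype.card (Matrix α (Fin j) F) : ℂ) * ∑ w : Matrix α Unit F,
        f (α ⊕ Fin (j + 1)) (fromBlocks x (lastCol j w) 0 (comp t)) := by
  rw [← (colParam_bijective x t).sum_comp, Fintype.sum_prod_type, Finset.mul_sum]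
  refine Finset.sum_congr rfl fun w _ => ?_
  rw [Finset.sum_congr rfl fun Z _ => ?_, Finset.sum_const, Finset.card_univ, nsmul_eq_mul]
  rw [← ClassFn.apply_conj f (P := fromBlocks 1 (padCol Z) 0 1) (Q := fromBlocks 1 (-padCol Z) 0 1)
    (fromBlocks x (lastCol j w) 0 (comp t)) (by simp [fromBlocks_multiply])]
  refine congrArg (f _) ?_
  simp [fromBlocks_multiply, colParam]
  abel

/-- The averaged operator attached to an entry `t` and a size `j + 1`. -/
noncomputable def muj (j : ℕ) (t : F) : ClassFn F →ₗ[ℂ] ClassFn F :=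
  ∑ u : Fin j → F, ClassFn.mu (comp (Fin.cons t u))

theorem muj_apply (j : ℕ) (t : F) (f : ClassFn F) (x : Matrix α α F) :
    muj j t f α x = ∑ u : Fin j → F, ClassFn.mu (comp (Fin.cons t u)) f α x := by
  have h : ∀ s : Finset (Fin j → F), ((∑ u ∈ s, ClassFn.mu (comp (Fin.cons t u))) f : ClassFn F) α x =
      ∑ u ∈ s, ClassFn.mu (comp (Fin.cons t u)) f α x := by
    intro s
    induction s using Finset.induction_on with
    | empty => rfl
    | insert a s ha ih => rw [Finset.sum_insert ha, Finset.sum_insert ha, ← ih]; rfl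
  exact h _

theorem muj_comm (j k : ℕ) (s t : F) (f : ClassFn F) :
    muj j s (muj k t f) = muj k t (muj j s f) := by
  simp only [muj, LinearMap.sum_apply, map_sum]
  rw [Finset.sum_comm]
  exact Finset.sum_congr rfl fun _ _ => Finset.sum_congr rfl fun _ _ => ClassFn.mu_comm _ _ _

theorem muj_eq_phi (f : ClassFn F) (j : ℕ) (t : F) (x : Matrix α α F) (hx : IsUnit x) :
    muj j t f α x = (Fintype.card (Matrix α (Fin j) F) : ℂ) *
      phi f j α (fromBlocks x 0 0 (of fun _ _ => t)) := by
  have hd := (Matrix.isUnit_iff_isUnit_det x).1 hx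
  rw [muj_apply, phi_eq, Finset.sum_comm, Finset.mul_sum]
  refine Finset.sum_congr rfl fun u _ => ?_
  rw [ClassFn.mu_apply, sum_fromBlocks_comp]
  congr 1
  have hb : Function.Bijective (fun w : Matrix α Unit F => x * w) := by
    refine Function.bijective_iff_has_inverse.2 ⟨fun X => x⁻¹ * X, fun X => ?_, fun X => ?_⟩
    · simp [← Matrix.mul_assoc, nonsing_inv_mul x hd]
    · simp [← Matrix.mul_assoc, mul_nonsing_inv x hd]
  rw [← hb.sum_comp]
  refine Finset.sum_congr rfl fun w _ => ?_
  refine congrArg (f _) ?_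
  have : firstRow j (0 : Matrix Unit α F) = 0 := by ext i k; simp [firstRow]
  simp [this]

end Mirabolic

namespace Mirabolic

variable {F : Type} [Field F] [Fintype F] [DecidableEq F]

instance : LeftCommutative fun (p : ℕ × Fˣ) (f : ClassFn F) => muj p.1 (p.2 : F) f :=
  ⟨fun _ _ _ => muj_comm _ _ _ _ _⟩

/-- The composition of the operators attached to a multiset of pairs `(j, t)`. -/
noncomputable def ops (M : Multiset (ℕ × Fˣ)) (f : ClassFn F) : ClassFn F :=
  M.foldr (fun p f => muj p.1 (p.2 : F) f) f

/-- The total size of a multiset of pairs `(j, t)`. -/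
def wt (M : Multiset (ℕ × Fˣ)) : ℕ := (M.map fun p => p.1 + 1).sum

theorem ops_muj (M : Multiset (ℕ × Fˣ)) (p : ℕ × Fˣ) (f : ClassFn F) :
    ops M (muj p.1 (p.2 : F) f) = ops (p ::ₘ M) f := by
  rw [← Multiset.singleton_add, add_comm, ops, ops, Multiset.foldr_add, Multiset.foldr_singleton]

theorem sum_ext {α : Type} [Fintype α] [DecidableEq α] (Q : Finset (Matrix α α F))
    (φ : Matrix (α ⊕ Unit) (α ⊕ Unit) F → ℂ) :
    ∑ q ∈ ext Q, φ q = ∑ q ∈ Q, ∑ w, φ (fromBlocks q w 0 1) := by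
  rw [ext, Finset.sum_image, Finset.sum_product]
  rintro ⟨q, w⟩ _ ⟨q', w'⟩ _ h
  obtain ⟨h1, h2, -, -⟩ := fromBlocks_inj.1 h
  exact Prod.ext h1 h2

theorem sum_ext_of_isUnit {α : Type} [Fintype α] [DecidableEq α] {Q : Finset (Matrix α α F)}
    (hQ : ∀ q ∈ Q, IsUnit q) (φ : Matrix (α ⊕ Unit) (α ⊕ Unit) F → ℂ) :
    ∑ q ∈ ext Q, φ q = ∑ q ∈ Q, ∑ w, φ (dg q * col w) := by
  rw [sum_ext]
  refine Finset.sum_congr rfl fun q hq => ?_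
  have hd := (Matrix.isUnit_iff_isUnit_det q).1 (hQ q hq)
  have hb : Function.Bijective (fun w : Matrix α Unit F => q * w) := by
    refine Function.bijective_iff_has_inverse.2 ⟨fun X => q⁻¹ * X, fun X => ?_, fun X => ?_⟩
    · simp [← Matrix.mul_assoc, nonsing_inv_mul q hd]
    · simp [← Matrix.mul_assoc, mul_nonsing_inv q hd]
  rw [← hb.sum_comp]
  refine Finset.sum_congr rfl fun w _ => congrArg φ ?_
  simp [dg, col, fromBlocks_multiply]

theorem sum_Qs_eq_zero (a k : ℕ) : ∀ f : ClassFn F,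
    (∀ M : Multiset (ℕ × Fˣ), wt M ≤ k → (∀ x, ops M f (T a 0) x = 0) ∧
      ∀ z, phi (ops M f) (k - wt M - 1) (T a 0) z = 0) →
    ∀ x : Matrix (T a k) (T a k) F, IsUnit x → ∑ q ∈ Qs F a k, f (T a k) (x * q) = 0 := by
  induction k using Nat.strong_induction_on with
  | _ k ih =>
  intro f h
  match k, ih, h with
  | 0, ih, h =>
    intro x _
    refine Finset.sum_eq_zero fun q _ => (h 0 (by simp [wt])).1 _
  | k + 1, ih, h =>
    intro (x : Matrix (T a k ⊕ Unit) (T a k ⊕ Unit) F) hx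
    have key := sum_phi_Qs f a k 0 ?_ ?_ x hx
    · simp only [phi_zero] at key
      refine (sum_ext_of_isUnit (fun q hq => (isGrp_Qs a k).isUnit hq)
        (fun q => f (T a k ⊕ Unit) (x * q))).trans ?_
      simpa only [Matrix.mul_assoc] using key
    · intro i hi y t hy ht
      have := ih i (by omega) (muj (k - i) t f) ?_ y hy
      · rw [Finset.sum_congr rfl fun q hq =>
          muj_eq_phi f (k - i) t (y * q) (hy.mul ((isGrp_Qs a i).isUnit hq)), ← Finset.mul_sum] at this
        rw [zero_add]
        exact (mul_eq_zero.1 this).resolve_left (Nat.cast_ne_zero.2 Fintype.card_ne_zero)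
      · intro M hM
        have e := ops_muj M (k - i, Units.mk0 t ht) f
        have e2 : wt ((k - i, Units.mk0 t ht) ::ₘ M) = k - i + 1 + wt M := by simp [wt]
        have := h _ (by omega : wt ((k - i, Units.mk0 t ht) ::ₘ M) ≤ k + 1)
        simp only [Units.val_mk0] at e
        rw [e2, ← e, show k + 1 - (k - i + 1 + wt M) - 1 = i - wt M - 1 by omega] at this
        exact this
    · have := (h 0 (by simp [wt])).2
      simpa [wt, ops] using this

end Mirabolic

namespace Mirabolic

universe u

variable {F : Type} [Field F] [Fintype F] [DecidableEq F] {α β : Type} [Fintype α] [Fintype β]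
  [DecidableEq α] [DecidableEq β] {X : Type*} [AddCommGroup X] [Module ℂ X]

/-- Representations of the affine group of `F ^ α`. -/
structure AffRep (r : (Matrix α α F)ˣ → (α → F) → Module.End ℂ X) : Prop where
  one : r 1 0 = 1
  mul : ∀ g w g' w', r g w * r g' w' = r (g * g') ((g : Matrix α α F) *ᵥ w' + w)

/-- The part of a representation on which translations act by a given character. -/
def eigen (r : (Matrix α α F)ˣ → (α → F) → Module.End ℂ X) (θ : AddChar (α → F) ℂ) :
    Submodule ℂ X where
  carrier := {x | ∀ w, r 1 w x = θ w • x}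
  add_mem' hx hy w := by simp [hx w, hy w]
  zero_mem' w := by simp
  smul_mem' c x hx w := by simp [hx w, smul_comm c]

theorem AffRep.isProj {r : (Matrix α α F)ˣ → (α → F) → Module.End ℂ X} (h : AffRep r)
    (θ : AddChar (α → F) ℂ) :
    LinearMap.IsProj (eigen r θ) ((Fintype.card (α → F) : ℂ)⁻¹ • ∑ w, θ (-w) • r 1 w) where
  map_mem x w := by
    rw [LinearMap.smul_apply, map_smul, smul_comm]
    congr 1
    simp only [LinearMap.sum_apply, map_sum, LinearMap.smul_apply, map_smul, Finset.smul_sum]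
    refine Fintype.sum_equiv (Equiv.addLeft w) _ _ fun v => ?_
    have := congrArg (· x) (h.mul 1 w 1 v)
    simp only [Module.End.mul_apply, mul_one, Units.val_one, one_mulVec] at this
    rw [this, smul_smul, ← AddChar.map_add_eq_mul, Equiv.coe_addLeft, add_comm v w, neg_add_rev,
      add_comm (-v), add_neg_cancel_left]
  map_id x hx := by
    have hx : ∀ w, r 1 w x = θ w • x := hx
    simp only [LinearMap.smul_apply, LinearMap.sum_apply, hx, smul_smul, ← AddChar.map_add_eq_mul,
      neg_add_cancel, AddChar.map_zero_eq_one, one_smul, Finset.sum_const, Finset.card_univ,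
      ← Nat.cast_smul_eq_nsmul ℂ]
    rw [inv_mul_cancel₀ (Nat.cast_ne_zero.2 Fintype.card_ne_zero), one_smul]

theorem AffRep.trace_eq {r : (Matrix α α F)ˣ → (α → F) → Module.End ℂ X} (h : AffRep r) (i : α)
    {w : α → F} (hw : w ≠ 0) :
    LinearMap.trace ℂ X (r 1 w) = LinearMap.trace ℂ X (r 1 (Pi.single i 1)) := by
  obtain ⟨Y, Y', hY, hr⟩ := exists_isUnit_row i w hw
  let g : (Matrix α α F)ˣ := ⟨Yᵀ, Y'ᵀ, by rw [← transpose_mul, mul_eq_one_comm.1 hY, transpose_one],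
    by rw [← transpose_mul, hY, transpose_one]⟩
  have e : r 1 w = r g 0 * (r 1 (Pi.single i 1) * r g⁻¹ 0) := by
    rw [h.mul, h.mul]
    congr 1
    · simp
    · ext k
      simp [g, ← hr]
  rw [e, LinearMap.trace_mul_comm, mul_assoc, h.mul]
  simp [h.one]

theorem AffRep.finrank_eq [FiniteDimensional ℂ X] {r : (Matrix α α F)ˣ → (α → F) → Module.End ℂ X}
    (h : AffRep r) (i : α) {θ : AddChar (α → F) ℂ} (hθ : θ ≠ 1) :
    Module.finrank ℂ X = Module.finrank ℂ (eigen r 1) +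
      (Fintype.card (α → F) - 1) * Module.finrank ℂ (eigen r θ) := by
  have hc : (Fintype.card (α → F) : ℂ) ≠ 0 := Nat.cast_ne_zero.2 Fintype.card_ne_zero
  have key : ∀ θ : AddChar (α → F) ℂ, (Fintype.card (α → F) : ℂ) * Module.finrank ℂ (eigen r θ) =
      Module.finrank ℂ X + ((∑ w, θ w) - 1) * LinearMap.trace ℂ X (r 1 (Pi.single i 1)) := by
    intro θ
    have e : ∑ w, θ w = ∑ w, θ (-w) := (Equiv.sum_comp (Equiv.neg (α → F)) fun w => θ w).symm
    rw [← (h.isProj θ).trace, map_smul, smul_eq_mul, mul_inv_cancel_left₀ hc, map_sum, e,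
      Fintype.sum_eq_add_sum_compl 0, Fintype.sum_eq_add_sum_compl 0 fun w => θ (-w), h.one]
    simp only [neg_zero, AddChar.map_zero_eq_one, one_smul, LinearMap.trace_one, add_sub_cancel_left,
      Finset.sum_mul]
    congr 1
    refine Finset.sum_congr rfl fun w hw => ?_
    rw [map_smul, h.trace_eq i (by simpa using hw), smul_eq_mul]
  have h1 := key 1
  have h2 := key θ
  rw [AddChar.sum_eq_zero_of_ne_one hθ] at h2
  rw [AddChar.sum_eq_card_of_eq_one rfl] at h1
  have : (Module.finrank ℂ X : ℂ) = Module.finrank ℂ (eigen r 1) +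
      ((Fintype.card (α → F) : ℂ) - 1) * Module.finrank ℂ (eigen r θ) := by
    refine mul_left_cancel₀ hc ?_
    linear_combination -h1 - ((Fintype.card (α → F) : ℂ) - 1) * h2
  have h3 : 1 ≤ Fintype.card (α → F) := Fintype.card_pos
  exact_mod_cast (by push_cast [Nat.cast_sub h3]; exact this : ((Module.finrank ℂ X : ℕ) : ℂ) =
    ((Module.finrank ℂ (eigen r 1) +
      (Fintype.card (α → F) - 1) * Module.finrank ℂ (eigen r θ) : ℕ) : ℂ))

/-- The block matrix `[g w; 0 1]`. -/
def blk (g : (Matrix β β F)ˣ) (w : β → F) : (Matrix (β ⊕ Unit) (β ⊕ Unit) F)ˣ where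
  val := fromBlocks g (of fun i _ => w i) 0 1
  inv := fromBlocks (g⁻¹ : (Matrix β β F)ˣ) (of fun i _ => -(((g⁻¹ : (Matrix β β F)ˣ) : Matrix β β F) *ᵥ w) i) 0 1
  val_inv := by
    have : (g : Matrix β β F) * (of fun i (_ : Unit) => -(((g⁻¹ : (Matrix β β F)ˣ) : Matrix β β F) *ᵥ w) i) =
        of fun i _ => - w i := by
      ext i k
      have := congrFun (mulVec_neg (((g⁻¹ : (Matrix β β F)ˣ) : Matrix β β F) *ᵥ w) (g : Matrix β β F)) i
      rw [mulVec_mulVec, Units.mul_inv, one_mulVec] at this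
      exact this
    rw [fromBlocks_multiply, this, ← fromBlocks_one]
    congr 1
    · simp
    · ext; simp
    · simp
    · simp
  inv_val := by
    rw [fromBlocks_multiply, ← fromBlocks_one]
    congr 1
    · simp
    · ext i k; simp [Matrix.mul_apply, mulVec, dotProduct]
    · simp
    · simp

theorem blk_mul (g : (Matrix β β F)ˣ) (w : β → F) (g' : (Matrix β β F)ˣ) (w' : β → F) :
    blk g w * blk g' w' = blk (g * g') ((g : Matrix β β F) *ᵥ w' + w) := by
  refine Units.ext ?_
  simp only [blk, Units.val_mul, fromBlocks_multiply]
  congr 1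
  · simp
  · ext i k; simp [Matrix.mul_apply, mulVec, dotProduct]
  · simp
  · simp

theorem blk_one : blk (1 : (Matrix β β F)ˣ) 0 = 1 := by
  refine Units.ext ?_
  simp only [blk, Units.val_one, ← fromBlocks_one]
  congr 1

theorem blk_mulVec_inr (g : (Matrix β β F)ˣ) (w : β → F) (v : β ⊕ Unit → F) :
    ((blk g w : Matrix (β ⊕ Unit) (β ⊕ Unit) F) *ᵥ v) (Sum.inr ()) = v (Sum.inr ()) := by
  simp [blk, mulVec, dotProduct]

/-- Matrices that agree with the identity except at entries whose level increases. -/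
def InU (h : α → ℕ) (u : Matrix α α F) : Prop :=
  ∀ i j, ¬ h i < h j → u i j = (1 : Matrix α α F) i j

theorem InU.exists_blk {h : β ⊕ Unit → ℕ} (hh : ∀ i, h i ≤ h (Sum.inr ()))
    {u : (Matrix (β ⊕ Unit) (β ⊕ Unit) F)ˣ} (hu : InU h (u : Matrix (β ⊕ Unit) (β ⊕ Unit) F)) :
    ∃ g w, u = blk g w ∧ InU (fun i => h (Sum.inl i)) (g : Matrix β β F) ∧
      ∀ i, ¬ h (Sum.inl i) < h (Sum.inr ()) → w i = 0 := by
  have e : (u : Matrix (β ⊕ Unit) (β ⊕ Unit) F) = fromBlocks (u : Matrix (β ⊕ Unit) (β ⊕ Unit) F).toBlocks₁₁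
      (u : Matrix (β ⊕ Unit) (β ⊕ Unit) F).toBlocks₁₂ 0 1 := by
    conv_lhs => rw [← fromBlocks_toBlocks (u : Matrix (β ⊕ Unit) (β ⊕ Unit) F)]
    congr 1
    · ext i j; simp [toBlocks₂₁, hu (Sum.inr i) (Sum.inl j) (by have := hh (Sum.inl j); simpa using this)]
    · ext i j; simp [toBlocks₂₂, hu (Sum.inr i) (Sum.inr j) (by simp), Subsingleton.elim i j]
  have hd := (Matrix.isUnit_iff_isUnit_det _).1 u.isUnit
  rw [e, det_fromBlocks_zero₂₁, det_one, mul_one] at hd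
  refine ⟨((Matrix.isUnit_iff_isUnit_det _).2 hd).unit, fun i => (u : Matrix (β ⊕ Unit) (β ⊕ Unit) F).toBlocks₁₂ i (), ?_,
    ?_, ?_⟩
  · exact Units.ext e
  · intro i j hij
    have := hu (Sum.inl i) (Sum.inl j) hij
    simpa [Matrix.one_apply, toBlocks₁₁] using this
  · intro i hi
    simpa [toBlocks₁₂] using hu (Sum.inl i) (Sum.inr ()) hi

theorem AffRep.restrict {r : (Matrix (β ⊕ Unit) (β ⊕ Unit) F)ˣ → (β ⊕ Unit → F) → Module.End ℂ X}
    (h : AffRep r) {θ : AddChar (β ⊕ Unit → F) ℂ}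
    (hθ : ∀ (g : (Matrix β β F)ˣ) w v, θ ((blk g w : Matrix _ _ F) *ᵥ v) = θ v) :
    ∃ r' : (Matrix β β F)ˣ → (β → F) → Module.End ℂ (eigen r θ), AffRep r' ∧
      ∀ g w x, (r' g w x : X) = r (blk g w) 0 x := by
  have hs : ∀ g w, ∀ x ∈ eigen r θ, r (blk g w) 0 x ∈ eigen r θ := by
    intro g w x hx v
    have h1 := congrArg (· x) (h.mul 1 v (blk g w) 0)
    have h2 := congrArg (· x) (h.mul (blk g w) 0 1 ((blk g w)⁻¹.val *ᵥ v))
    have hx : ∀ w, r 1 w x = θ w • x := hx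
    simp only [Module.End.mul_apply, hx, map_smul] at h1 h2
    rw [h1]
    rw [mulVec_mulVec, Units.mul_inv] at h2
    rw [← hθ g w, mulVec_mulVec, Units.mul_inv, one_mulVec] at h2
    rw [h2]
    simp
  refine ⟨fun g w => (r (blk g w) 0).restrict (hs g w), ⟨?_, ?_⟩, fun g w x => rfl⟩
  · ext x
    simp [blk_one, h.one]
  · intro g w g' w'
    ext x
    have := congrArg (· (x : X)) (h.mul (blk g w) 0 (blk g' w') 0)
    simpa [blk_mul] using this

/-- The additive character of `F ^ (β ⊕ Unit)` seeing only the last coordinate. -/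
noncomputable def lastChar (β : Type) (F : Type) [Field F] [Fintype F] : AddChar (β ⊕ Unit → F) ℂ :=
  (AddChar.FiniteField.primitiveChar_to_Complex F).compAddMonoidHom
    (Pi.evalAddMonoidHom (fun _ => F) (Sum.inr ()))

theorem lastChar_ne_one : lastChar β F ≠ 1 := by
  intro h
  have h1 : AddChar.FiniteField.primitiveChar_to_Complex F ≠ 1 := by
    have := AddChar.FiniteField.primitiveChar_to_Complex_isPrimitive (F := F) one_ne_zero
    simpa [AddChar.mulShift_one] using this
  refine h1 (DFunLike.ext _ _ fun t => ?_)
  have := DFunLike.congr_fun h (fun _ => t)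
  simpa [lastChar] using this

variable (F) in
/-- Representations of the affine group of `F ^ β` of dimension not divisible by `2 ^ m` have a
vector fixed by a large unipotent subgroup. -/
def HasFixed (β : Type) [Fintype β] [DecidableEq β] : Prop := ∀ (m : ℕ) (X : Type u)
    [AddCommGroup X] [Module ℂ X] [FiniteDimensional ℂ X]
    (r : (Matrix β β F)ˣ → (β → F) → Module.End ℂ X), AffRep r →
    ¬ 2 ^ m ∣ Module.finrank ℂ X → ∃ h : β ⊕ Unit → ℕ, (∀ i, h i ≤ h (Sum.inr ())) ∧
      Fintype.card β + 1 < (Finset.univ.image h).card + m ∧ ∃ x : X, x ≠ 0 ∧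
      ∀ (g : (Matrix β β F)ˣ) w, InU (fun i => h (Sum.inl i)) (g : Matrix β β F) →
        (∀ i, ¬ h (Sum.inl i) < h (Sum.inr ()) → w i = 0) → r g w x = x

theorem hasFixed_of_isEmpty [IsEmpty β] : HasFixed.{u} F β := by
  intro m X _ _ _ r hr hm
  refine ⟨fun _ => 0, fun _ => le_rfl, ?_, ?_⟩
  · have : m ≠ 0 := by rintro rfl; simp at hm
    rw [Finset.image_const Finset.univ_nonempty, Finset.card_singleton, Fintype.card_eq_zero]
    omega
  · have : Nontrivial X := by
      by_contra h
      rw [not_nontrivial_iff_subsingleton] at h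
      exact hm (by rw [Module.finrank_zero_of_subsingleton]; exact dvd_zero _)
    obtain ⟨x, hx⟩ := exists_ne (0 : X)
    refine ⟨x, hx, fun g w _ _ => ?_⟩
    rw [Subsingleton.elim g 1, Subsingleton.elim w 0, hr.one]
    rfl

theorem HasFixed.sum_unit (hF : Odd (Fintype.card F)) (ih : HasFixed.{u} F β) :
    HasFixed.{u} F (β ⊕ Unit) := by
  intro m X _ _ _ r hr hm
  have hsplit : ∀ g w, r g w = r 1 w * r g 0 := by
    intro g w
    have := hr.mul 1 w g 0
    rw [this, one_mul, mulVec_zero, zero_add]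
  have hd := hr.finrank_eq (Sum.inr ()) (lastChar_ne_one (β := β))
  rw [hd] at hm
  by_cases h0 : 2 ^ m ∣ Module.finrank ℂ (eigen r 1)
  · obtain ⟨r', hr', e⟩ := hr.restrict (θ := lastChar (β) F) fun g w v => by
      exact congrArg (AddChar.FiniteField.primitiveChar_to_Complex F) (blk_mulVec_inr g w v)
    have hm' : m ≠ 0 := by rintro rfl; simp at hm
    have h1 : ¬ 2 ^ (m - 1) ∣ Module.finrank ℂ (eigen r (lastChar (β) F)) := by
      intro h1
      refine hm (dvd_add h0 ?_)
      obtain ⟨n, rfl⟩ := Nat.exists_eq_succ_of_ne_zero hm'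
      rw [pow_succ']
      refine mul_dvd_mul ?_ h1
      rw [Fintype.card_fun]
      exact (Nat.Odd.sub_odd hF.pow odd_one).two_dvd
    obtain ⟨h, hh, hc, x, hx, hf⟩ := ih (m - 1) _ r' hr' h1
    refine ⟨Sum.elim h fun _ => h (Sum.inr ()), ?_, ?_, x, ?_, ?_⟩
    · rintro (i | i)
      · exact hh i
      · exact le_rfl
    · have : Finset.univ.image h ⊆ Finset.univ.image
          (Sum.elim h fun _ => h (Sum.inr ()) : ((β ⊕ Unit) ⊕ Unit) → ℕ) := by
        intro n hn
        obtain ⟨i, -, rfl⟩ := Finset.mem_image.1 hn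
        exact Finset.mem_image.2 ⟨Sum.inl i, Finset.mem_univ _, rfl⟩
      have := Finset.card_le_card this
      rw [Fintype.card_sum, Fintype.card_unit]
      omega
    · simpa using hx
    · intro g w hg hw
      obtain ⟨g', w', rfl, hg', hw'⟩ := InU.exists_blk hh hg
      rw [hsplit, Module.End.mul_apply, ← e, hf g' w' hg' hw', x.2 w]
      have : lastChar (β) F w = 1 := by
        have := hw (Sum.inr ()) (lt_irrefl _)
        simp [lastChar, this]
      rw [this, one_smul]
  · obtain ⟨r', hr', e⟩ := hr.restrict (θ := 1) fun g w v => by simp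
    obtain ⟨h, hh, hc, x, hx, hf⟩ := ih m _ r' hr' h0
    refine ⟨Sum.elim h fun _ => h (Sum.inr ()) + 1, ?_, ?_, x, ?_, ?_⟩
    · rintro (i | i)
      · exact (hh i).trans (Nat.le_succ _)
      · exact le_rfl
    · have : insert (h (Sum.inr ()) + 1) (Finset.univ.image h) ⊆ Finset.univ.image
          (Sum.elim h fun _ => h (Sum.inr ()) + 1 : ((β ⊕ Unit) ⊕ Unit) → ℕ) := by
        intro n hn
        rcases Finset.mem_insert.1 hn with rfl | hn
        · exact Finset.mem_image.2 ⟨Sum.inr (), Finset.mem_univ _, rfl⟩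
        obtain ⟨i, -, rfl⟩ := Finset.mem_image.1 hn
        exact Finset.mem_image.2 ⟨Sum.inl i, Finset.mem_univ _, rfl⟩
      have := Finset.card_le_card this
      rw [Fintype.card_sum, Fintype.card_unit]
      rw [Finset.card_insert_of_notMem] at this
      · omega
      · intro hn
        obtain ⟨i, -, hi⟩ := Finset.mem_image.1 hn
        have := hh i
        omega
    · simpa using hx
    · intro g w hg hw
      obtain ⟨g', w', rfl, hg', hw'⟩ := InU.exists_blk hh hg
      rw [hsplit, Module.End.mul_apply, ← e, hf g' w' hg' hw', x.2 w]
      simp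

theorem hasFixed_T (hF : Odd (Fintype.card F)) : ∀ k, HasFixed.{u} F (T 0 k)
  | 0 => hasFixed_of_isEmpty (β := Fin 0)
  | k + 1 => (hasFixed_T hF k).sum_unit hF

end Mirabolic

namespace Mirabolic

variable {F : Type} [Field F] [Fintype F] [DecidableEq F] {α β γ : Type} [Fintype α] [Fintype β]
  [Fintype γ] [DecidableEq α] [DecidableEq β] [DecidableEq γ]

theorem InU.mul {h : α → ℕ} {u v : Matrix α α F} (hu : InU h u) (hv : InU h v) : InU h (u * v) := by
  intro i j hij
  rw [Matrix.mul_apply, Finset.sum_eq_single i]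
  · rw [hu i i (lt_irrefl _), hv i j hij, Matrix.one_apply_eq, one_mul]
  · intro k _ hk
    by_cases hik : h i < h k
    · rw [hv k j (by omega), Matrix.one_apply_ne (by rintro rfl; exact hij hik), mul_zero]
    · rw [hu i k hik, Matrix.one_apply_ne (Ne.symm hk), zero_mul]
  · simp

theorem inU_one (h : α → ℕ) : InU h (1 : Matrix α α F) := fun _ _ _ => rfl

open Classical in
/-- The invertible matrices satisfying `InU h`. -/
noncomputable def unip (F : Type) [Field F] [Fintype F] (h : α → ℕ) : Finset (Matrix α α F) :=
  Finset.univ.filter fun u => InU h u ∧ IsUnit u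

theorem mem_unip {h : α → ℕ} {u : Matrix α α F} : u ∈ unip F h ↔ InU h u ∧ IsUnit u := by
  simp [unip]

theorem unip_unit (c : ℕ) : unip F (fun _ : Unit => c) = {1} := by
  ext u
  rw [mem_unip, Finset.mem_singleton]
  constructor
  · rintro ⟨h, -⟩
    ext i j
    exact h i j (lt_irrefl _)
  · rintro rfl
    exact ⟨inU_one _, isUnit_one⟩

theorem fromBlocks_mem_unip {h₁ : α → ℕ} {h₂ : β → ℕ} (h : ∀ i j, h₁ i < h₂ j) {A : Matrix α α F}
    {B : Matrix α β F} {C : Matrix β α F} {D : Matrix β β F} :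
    fromBlocks A B C D ∈ unip F (Sum.elim h₁ h₂) ↔ A ∈ unip F h₁ ∧ D ∈ unip F h₂ ∧ C = 0 := by
  simp only [mem_unip]
  constructor
  · rintro ⟨hu, hi⟩
    have hC : C = 0 := by
      ext i j
      simpa using hu (Sum.inr i) (Sum.inl j) (by simpa using (h j i).le)
    subst hC
    rw [isUnit_fromBlocks_zero₂₁] at hi
    refine ⟨⟨fun i j hij => ?_, hi.1⟩, ⟨fun i j hij => ?_, hi.2⟩, rfl⟩
    · simpa [Matrix.one_apply] using hu (Sum.inl i) (Sum.inl j) hij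
    · simpa [Matrix.one_apply] using hu (Sum.inr i) (Sum.inr j) hij
  · rintro ⟨⟨hA, hA'⟩, ⟨hD, hD'⟩, rfl⟩
    refine ⟨?_, isUnit_fromBlocks_zero₂₁.2 ⟨hA', hD'⟩⟩
    rintro (i | i) (j | j) hij
    · simpa [Matrix.one_apply] using hA i j hij
    · exact absurd (h i j) hij
    · simp
    · simpa [Matrix.one_apply] using hD i j hij

/-- The sum of a class function over a unipotent subgroup. -/
noncomputable def nh (h : α → ℕ) (f : ClassFn F) : ℂ := ∑ u ∈ unip F h, f α u

theorem nh_reindex (e : α ≃ β) (h : β → ℕ) (f : ClassFn F) : nh (h ∘ e) f = nh h f := by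
  refine Finset.sum_nbij' (Matrix.reindex e e) (Matrix.reindex e.symm e.symm) ?_ ?_ ?_ ?_ ?_
  · intro u hu
    rw [mem_unip] at hu ⊢
    refine ⟨fun i j hij => ?_, ?_⟩
    · have := hu.1 (e.symm i) (e.symm j) (by simpa using hij)
      simpa [Matrix.one_apply] using this
    · have := hu.2
      rw [isUnit_iff_isUnit_det] at this ⊢
      rwa [det_reindex_self]
  · intro u hu
    rw [mem_unip] at hu ⊢
    refine ⟨fun i j hij => ?_, ?_⟩
    · have := hu.1 (e i) (e j) hij
      simpa [Matrix.one_apply] using this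
    · have := hu.2
      rw [isUnit_iff_isUnit_det] at this ⊢
      rwa [det_reindex_self]
  · intro u _; ext; simp
  · intro u _; ext; simp
  · intro u _; rw [ClassFn.apply_reindex]

theorem nh_sumElim {h₁ : α → ℕ} {h₂ : β → ℕ} (h : ∀ i j, h₁ i < h₂ j) (f : ClassFn F) :
    nh (Sum.elim h₁ h₂) f = ∑ A ∈ unip F h₁, nh h₂ (ClassFn.mu A f) := by
  simp only [nh, ClassFn.mu_apply', ← Finset.sum_product']
  refine Finset.sum_bij' (fun u _ => (u.toBlocks₁₁, u.toBlocks₂₂, u.toBlocks₁₂))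
    (fun p _ => fromBlocks p.1 p.2.2 0 p.2.1) ?_ ?_ ?_ ?_ ?_
  · intro u hu
    rw [← fromBlocks_toBlocks u, fromBlocks_mem_unip h] at hu
    simpa using ⟨hu.1, hu.2.1⟩
  · rintro ⟨A, D, B⟩ hp
    simp only [Finset.mem_product] at hp
    exact (fromBlocks_mem_unip h).2 ⟨hp.1, hp.2.1, rfl⟩
  · intro u hu
    rw [← fromBlocks_toBlocks u, fromBlocks_mem_unip h] at hu
    conv_rhs => rw [← fromBlocks_toBlocks u, hu.2.2]
  · rintro ⟨A, D, B⟩ hp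
    simp
  · intro u hu
    have hu' := hu
    rw [← fromBlocks_toBlocks u, fromBlocks_mem_unip h] at hu'
    conv_lhs => rw [← fromBlocks_toBlocks u, hu'.2.2]

/-- The operator `mu` attached to the one by one identity matrix. -/
noncomputable def del : ClassFn F →ₗ[ℂ] ClassFn F := ClassFn.mu (1 : Matrix Unit Unit F)

theorem nh_del {h₁ : α → ℕ} {c : ℕ} {h₂ : β → ℕ} (hc₁ : ∀ i, h₁ i < c) (hc₂ : ∀ i, c < h₂ i)
    (f : ClassFn F) : nh (Sum.elim h₁ (Sum.elim (fun _ : Unit => c) h₂)) f =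
      nh (Sum.elim h₁ h₂) (del f) := by
  rw [nh_sumElim, nh_sumElim fun i j => (hc₁ i).trans (hc₂ j)]
  · refine Finset.sum_congr rfl fun A _ => ?_
    rw [nh_sumElim fun _ j => hc₂ j, unip_unit, Finset.sum_singleton, del, ClassFn.mu_comm]
  · rintro i (j | j)
    · exact hc₁ i
    · exact (hc₁ i).trans (hc₂ j)

theorem nh_remove {h : α → ℕ} (i : α) (hi : ∀ j, j ≠ i → h j ≠ h i) (f : ClassFn F) :
    nh h f = nh (fun j : {j // j ≠ i} => h j) (del f) := by
  let e : {j // h j < h i} ⊕ Unit ⊕ {j // h i < h j} ≃ α := Equiv.ofBijective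
    (Sum.elim (fun j => j) (Sum.elim (fun _ => i) fun j => j)) (by
      constructor
      · rintro (⟨j, hj⟩ | j | ⟨j, hj⟩) (⟨k, hk⟩ | k | ⟨k, hk⟩) hjk <;> simp at hjk <;>
          first | rfl | (subst hjk; first | rfl | omega)
      · intro j
        rcases lt_trichotomy (h j) (h i) with hj | hj | hj
        · exact ⟨Sum.inl ⟨j, hj⟩, rfl⟩
        · refine ⟨Sum.inr (Sum.inl ()), ?_⟩
          by_contra hne
          exact hi j (Ne.symm hne) hj
        · exact ⟨Sum.inr (Sum.inr ⟨j, hj⟩), rfl⟩)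
  let e' : {j // h j < h i} ⊕ {j // h i < h j} ≃ {j // j ≠ i} := Equiv.ofBijective
    (Sum.elim (fun j => ⟨j, by rintro h; have := j.2; rw [h] at this; omega⟩)
      fun j => ⟨j, by rintro h; have := j.2; rw [h] at this; omega⟩) (by
      constructor
      · rintro (⟨j, hj⟩ | ⟨j, hj⟩) (⟨k, hk⟩ | ⟨k, hk⟩) hjk <;> simp at hjk <;> subst hjk <;>
          first | rfl | omega
      · rintro ⟨j, hji⟩
        rcases lt_or_gt_of_ne (hi j hji) with hj | hj
        · exact ⟨Sum.inl ⟨j, hj⟩, rfl⟩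
        · exact ⟨Sum.inr ⟨j, hj⟩, rfl⟩)
  rw [← nh_reindex e, ← nh_reindex e']
  have h1 : h ∘ e = Sum.elim (fun j : {j // h j < h i} => h j) (Sum.elim (fun _ => h i)
      fun j : {j // h i < h j} => h j) := by
    ext (j | j | j) <;> rfl
  have h2 : (fun j : {j // j ≠ i} => h j) ∘ e' = Sum.elim (fun j : {j // h j < h i} => h j)
      fun j : {j // h i < h j} => h j := by
    ext (j | j) <;> rfl
  rw [h1, h2]
  exact nh_del (fun j => j.2) (fun j => j.2) f

theorem exists_isolated {h : α → ℕ} {a : ℕ} (hc : a < Fintype.card α)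
    (ha : 2 * Fintype.card α ≤ a + 2 * (Finset.univ.image h).card) :
    ∃ i, ∀ j, j ≠ i → h j ≠ h i := by
  by_contra! hne
  have := Finset.mul_card_image_le_card (f := h) (Finset.univ : Finset α) 2 ?_
  · rw [Finset.card_univ] at this
    omega
  · intro n hn
    obtain ⟨i, -, rfl⟩ := Finset.mem_image.1 hn
    obtain ⟨j, hj, hji⟩ := hne i
    exact Finset.one_lt_card.2 ⟨j, by simp [hji], i, by simp, hj⟩

theorem exists_del_ne_zero {a : ℕ} (s : ℕ) : ∀ (α : Type) [Fintype α] [DecidableEq α] (h : α → ℕ)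
    (f : ClassFn F), Fintype.card α = a + s →
    2 * Fintype.card α ≤ a + 2 * (Finset.univ.image h).card → nh h f ≠ 0 →
    ∃ u : Matrix (Fin a) (Fin a) F, IsUnit u ∧ (del^[s] f : ClassFn F) (Fin a) u ≠ 0 := by
  induction s with
  | zero =>
    intro α _ _ h f hs _ hn
    obtain ⟨u, hu, hf⟩ := Finset.exists_ne_zero_of_sum_ne_zero hn
    let e : α ≃ Fin a := Fintype.equivFinOfCardEq hs
    refine ⟨Matrix.reindex e e u, ?_, ?_⟩
    · have := (mem_unip.1 hu).2
      rw [isUnit_iff_isUnit_det] at this ⊢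
      rwa [det_reindex_self]
    · rwa [Function.iterate_zero_apply, ClassFn.apply_reindex]
  | succ s ih =>
    intro α _ _ h f hs hr hn
    obtain ⟨i, hi⟩ := exists_isolated (by omega) hr
    rw [nh_remove i hi] at hn
    have hc : Fintype.card {j // j ≠ i} = a + s := by
      rw [Fintype.card_subtype_compl, Fintype.card_subtype_eq]
      omega
    refine ih {j // j ≠ i} _ (del f) hc ?_ hn
    have : Finset.univ.image h ⊆ insert (h i) (Finset.univ.image fun j : {j // j ≠ i} => h j) := by
      intro n hn
      obtain ⟨j, -, rfl⟩ := Finset.mem_image.1 hn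
      by_cases hj : j = i
      · simp [hj]
      · exact Finset.mem_insert_of_mem (Finset.mem_image.2 ⟨⟨j, hj⟩, Finset.mem_univ _, rfl⟩)
    have := (Finset.card_le_card this).trans (Finset.card_insert_le _ _)
    omega

theorem del_iterate_apply (a k : ℕ) {u : Matrix (Fin a) (Fin a) F} (hu : IsUnit u) :
    ∃ v : Matrix (T a k) (T a k) F, IsUnit v ∧ ∀ f : ClassFn F,
      (del^[k] f : ClassFn F) (Fin a) u = ∑ q ∈ Qs F a k, f (T a k) (v * q) := by
  induction k with
  | zero => exact ⟨u, hu, fun f => by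
    rw [Function.iterate_zero_apply, Qs, Finset.sum_singleton]
    exact congrArg (f (Fin a)) (Matrix.mul_one u).symm⟩
  | succ k ih =>
    obtain ⟨v, hv, h⟩ := ih
    have hd := (Matrix.isUnit_iff_isUnit_det v).1 hv
    refine ⟨dg v, isUnit_fromBlocks_zero₂₁.2 ⟨hv, isUnit_one⟩, fun f => ?_⟩
    rw [Function.iterate_succ_apply, h]
    refine Eq.trans ?_ (sum_ext (Qs F a k) (fun q => f (T a k ⊕ Unit) (dg v * q))).symm
    refine Finset.sum_congr rfl fun q _ => ?_
    have hb : Function.Bijective (fun w : Matrix (T a k) Unit F => v * w) := by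
      refine Function.bijective_iff_has_inverse.2 ⟨fun X => v⁻¹ * X, fun X => ?_, fun X => ?_⟩
      · simp [← Matrix.mul_assoc, nonsing_inv_mul v hd]
      · simp [← Matrix.mul_assoc, mul_nonsing_inv v hd]
    rw [del, ClassFn.mu_apply, ← hb.sum_comp]
    refine Finset.sum_congr rfl fun w _ => congrArg (f _) ?_
    simp [dg, fromBlocks_multiply]

end Mirabolic

namespace Mirabolic

universe u

variable {F : Type} [Field F] [Fintype F] [DecidableEq F] {α β : Type} [Fintype α] [Fintype β]
  [DecidableEq α] [DecidableEq β]

/-- The subgroup of invertible matrices satisfying `InU h`. -/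
def unipSubgroup (F : Type) [Field F] [Fintype F] [DecidableEq F] (h : α → ℕ) : Subgroup (Matrix α α F)ˣ :=
  let S : Submonoid (Matrix α α F)ˣ :=
    { carrier := {u | InU h (u : Matrix α α F)}
      mul_mem' := fun hu hv => InU.mul hu hv
      one_mem' := inU_one h }
  { S with
    inv_mem' := by
      intro u hu
      have : IsOfFinOrder u := isOfFinOrder_of_finite u
      obtain ⟨k, hk⟩ := (this.mem_powers_iff_mem_zpowers (y := u⁻¹)).2
        (Subgroup.inv_mem _ (Subgroup.mem_zpowers u))
      exact hk ▸ S.pow_mem hu k }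

theorem nh_ne_zero {X : Type*} [AddCommGroup X] [Module ℂ X] [FiniteDimensional ℂ X]
    (ρ : Representation ℂ (Matrix α α F)ˣ X) (f : ClassFn F)
    (hf : ∀ g : (Matrix α α F)ˣ, f α (g : Matrix α α F) = ρ.character g) (h : α → ℕ) {x : X}
    (hx : x ≠ 0) (hfix : ∀ g : (Matrix α α F)ˣ, InU h (g : Matrix α α F) → ρ g x = x) :
    nh h f ≠ 0 := by
  classical
  let H := unipSubgroup F h
  let σ : Representation ℂ H X := ρ.comp H.subtype
  have : Invertible (Nat.card H : ℂ) := invertibleOfNonzero (Nat.cast_ne_zero.2 Nat.card_pos.ne')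
  have key := σ.card_inv_mul_sum_char_eq_finrank
  have hne : (Module.finrank ℂ σ.invariants : ℂ) ≠ 0 := by
    rw [Nat.cast_ne_zero, ← Nat.pos_iff_ne_zero, Module.finrank_pos_iff_exists_ne_zero]
    exact ⟨⟨x, fun g => hfix g.1 g.2⟩, fun h0 => hx (congrArg Subtype.val h0)⟩
  have hs : nh h f = ∑ g : H, σ.character g := by
    refine (Finset.sum_bij (fun (g : H) _ => ((g : (Matrix α α F)ˣ) : Matrix α α F)) ?_ ?_ ?_ ?_).symm
    · intro g _
      exact mem_unip.2 ⟨g.2, g.1.isUnit⟩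
    · intro g _ g' _ hg
      exact Subtype.ext (Units.ext hg)
    · intro u hu
      obtain ⟨hu, g, rfl⟩ := mem_unip.1 hu
      exact ⟨⟨g, hu⟩, Finset.mem_univ _, rfl⟩
    · intro g _
      exact (hf g.1).symm
  rw [hs]
  intro h0
  rw [h0, mul_zero] at key
  exact hne key.symm

theorem card_T (a k : ℕ) : Fintype.card (T a k) = a + k := by
  induction k with
  | zero => exact Fintype.card_fin a
  | succ k ih =>
    refine (Fintype.card_sum (α := T a k) (β := Unit)).trans ?_
    rw [ih, Fintype.card_unit, add_assoc]

theorem exists_sum_Qs_ne_zero (hF : Odd (Fintype.card F)) {a k m n : ℕ} (ha : 2 * m ≤ a)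
    (hn : a + k = n) {X : Type u} [AddCommGroup X] [Module ℂ X] [FiniteDimensional ℂ X]
    (ρ : Representation ℂ (GL (Fin n) F) X) (hX : ¬ 2 ^ m ∣ Module.finrank ℂ X) (f : ClassFn F)
    (hf : ∀ g : GL (Fin n) F, f (Fin n) (g : Matrix (Fin n) (Fin n) F) = ρ.character g) :
    ∃ v : Matrix (T a k) (T a k) F, IsUnit v ∧ ∑ q ∈ Qs F a k, f (T a k) (v * q) ≠ 0 := by
  have hm : m ≠ 0 := by
    rintro rfl
    simp at hX
  obtain ⟨n, rfl⟩ : ∃ n', n = n' + 1 := ⟨n - 1, by omega⟩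
  have e : T 0 n ⊕ Unit ≃ Fin (n + 1) := Fintype.equivFinOfCardEq (by simp [card_T])
  let R : (Matrix (T 0 n ⊕ Unit) (T 0 n ⊕ Unit) F)ˣ →* GL (Fin (n + 1)) F :=
    Units.map (Matrix.reindexAlgEquiv F F e).toAlgHom.toMonoidHom
  let ρ' : Representation ℂ (Matrix (T 0 n ⊕ Unit) (T 0 n ⊕ Unit) F)ˣ X := ρ.comp R
  have hf' : ∀ g : (Matrix (T 0 n ⊕ Unit) (T 0 n ⊕ Unit) F)ˣ,
      f (T 0 n ⊕ Unit) (g : Matrix (T 0 n ⊕ Unit) (T 0 n ⊕ Unit) F) = ρ'.character g := by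
    intro g
    rw [← ClassFn.apply_reindex f e]
    exact hf (R g)
  obtain ⟨h, hh, hc, x, hx, hfix⟩ := hasFixed_T hF n m X (fun g w => ρ' (blk g w))
    ⟨by rw [blk_one, map_one], fun g w g' w' => by rw [← map_mul, blk_mul]⟩ hX
  have hnh := nh_ne_zero ρ' f hf' h hx fun u hu => by
    obtain ⟨g, w, rfl, hg, hw⟩ := hu.exists_blk hh
    exact hfix g w hg hw
  rw [card_T] at hc
  obtain ⟨u, hu, hne⟩ := exists_del_ne_zero (a := a) k (T 0 n ⊕ Unit) h f
    (by rw [Fintype.card_sum, card_T, Fintype.card_unit]; omega)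
    (by rw [Fintype.card_sum, card_T, Fintype.card_unit]; omega) hnh
  obtain ⟨v, hv, hvf⟩ := del_iterate_apply (F := F) a k hu
  exact ⟨v, hv, by rwa [← hvf]⟩

end Mirabolic

namespace IrrChar

variable {G : Type} [Group G] [Fintype G]

/-- Irreducible complex characters of `G`. -/
def IsIrr (χ : G → ℂ) : Prop := ∃ V : FDRep ℂ G, Simple V ∧ χ = V.character

/-- Functions that are constant on conjugacy classes. -/
def IsClass (φ : G → ℂ) : Prop := ∀ g h, φ (h * g * h⁻¹) = φ g

theorem card_ne_zero : (Nat.card G : ℂ) ≠ 0 := Nat.cast_ne_zero.2 Nat.card_pos.ne'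

theorem IsIrr.isClass {χ : G → ℂ} (h : IsIrr χ) : IsClass χ := by
  obtain ⟨V, -, rfl⟩ := h
  exact fun g h => V.char_conj g h

open Classical in
theorem IsIrr.sum_mul_inv {χ ψ : G → ℂ} (hχ : IsIrr χ) (hψ : IsIrr ψ) :
    ∑ g, χ g * ψ g⁻¹ = if χ = ψ then (Nat.card G : ℂ) else 0 := by
  have := invertibleOfNonzero (card_ne_zero (G := G))
  obtain ⟨V, hV, hχV⟩ := id hχ
  obtain ⟨W, hW, rfl⟩ := hψ
  subst hχV
  split_ifs with h
  · rw [← h]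
    exact (FDRep.simple_iff_char_is_norm_one V).1 hV
  · have key := FDRep.char_orthonormal V W
    rw [if_neg (fun ⟨i⟩ => h (FDRep.char_iso i))] at key
    exact (mul_eq_zero.1 key).resolve_left (inv_ne_zero card_ne_zero)

theorem isIrr_of_norm {X : Type} [AddCommGroup X] [Module ℂ X] [FiniteDimensional ℂ X]
    (ρ : Representation ℂ G X) (h : ∑ g, ρ.character g * ρ.character g⁻¹ = Nat.card G) :
    IsIrr ρ.character :=
  ⟨FDRep.of ρ, (FDRep.simple_iff_char_is_norm_one _).2 h, rfl⟩

theorem isIrr_of_isIrreducible {X : Type} [AddCommGroup X] [Module ℂ X] [FiniteDimensional ℂ X]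
    (ρ : Representation ℂ G X) [ρ.IsIrreducible] : IsIrr ρ.character := by
  have := invertibleOfNonzero (card_ne_zero (G := G))
  refine isIrr_of_norm ρ ?_
  have key := Representation.char_orthonormal ρ ρ
  rw [if_pos ⟨Representation.Equiv.refl ρ⟩, inv_mul_eq_one₀ card_ne_zero] at key
  exact key.symm

theorem IsIrr.inv {χ : G → ℂ} (h : IsIrr χ) : IsIrr fun g => χ g⁻¹ := by
  obtain ⟨V, hV, rfl⟩ := h
  rw [show (fun g => V.character g⁻¹) = (FDRep.of (Representation.dual V.ρ)).character from
    funext fun g => (V.char_dual g).symm]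
  refine ⟨_, (FDRep.simple_iff_char_is_norm_one _).2 ?_, rfl⟩
  rw [← (FDRep.simple_iff_char_is_norm_one V).1 hV, ← Equiv.sum_comp (Equiv.inv G)]
  exact Finset.sum_congr rfl fun g _ => by simp [FDRep.char_dual]

theorem exists_smul_of_norm {X : Type} [AddCommGroup X] [Module ℂ X] [FiniteDimensional ℂ X]
    (ρ : Representation ℂ G X) (h : ∑ g, ρ.character g * ρ.character g⁻¹ = Nat.card G)
    {φ : G → ℂ} (hφ : IsClass φ) : ∃ c : ℂ, ∑ g, φ g • ρ g = c • 1 := by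
  have := invertibleOfNonzero (card_ne_zero (G := G))
  have key := Representation.card_inv_mul_sum_char_mul_char_eq_finrank ρ ρ
  rw [h, inv_mul_cancel₀ card_ne_zero, eq_comm, Nat.cast_eq_one] at key
  have comm : ∀ x v, (∑ g, φ g • ρ g) (ρ x v) = ρ x ((∑ g, φ g • ρ g) v) := by
    intro x v
    simp only [LinearMap.sum_apply, LinearMap.smul_apply, map_sum, map_smul]
    refine Finset.sum_bij (fun g _ => x⁻¹ * g * x) (fun _ _ => Finset.mem_univ _) ?_ ?_ ?_
    · intro a _ b _ hab
      simpa using hab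
    · intro b _
      exact ⟨x * b * x⁻¹, Finset.mem_univ _, by group⟩
    · intro g _
      have h1 := hφ g x⁻¹
      rw [inv_inv] at h1
      rw [h1, ← Module.End.mul_apply, ← Module.End.mul_apply, ← map_mul, ← map_mul]
      congr 3
      group
  let t : ρ.IntertwiningMap ρ :=
    LinearMap.intertwiningMap_of_isIntertwiningMap ρ ρ (∑ g, φ g • ρ g) comm
  by_cases h0 : Representation.IntertwiningMap.id ρ = 0
  · refine ⟨0, LinearMap.ext fun v => ?_⟩
    have : v = 0 := DFunLike.congr_fun h0 v
    rw [this, map_zero, map_zero]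
  · obtain ⟨c, hc⟩ := (finrank_eq_one_iff_of_nonzero' _ h0).1 key t
    exact ⟨c, LinearMap.ext fun v => (DFunLike.congr_fun hc v).symm⟩

theorem IsIrr.exists_rep {χ : G → ℂ} (h : IsIrr χ) :
    ∃ (X : Type) (_ : AddCommGroup X) (_ : Module ℂ X) (_ : FiniteDimensional ℂ X)
      (ρ : Representation ℂ G X), χ = ρ.character ∧
        ∑ g, ρ.character g * ρ.character g⁻¹ = Nat.card G := by
  obtain ⟨V, hV, rfl⟩ := h
  exact ⟨V, inferInstance, inferInstance, inferInstance, V.ρ, rfl,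
    (FDRep.simple_iff_char_is_norm_one V).1 hV⟩

open Classical in
theorem IsIrr.convolution {χ ψ : G → ℂ} (hχ : IsIrr χ) (hψ : IsIrr ψ) (z : G) :
    ψ 1 * ∑ y, χ y * ψ (y⁻¹ * z) = if χ = ψ then (Nat.card G : ℂ) * ψ z else 0 := by
  have hs := hχ.sum_mul_inv hψ
  obtain ⟨X, _, _, _, ρ, rfl, hρ⟩ := hψ.exists_rep
  obtain ⟨c, hc⟩ := exists_smul_of_norm ρ hρ hχ.inv.isClass
  have h1 : ∀ z, ∑ y, χ y * ρ.character (y⁻¹ * z) = c * ρ.character z := by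
    intro z
    have := congrArg (fun T => LinearMap.trace ℂ X (T * ρ z)) hc
    simp only [Finset.sum_mul, map_sum, smul_mul_assoc, map_smul, ← map_mul, one_mul,
      smul_eq_mul] at this
    rw [← Equiv.sum_comp (Equiv.inv G)]
    simpa [Representation.character] using this
  rw [h1, mul_left_comm, ← mul_assoc, ← h1 1]
  simp only [mul_one, hs]
  split_ifs <;> ring

open scoped MonoidAlgebra

theorem sum_single_smul_eq_zero {φ : G → ℂ} (hφ : IsClass φ)
    (h : ∀ χ, IsIrr χ → ∑ g, φ g * χ g = 0) (M : Type) [AddCommGroup M] [Module ℂ M]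
    [Module ℂ[G] M] [IsScalarTower ℂ ℂ[G] M] [IsSimpleModule ℂ[G] M] [FiniteDimensional ℂ M]
    (x : M) : (∑ g, MonoidAlgebra.single g (φ g) : ℂ[G]) • x = 0 := by
  let ρ : Representation ℂ G M := Representation.ofModule' M
  have hlift : ρ.asAlgebraHom = Algebra.lsmul ℂ ℂ M :=
    (MonoidAlgebra.lift ℂ (M →ₗ[ℂ] M) G).apply_symm_apply _
  let e : ρ.asModule ≃ₗ[ℂ[G]] M :=
    { ρ.asModuleEquiv with
      map_smul' := fun r v => LinearMap.congr_fun (DFunLike.congr_fun hlift r) _ }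
  have : ρ.IsIrreducible :=
    ρ.irreducible_iff_isSimpleModule_asModule.2 (IsSimpleModule.congr e)
  have hirr := isIrr_of_isIrreducible ρ
  obtain ⟨c, hc⟩ := exists_smul_of_norm ρ (by simpa using hirr.sum_mul_inv hirr) hφ
  have ht := congrArg (LinearMap.trace ℂ _) hc
  simp only [map_sum, map_smul, smul_eq_mul, LinearMap.trace_one] at ht
  have h0 := h _ hirr
  simp only [Representation.character] at h0
  rw [h0] at ht
  have := IsSimpleModule.nontrivial ℂ[G] M
  have hc0 : c = 0 := (mul_eq_zero.1 ht.symm).resolve_right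
    (Nat.cast_ne_zero.2 (Module.finrank_pos (R := ℂ)).ne')
  rw [hc0, zero_smul] at hc
  have key : ρ.asAlgebraHom (∑ g, MonoidAlgebra.single g (φ g)) = 0 := by
    simpa only [map_sum, Representation.asAlgebraHom_single] using hc
  rw [hlift] at key
  exact LinearMap.congr_fun key x

theorem eq_zero_of_forall_sum_eq_zero {φ : G → ℂ} (hφ : IsClass φ)
    (h : ∀ χ, IsIrr χ → ∑ g, φ g * χ g = 0) : φ = 0 := by
  have hz : (∑ g, MonoidAlgebra.single g (φ g) : ℂ[G]) ∈ Ring.jacobson ℂ[G] := by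
    rw [Ring.jacobson, Module.jacobson, Submodule.mem_sInf]
    intro I hI
    have : IsSimpleModule ℂ[G] (ℂ[G] ⧸ I) := isSimpleModule_iff_isCoatom.2 hI
    have := sum_single_smul_eq_zero hφ h (ℂ[G] ⧸ I) (Submodule.Quotient.mk 1)
    rwa [← Submodule.Quotient.mk_smul, smul_eq_mul, mul_one, Submodule.Quotient.mk_eq_zero] at this
  rw [IsSemisimpleRing.jacobson_eq_bot, Submodule.mem_bot] at hz
  classical
  funext x
  have := congrArg (fun z : ℂ[G] => z.coeff x) hz
  simpa [Finsupp.finsetSum_apply, Finsupp.single_apply] using this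

end IrrChar

namespace IrrChar

variable {G : Type} [Group G] [Fintype G]

theorem linearIndependent_irr :
    LinearIndependent ℂ (Subtype.val : {χ : G → ℂ // IsIrr χ} → G → ℂ) := by
  classical
  rw [linearIndependent_iff']
  intro s c hc ψ hψ
  have h1 : ∑ χ ∈ s, c χ * ∑ g, χ.1 g * ψ.1 g⁻¹ = 0 := by
    simp only [Finset.mul_sum]
    rw [Finset.sum_comm]
    refine Finset.sum_eq_zero fun g _ => ?_
    simp only [← mul_assoc, ← Finset.sum_mul]
    have := congrFun hc g
    simp only [Finset.sum_apply, Pi.smul_apply, smul_eq_mul, Pi.zero_apply] at this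
    rw [this, zero_mul]
  rw [Finset.sum_eq_single ψ, ψ.2.sum_mul_inv ψ.2, if_pos rfl] at h1
  · exact (mul_eq_zero.1 h1).resolve_right card_ne_zero
  · intro χ _ hne
    rw [χ.2.sum_mul_inv ψ.2, if_neg (fun h => hne (Subtype.ext h)), mul_zero]
  · exact fun h => absurd hψ h

instance finite_irr : Finite {χ : G → ℂ // IsIrr χ} :=
  linearIndependent_irr.finite

noncomputable instance : Fintype {χ : G → ℂ // IsIrr χ} := Fintype.ofFinite _

theorem IsClass.expand {φ : G → ℂ} (hφ : IsClass φ) (h : G) :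
    Nat.card G * φ h = ∑ χ : {χ : G → ℂ // IsIrr χ}, (∑ g, φ g * χ.1 g⁻¹) * χ.1 h := by
  classical
  let δ : G → ℂ := fun h =>
    Nat.card G * φ h - ∑ χ : {χ : G → ℂ // IsIrr χ}, (∑ g, φ g * χ.1 g⁻¹) * χ.1 h
  suffices δ = 0 from sub_eq_zero.1 (congrFun this h)
  refine eq_zero_of_forall_sum_eq_zero (fun g x => ?_) fun ψ hψ => ?_
  · simp only [δ, hφ g x]
    exact congrArg _ (Finset.sum_congr rfl fun χ _ => by rw [χ.2.isClass g x])
  · simp only [δ, sub_mul, Finset.sum_sub_distrib, Finset.sum_mul]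
    rw [Finset.sum_comm, sub_eq_zero]
    have h1 : ∀ χ : {χ : G → ℂ // IsIrr χ}, ∑ x, (∑ g, φ g * χ.1 g⁻¹) * χ.1 x * ψ x =
        (∑ g, φ g * χ.1 g⁻¹) * if χ = ⟨_, hψ.inv⟩ then (Nat.card G : ℂ) else 0 := by
      intro χ
      have := χ.2.sum_mul_inv hψ.inv
      simp only [inv_inv] at this
      simp only [mul_assoc, ← Finset.mul_sum, this, Subtype.ext_iff]
    simp only [← Finset.sum_mul]
    simp only [h1]
    rw [
      Finset.sum_eq_single (⟨_, hψ.inv⟩ : {χ : G → ℂ // IsIrr χ})]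
    · simp only [if_true, inv_inv, Finset.sum_mul]
      exact Finset.sum_congr rfl fun x _ => by ring
    · intro χ _ hne
      rw [if_neg hne, mul_zero]
    · simp

open Classical in
/-- The conjugacy class of `g`. -/
noncomputable def cl (g : G) : Finset G := Finset.univ.filter fun x => IsConj g x

theorem mem_cl {g x : G} : x ∈ cl g ↔ IsConj g x := by simp [cl]

theorem IsClass.eq_of_isConj {φ : G → ℂ} (hφ : IsClass φ) {g x : G} (h : IsConj g x) :
    φ x = φ g := by
  obtain ⟨c, rfl⟩ := isConj_iff.1 h
  exact hφ g c

theorem isConj_inv {g x : G} (h : IsConj g x) : IsConj g⁻¹ x⁻¹ := by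
  obtain ⟨c, rfl⟩ := isConj_iff.1 h
  exact isConj_iff.2 ⟨c, by group⟩

theorem cl_eq {g x : G} (h : IsConj g x) : cl g = cl x := by
  ext y
  rw [mem_cl, mem_cl]
  exact ⟨fun h' => h.symm.trans h', fun h' => h.trans h'⟩

theorem card_cl_ne_zero (g : G) : ((cl g).card : ℂ) ≠ 0 :=
  Nat.cast_ne_zero.2 (Finset.card_ne_zero_of_mem (mem_cl.2 (IsConj.refl g)))

open Classical in
theorem sum_sq (g : G) : ∑ χ : {χ : G → ℂ // IsIrr χ}, χ.1 g * χ.1 g =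
    if IsConj g⁻¹ g then (Nat.card G : ℂ) * ((cl g⁻¹).card : ℂ)⁻¹ else 0 := by
  have hφ : IsClass fun x => if x ∈ cl g⁻¹ then (1 : ℂ) else 0 := by
    intro x h
    have : IsConj x (h * x * h⁻¹) := isConj_iff.2 ⟨h, rfl⟩
    simp only [mem_cl]
    refine if_congr ⟨fun h' => h'.trans this.symm, fun h' => h'.trans this⟩ rfl rfl
  have key := hφ.expand g
  have h1 : ∀ χ : {χ : G → ℂ // IsIrr χ},
      ∑ x, (if x ∈ cl g⁻¹ then (1 : ℂ) else 0) * χ.1 x⁻¹ = (cl g⁻¹).card * χ.1 g := by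
    intro χ
    simp only [ite_mul, one_mul, zero_mul, Finset.sum_ite_mem, Finset.univ_inter]
    rw [Finset.sum_congr rfl fun x hx => χ.2.isClass.eq_of_isConj (g := g) (x := x⁻¹)
      (by simpa using isConj_inv (mem_cl.1 hx)), Finset.sum_const, nsmul_eq_mul]
  simp only [h1, mul_assoc, ← Finset.mul_sum] at key
  simp only [mem_cl] at key
  rw [← mul_right_inj' (card_cl_ne_zero g⁻¹), ← key]
  have := card_cl_ne_zero g⁻¹
  split_ifs
  · field_simp
  · simp

open Classical in
theorem card_selfDual : (Nat.card {χ : G → ℂ // IsIrr χ ∧ ∀ x, χ x⁻¹ = χ x} : ℝ) =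
    ∑ g : G, if IsConj g⁻¹ g then ((cl g⁻¹).card : ℝ)⁻¹ else 0 := by
  have h1 : ∀ χ : {χ : G → ℂ // IsIrr χ}, ∑ g, χ.1 g * χ.1 g =
      (Nat.card G : ℂ) * if ∀ x, χ.1 x⁻¹ = χ.1 x then 1 else 0 := by
    intro χ
    have := χ.2.sum_mul_inv χ.2.inv
    simp only [inv_inv] at this
    rw [this, mul_ite, mul_one, mul_zero]
    exact if_congr ⟨fun h x => (congrFun h x).symm, fun h => funext fun x => (h x).symm⟩ rfl rfl
  have h2 : (Nat.card G : ℂ) * Nat.card {χ : G → ℂ // IsIrr χ ∧ ∀ x, χ x⁻¹ = χ x} =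
      (Nat.card G : ℂ) * ∑ g : G, if IsConj g⁻¹ g then ((cl g⁻¹).card : ℂ)⁻¹ else 0 := by
    have h3 : (∑ χ : {χ : G → ℂ // IsIrr χ}, if ∀ x, χ.1 x⁻¹ = χ.1 x then (1 : ℂ) else 0) =
        Nat.card {χ : G → ℂ // IsIrr χ ∧ ∀ x, χ x⁻¹ = χ x} := by
      rw [Finset.sum_boole, ← Fintype.card_subtype, ← Nat.card_eq_fintype_card]
      exact congrArg _ (Nat.card_congr
        (Equiv.subtypeSubtypeEquivSubtypeInter IsIrr fun χ : G → ℂ => ∀ x, χ x⁻¹ = χ x))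
    rw [← h3, Finset.mul_sum]
    simp only [← h1]
    rw [Finset.sum_comm, Finset.mul_sum]
    simp only [sum_sq, mul_ite, mul_zero]
  have h4 := mul_left_cancel₀ card_ne_zero h2
  apply Complex.ofReal_injective
  rw [Complex.ofReal_natCast, h4, Complex.ofReal_sum]
  simp only [apply_ite Complex.ofReal, Complex.ofReal_inv, Complex.ofReal_natCast,
    Complex.ofReal_zero]

theorem card_le_card_selfDual {I : Type} [Fintype I] (r : I → G)
    (hr : ∀ i, IsConj (r i)⁻¹ (r i)) (hinj : ∀ i j, IsConj (r i) (r j) → i = j) :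
    Fintype.card I ≤ Nat.card {χ : G → ℂ // IsIrr χ ∧ ∀ x, χ x⁻¹ = χ x} := by
  classical
  have h : (Fintype.card I : ℝ) ≤ Nat.card {χ : G → ℂ // IsIrr χ ∧ ∀ x, χ x⁻¹ = χ x} := by
    rw [card_selfDual]
    have h1 : (Fintype.card I : ℝ) = ∑ i, ∑ g ∈ cl (r i),
        if IsConj g⁻¹ g then ((cl g⁻¹).card : ℝ)⁻¹ else 0 := by
      rw [← Finset.card_univ, Finset.card_eq_sum_ones, Nat.cast_sum]
      refine Finset.sum_congr rfl fun i _ => ?_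
      have h2 : ∀ g ∈ cl (r i), (if IsConj g⁻¹ g then ((cl g⁻¹).card : ℝ)⁻¹ else 0) =
          ((cl (r i)).card : ℝ)⁻¹ := by
        intro g hg
        have hg := mem_cl.1 hg
        have : IsConj (r i) g⁻¹ := (hr i).symm.trans (isConj_inv hg)
        rw [if_pos (this.symm.trans hg), cl_eq this]
      rw [Finset.sum_congr rfl h2, Finset.sum_const, nsmul_eq_mul, mul_inv_cancel₀, Nat.cast_one]
      exact Nat.cast_ne_zero.2 (Finset.card_ne_zero_of_mem (mem_cl.2 (IsConj.refl _)))
    rw [h1, ← Finset.sum_biUnion]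
    · refine Finset.sum_le_sum_of_subset_of_nonneg (Finset.subset_univ _) fun g _ _ => ?_
      split_ifs <;> positivity
    · intro i _ j _ hij
      refine Finset.disjoint_left.2 fun g hg hg' => hij (hinj i j ?_)
      exact (mem_cl.1 hg).trans (mem_cl.1 hg').symm
  exact_mod_cast h

theorem IsIrr.apply_one_ne_zero {χ : G → ℂ} (h : IsIrr χ) : χ 1 ≠ 0 := by
  intro h0
  have := h.convolution h 1
  rw [if_pos rfl, h0, zero_mul, mul_zero] at this
  have h1 := h.sum_mul_inv h
  obtain ⟨X, _, _, _, ρ, rfl, hρ⟩ := h.exists_rep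
  rw [Representation.char_one, Nat.cast_eq_zero, Module.finrank_zero_iff] at h0
  have h2 : ∀ g, ρ.character g = 0 := fun g => by
    rw [Representation.character, Subsingleton.elim (ρ g) 0, map_zero]
  simp only [h2, zero_mul, Finset.sum_const_zero] at hρ
  exact card_ne_zero hρ.symm

/-- Averages over a family of group elements separate the irreducible constituents. -/
theorem smul_sum_eq_zero {ι : Type} [Fintype ι] (q : ι → G) (S : Finset (G → ℂ))
    (hS : ∀ χ ∈ S, IsIrr χ) (c : (G → ℂ) → ℂ)
    (h : ∀ x, ∑ i, ∑ χ ∈ S, c χ * χ (x * q i) = 0) {χ : G → ℂ} (hχ : χ ∈ S) (x : G) :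
    c χ * ∑ i, χ (x * q i) = 0 := by
  classical
  have h1 : ∑ y, χ y * ∑ i, ∑ ψ ∈ S, c ψ * ψ (y⁻¹ * x * q i) = 0 :=
    Finset.sum_eq_zero fun y _ => by rw [h, mul_zero]
  have h2 : ∑ i, ∑ ψ ∈ S, c ψ * ∑ y, χ y * ψ (y⁻¹ * (x * q i)) = 0 := by
    rw [← h1]
    simp only [Finset.mul_sum]
    conv_rhs => rw [Finset.sum_comm]
    refine Finset.sum_congr rfl fun i _ => ?_
    rw [Finset.sum_comm]
    refine Finset.sum_congr rfl fun y _ => Finset.sum_congr rfl fun ψ _ => ?_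
    rw [mul_assoc, mul_left_comm]
  have h3 : ∀ ψ ∈ S, ∀ z, ∑ y, χ y * ψ (y⁻¹ * z) =
      if χ = ψ then (ψ 1)⁻¹ * (Nat.card G * ψ z) else 0 := by
    intro ψ hψ z
    have := (hS χ hχ).convolution (hS ψ hψ) z
    rw [← mul_right_inj' (hS ψ hψ).apply_one_ne_zero, this]
    split_ifs
    · rw [mul_inv_cancel_left₀ (hS ψ hψ).apply_one_ne_zero]
    · rw [mul_zero]
  have h4 : ∀ i, ∑ ψ ∈ S, c ψ * ∑ y, χ y * ψ (y⁻¹ * (x * q i)) =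
      (χ 1)⁻¹ * Nat.card G * (c χ * χ (x * q i)) := by
    intro i
    rw [Finset.sum_congr rfl fun ψ hψ => by rw [h3 ψ hψ], Finset.sum_eq_single χ]
    · rw [if_pos rfl]
      ring
    · intro ψ _ hne
      rw [if_neg hne.symm, mul_zero]
    · exact fun h => absurd hχ h
  simp only [h4, ← Finset.mul_sum] at h2
  exact (mul_eq_zero.1 h2).resolve_left
    (mul_ne_zero (inv_ne_zero (hS χ hχ).apply_one_ne_zero) card_ne_zero)

end IrrChar

namespace RealClasses

variable {F : Type} [Field F]

theorem exists_charpoly_eq {g : Polynomial F} (hg : g.Monic) :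
    ∃ D : Matrix (Fin g.natDegree) (Fin g.natDegree) F, D.charpoly = g := by
  have h : ∃ D : Matrix (Fin (AdjoinRoot.powerBasis hg.ne_zero).dim)
      (Fin (AdjoinRoot.powerBasis hg.ne_zero).dim) F, D.charpoly = g :=
    ⟨_, (charpoly_leftMulMatrix (AdjoinRoot.powerBasis hg.ne_zero)).trans
      (AdjoinRoot.minpoly_powerBasis_gen_of_monic hg)⟩
  rwa [AdjoinRoot.powerBasis_dim] at h

theorem exists_charpoly_family (k : ℕ) :
    ∃ D : (Fin k → F) → Matrix (Fin k) (Fin k) F, Function.Injective fun c => (D c).charpoly := by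
  let p : (Fin k → F) → Polynomial F := fun c => ((Polynomial.degreeLTEquiv F k).symm c).1
  have hp : ∀ c, (p c).degree < k := fun c =>
    Polynomial.mem_degreeLT.1 ((Polynomial.degreeLTEquiv F k).symm c).2
  have hm : ∀ c, (Polynomial.X ^ k + p c).Monic := fun c => Polynomial.monic_X_pow_add (hp c)
  have hd : ∀ c, (Polynomial.X ^ k + p c).natDegree = k := fun c => by
    refine Polynomial.natDegree_eq_of_degree_eq_some ?_
    rw [Polynomial.degree_add_eq_left_of_degree_lt, Polynomial.degree_X_pow]
    rw [Polynomial.degree_X_pow]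
    exact hp c
  have : ∀ c, ∃ D : Matrix (Fin k) (Fin k) F, D.charpoly = Polynomial.X ^ k + p c := by
    intro c
    have := exists_charpoly_eq (hm c)
    rwa [hd c] at this
  choose D hD using this
  refine ⟨D, fun c c' h => ?_⟩
  simp only [hD, add_right_inj] at h
  exact (Polynomial.degreeLTEquiv F k).symm.injective (Subtype.ext h)

variable {β γ : Type} [Fintype β] [DecidableEq β] [Fintype γ] [DecidableEq γ]

/-- A product of two involutions. -/
def real (D : Matrix β β F) : Matrix ((β ⊕ β) ⊕ γ) ((β ⊕ β) ⊕ γ) F :=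
  fromBlocks (fromBlocks (D - 1) (-1) (2 - D) 1) 0 0 1

/-- The inverse of `real D`. -/
def realInv (D : Matrix β β F) : Matrix ((β ⊕ β) ⊕ γ) ((β ⊕ β) ⊕ γ) F :=
  fromBlocks (fromBlocks 1 1 (D - 2) (D - 1)) 0 0 1

/-- An involution inverting `real D`. -/
def flip : Matrix ((β ⊕ β) ⊕ γ) ((β ⊕ β) ⊕ γ) F :=
  fromBlocks (fromBlocks 1 1 0 (-1)) 0 0 1

theorem one_eq : (1 : Matrix ((β ⊕ β) ⊕ γ) ((β ⊕ β) ⊕ γ) F) =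
    fromBlocks (fromBlocks 1 0 0 1) 0 0 1 := by
  rw [fromBlocks_one, fromBlocks_one]

theorem real_mul_realInv (D : Matrix β β F) :
    (real D : Matrix ((β ⊕ β) ⊕ γ) ((β ⊕ β) ⊕ γ) F) * realInv D = 1 := by
  simp only [real, realInv, fromBlocks_multiply, one_eq, fromBlocks_inj,
    Matrix.mul_zero, Matrix.zero_mul, add_zero, zero_add, Matrix.mul_one, ← one_add_one_eq_two]
  simp only [and_true]
  refine ⟨?_, ?_, ?_, ?_⟩ <;> noncomm_ring

theorem flip_mul_flip : (flip : Matrix ((β ⊕ β) ⊕ γ) ((β ⊕ β) ⊕ γ) F) * flip = 1 := by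
  simp only [flip, fromBlocks_multiply, one_eq]
  congr 2 <;> simp

theorem flip_mul_real_mul_flip (D : Matrix β β F) :
    (flip : Matrix ((β ⊕ β) ⊕ γ) ((β ⊕ β) ⊕ γ) F) * real D * flip = realInv D := by
  simp only [flip, real, realInv, fromBlocks_multiply, fromBlocks_inj,
    Matrix.mul_zero, Matrix.zero_mul, add_zero, zero_add, Matrix.mul_one, ← one_add_one_eq_two]
  simp only [and_true]
  refine ⟨?_, ?_, ?_, ?_⟩ <;> noncomm_ring

theorem real_add_realInv (D : Matrix β β F) :
    (real D : Matrix ((β ⊕ β) ⊕ γ) ((β ⊕ β) ⊕ γ) F) + realInv D =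
      fromBlocks (fromBlocks D 0 0 D) 0 0 2 := by
  simp only [real, realInv, fromBlocks_add]
  congr 2
  · simp
  · simp
  · simp
  · simp
  · simp
  · simp
  · exact one_add_one_eq_two

variable [DecidableEq F] [Fintype F]

theorem exists_real_family (n : ℕ) : ∃ r : (Fin (n / 2) → F) → GL (Fin n) F,
    (∀ i, IsConj (r i)⁻¹ (r i)) ∧ ∀ i j, IsConj (r i) (r j) → i = j := by
  obtain ⟨D, hD⟩ := exists_charpoly_family (F := F) (n / 2)
  have e : (Fin (n / 2) ⊕ Fin (n / 2)) ⊕ Fin (n % 2) ≃ Fin n :=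
    Fintype.equivFinOfCardEq (by simp; omega)
  let A := Matrix ((Fin (n / 2) ⊕ Fin (n / 2)) ⊕ Fin (n % 2))
    ((Fin (n / 2) ⊕ Fin (n / 2)) ⊕ Fin (n % 2)) F
  let R : (Matrix ((Fin (n / 2) ⊕ Fin (n / 2)) ⊕ Fin (n % 2))
      ((Fin (n / 2) ⊕ Fin (n / 2)) ⊕ Fin (n % 2)) F)ˣ ≃* GL (Fin n) F :=
    Units.mapEquiv (Matrix.reindexAlgEquiv F F e).toMulEquiv
  let s : (Fin (n / 2) → F) → (Matrix ((Fin (n / 2) ⊕ Fin (n / 2)) ⊕ Fin (n % 2))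
      ((Fin (n / 2) ⊕ Fin (n / 2)) ⊕ Fin (n % 2)) F)ˣ := fun c =>
    ⟨real (D c), realInv (D c), real_mul_realInv _, mul_eq_one_comm.1 (real_mul_realInv _)⟩
  have hs : ∀ c, IsConj (s c) (s c)⁻¹ := fun c => isConj_iff.2
    ⟨⟨flip, flip, flip_mul_flip, flip_mul_flip⟩, Units.ext (flip_mul_real_mul_flip _)⟩
  have hinj : ∀ c c', IsConj (s c) (s c') → c = c' := by
    intro c c' h
    obtain ⟨P, hP⟩ := isConj_iff.1 h
    have h1 : (P : A) * real (D c) * ((P⁻¹ : Aˣ) : A) = real (D c') :=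
      congrArg Units.val hP
    have h2 : (P : A) * realInv (D c) * ((P⁻¹ : Aˣ) : A) = realInv (D c') := by
      have := congrArg (fun u => ((u⁻¹ : Aˣ) : A)) hP
      rw [_root_.mul_inv_rev, _root_.mul_inv_rev, inv_inv, ← mul_assoc] at this
      exact this
    have h3 : Matrix.charpoly ((P : A) * (real (D c) + realInv (D c)) * ((P⁻¹ : Aˣ) : A)) =
        Matrix.charpoly (real (D c') + realInv (D c') : A) := by
      rw [← h1, ← h2]
      exact congrArg Matrix.charpoly (by noncomm_ring)
    rw [coe_units_inv, charpoly_units_conj, real_add_realInv, real_add_realInv] at h3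
    simp only [charpoly_fromBlocks_zero₁₂] at h3
    have h4 := mul_right_cancel₀ (charpoly_monic (2 : Matrix (Fin (n % 2)) (Fin (n % 2)) F)).ne_zero h3
    rcases mul_self_eq_mul_self_iff.1 h4 with h5 | h5
    · exact hD h5
    · refine hD ?_
      have h6 := congrArg Polynomial.leadingCoeff h5
      rw [Polynomial.leadingCoeff_neg, charpoly_monic, charpoly_monic] at h6
      have h7 : (D c).charpoly = (-1 : F) • (D c').charpoly := by rw [h5, neg_one_smul]
      rw [← h6, one_smul] at h7
      exact h7
  have hR : ∀ x y, IsConj (R x) (R y) ↔ IsConj x y := by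
    intro x y
    refine ⟨fun h => ?_, fun h => ?_⟩
    · simpa using R.symm.toMonoidHom.map_isConj h
    · exact R.toMonoidHom.map_isConj h
  exact ⟨fun c => R (s c), fun c => by rw [← map_inv, hR]; exact (hs c).symm,
    fun c c' h => hinj c c' ((hR _ _).1 h)⟩

theorem card_pow_le_card_selfDual (n : ℕ) : Fintype.card F ^ (n / 2) ≤
    Nat.card {χ : GL (Fin n) F → ℂ // IrrChar.IsIrr χ ∧ ∀ x, χ x⁻¹ = χ x} := by
  obtain ⟨r, hr, hinj⟩ := exists_real_family (F := F) n
  simpa using IrrChar.card_le_card_selfDual r hr hinj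

end RealClasses

namespace Mirabolic

variable {F : Type} [Field F]

open Classical in
/-- Extension of a function on `GL (Fin n) F` to square matrices of all sizes, by transport of
structure on invertible matrices of size `n` and by zero elsewhere. -/
noncomputable def extend (n : ℕ) :
    (GL (Fin n) F → ℂ) →ₗ[ℂ] (∀ (α : Type) [Fintype α], Matrix α α F → ℂ) where
  toFun ψ α _ x := if h : ∃ g : GL (Fin n) F, ∃ (P : Matrix α (Fin n) F) (Q : Matrix (Fin n) α F),
    P * Q = 1 ∧ Q * P = 1 ∧ x = P * (g : Matrix (Fin n) (Fin n) F) * Q then ψ h.choose else 0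
  map_add' ψ ψ' := by
    funext α _ x
    simp only [Pi.add_apply]
    split_ifs <;> simp
  map_smul' c ψ := by
    funext α _ x
    simp only [Pi.smul_apply]
    split_ifs <;> simp

theorem extend_apply {n : ℕ} {ψ : GL (Fin n) F → ℂ} (hψ : IrrChar.IsClass ψ) {α : Type} [Fintype α]
    [DecidableEq α] (g : GL (Fin n) F) {P : Matrix α (Fin n) F} {Q : Matrix (Fin n) α F}
    (h1 : P * Q = 1) (h2 : Q * P = 1) :
    extend n ψ α (P * (g : Matrix (Fin n) (Fin n) F) * Q) = ψ g := by
  obtain rfl : ‹DecidableEq α› = fun a b => Classical.propDecidable (a = b) :=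
    Subsingleton.elim _ _
  classical
  have h : ∃ g' : GL (Fin n) F, ∃ (P' : Matrix α (Fin n) F) (Q' : Matrix (Fin n) α F),
      P' * Q' = 1 ∧ Q' * P' = 1 ∧ P * (g : Matrix (Fin n) (Fin n) F) * Q = P' * g'.1 * Q' :=
    ⟨g, P, Q, h1, h2, rfl⟩
  have hc : extend n ψ α (P * (g : Matrix (Fin n) (Fin n) F) * Q) = ψ h.choose :=
    dif_pos h
  obtain ⟨P', Q', h1', h2', he⟩ := h.choose_spec
  rw [hc]
  generalize h.choose = g' at he
  have hu1 : (Q' * P) * (Q * P') = 1 := by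
    rw [Matrix.mul_assoc, ← Matrix.mul_assoc P, h1, Matrix.one_mul, h2']
  have hu2 : (Q * P') * (Q' * P) = 1 := by
    rw [Matrix.mul_assoc, ← Matrix.mul_assoc P', h1', Matrix.one_mul, h2]
  let u : GL (Fin n) F := ⟨Q' * P, Q * P', hu1, hu2⟩
  have : g' = u * g * u⁻¹ := by
    refine Units.ext ?_
    change g'.1 = (Q' * P) * g.1 * (Q * P')
    have h3 : (Q' * P) * g.1 * (Q * P') = Q' * (P * g.1 * Q) * P' := by
      simp only [Matrix.mul_assoc]
    rw [h3, he]
    have h4 : Q' * (P' * g'.1 * Q') * P' = (Q' * P') * g'.1 * (Q' * P') := by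
      simp only [Matrix.mul_assoc]
    rw [h4, h2', Matrix.one_mul, Matrix.mul_one]
  rw [this, hψ]

theorem extend_mem {n : ℕ} {ψ : GL (Fin n) F → ℂ} (hψ : IrrChar.IsClass ψ) :
    extend n ψ ∈ ClassFn F := by
  classical
  intro α β _ _ _ _ P Q x h1 h2
  by_cases h : ∃ g : GL (Fin n) F, ∃ (P : Matrix β (Fin n) F) (Q : Matrix (Fin n) β F),
      P * Q = 1 ∧ Q * P = 1 ∧ x = P * (g : Matrix (Fin n) (Fin n) F) * Q
  · obtain ⟨g, P', Q', h1', h2', rfl⟩ := h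
    rw [extend_apply hψ g h1' h2', ← extend_apply (α := α) hψ g (P := P * P') (Q := Q' * Q)]
    · simp only [Matrix.mul_assoc]
    · rw [Matrix.mul_assoc, ← Matrix.mul_assoc P', h1', Matrix.one_mul, h1]
    · rw [Matrix.mul_assoc, ← Matrix.mul_assoc Q, h2, Matrix.one_mul, h2']
  · have h' : ¬ ∃ g : GL (Fin n) F, ∃ (P' : Matrix α (Fin n) F) (Q' : Matrix (Fin n) α F),
        P' * Q' = 1 ∧ Q' * P' = 1 ∧ P * x * Q = P' * (g : Matrix (Fin n) (Fin n) F) * Q' := by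
      rintro ⟨g, P', Q', h1', h2', he⟩
      refine h ⟨g, Q * P', Q' * P, ?_, ?_, ?_⟩
      · rw [Matrix.mul_assoc, ← Matrix.mul_assoc P', h1', Matrix.one_mul, h2]
      · rw [Matrix.mul_assoc, ← Matrix.mul_assoc P, h1, Matrix.one_mul, h2']
      · have h3 : Q * P' * g.1 * (Q' * P) = Q * (P' * g.1 * Q') * P := by
          simp only [Matrix.mul_assoc]
        rw [h3, ← he]
        have h4 : Q * (P * x * Q) * P = (Q * P) * x * (Q * P) := by
          simp only [Matrix.mul_assoc]
        rw [h4, h2, Matrix.one_mul, Matrix.mul_one]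
    rw [extend]
    simp only [LinearMap.coe_mk, AddHom.coe_mk]
    rw [dif_neg, dif_neg]
    · convert h
    · convert h'

variable [Fintype F] [DecidableEq F]

theorem exists_linear_ops (M : Multiset (ℕ × Fˣ)) :
    ∃ L : ClassFn F →ₗ[ℂ] ClassFn F, ∀ f, L f = ops M f := by
  induction M using Multiset.induction with
  | empty => exact ⟨LinearMap.id, fun f => rfl⟩
  | cons p M ih =>
    obtain ⟨L, hL⟩ := ih
    refine ⟨muj p.1 (p.2 : F) ∘ₗ L, fun f => ?_⟩
    rw [LinearMap.comp_apply, hL, ops, ops, Multiset.foldr_cons]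

theorem exists_linear_phi (j : ℕ) : ∀ (α : Type) [Fintype α] [DecidableEq α]
    (z : Matrix (α ⊕ Unit) (α ⊕ Unit) F),
    ∃ L : ClassFn F →ₗ[ℂ] ℂ, ∀ f, L f = phi f j α z := by
  induction j with
  | zero =>
    intro α _ _ z
    refine ⟨{ toFun := fun f => phi f 0 α z, map_add' := ?_, map_smul' := ?_ }, fun f => rfl⟩
    · intro f g
      simp only [phi_zero]
      exact Finset.sum_add_distrib
    · intro c f
      simp only [phi_zero]
      exact (Finset.mul_sum _ _ _).symm
  | succ j ih =>
    intro α _ _ z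
    obtain ⟨L, hL⟩ := ih (α ⊕ Unit) (dg z * swp)
    exact ⟨L, fun f => by rw [hL, phi]⟩

theorem extend_units {n : ℕ} {ψ : GL (Fin n) F → ℂ} (hψ : IrrChar.IsClass ψ) {α : Type} [Fintype α]
    [DecidableEq α] (e : α ≃ Fin n) (y : (Matrix α α F)ˣ) :
    extend n ψ α y.1 = ψ (Units.mapEquiv (Matrix.reindexAlgEquiv F F e).toMulEquiv y) := by
  have h := ClassFn.apply_reindex ⟨extend n ψ, extend_mem hψ⟩ e y.1
  refine h.symm.trans ?_
  rw [← extend_apply hψ _ (Matrix.one_mul (1 : Matrix (Fin n) (Fin n) F))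
    (Matrix.one_mul (1 : Matrix (Fin n) (Fin n) F)), Matrix.one_mul, Matrix.mul_one]
  rfl

theorem extend_coe {n : ℕ} {ψ : GL (Fin n) F → ℂ} (hψ : IrrChar.IsClass ψ) (g : GL (Fin n) F) :
    extend n ψ (Fin n) g.1 = ψ g := by
  rw [← extend_apply hψ g (Matrix.one_mul (1 : Matrix (Fin n) (Fin n) F))
    (Matrix.one_mul (1 : Matrix (Fin n) (Fin n) F)), Matrix.one_mul, Matrix.mul_one]

theorem card_le_of_exists_sum_Qs_ne_zero {a k n : ℕ} (hn : a + k = n)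
    (S : Finset (GL (Fin n) F → ℂ)) (hS : ∀ χ ∈ S, IrrChar.IsIrr χ)
    (hne : ∀ χ ∈ S, ∃ v : Matrix (T a k) (T a k) F, IsUnit v ∧
      ∑ q ∈ Qs F a k, extend n χ (T a k) (v * q) ≠ 0)
    (W : Finset (Multiset (ℕ × Fˣ))) (hW : ∀ M, wt M ≤ k → M ∈ W) :
    S.card ≤ W.card * (Fintype.card (Matrix (T a 0) (T a 0) F) +
      Fintype.card (Matrix (T a 0 ⊕ Unit) (T a 0 ⊕ Unit) F)) := by
  have hcl : ∀ c : S → ℂ, IrrChar.IsClass (Fintype.linearCombination ℂ (fun s : S => s.1) c) := by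
    intro c g h
    simp only [Fintype.linearCombination_apply, Finset.sum_apply, Pi.smul_apply]
    exact Finset.sum_congr rfl fun s _ => by rw [(hS s.1 s.2).isClass]
  let L : (S → ℂ) →ₗ[ℂ] ClassFn F := LinearMap.codRestrict (ClassFn F)
    (extend n ∘ₗ Fintype.linearCombination ℂ (fun s : S => s.1)) fun c => extend_mem (hcl c)
  choose O hO using exists_linear_ops (F := F)
  choose Φ hΦ using exists_linear_phi (F := F)
  let ev (x : Matrix (T a 0) (T a 0) F) : ClassFn F →ₗ[ℂ] ℂ :=
    { toFun := fun f => f (T a 0) x, map_add' := fun _ _ => rfl, map_smul' := fun _ _ => rfl }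
  let N : (S → ℂ) →ₗ[ℂ] (W × (Matrix (T a 0) (T a 0) F ⊕
      Matrix (T a 0 ⊕ Unit) (T a 0 ⊕ Unit) F) → ℂ) := LinearMap.pi fun i =>
    (Sum.elim ev (Φ (k - wt i.1.1 - 1) (T a 0)) i.2) ∘ₗ O i.1.1 ∘ₗ L
  have hN : Function.Injective N := by
    refine (injective_iff_map_eq_zero N).2 fun c hc => ?_
    have hvan := sum_Qs_eq_zero a k (L c) ?_
    · have e : T a k ≃ Fin n := Fintype.equivFinOfCardEq (by rw [card_T, hn])
      let R : (Matrix (T a k) (T a k) F)ˣ ≃* GL (Fin n) F :=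
        Units.mapEquiv (Matrix.reindexAlgEquiv F F e).toMulEquiv
      have hR : ∀ {ψ : GL (Fin n) F → ℂ} (_ : IrrChar.IsClass ψ) (v : (Matrix (T a k) (T a k) F)ˣ),
          ∑ q ∈ Qs F a k, extend n ψ (T a k) (v.1 * q) =
            ∑ q : Qs F a k, ψ (R v * R ((isGrp_Qs a k).isUnit q.2).unit) := by
        intro ψ hψ v
        rw [← Finset.sum_coe_sort]
        refine Finset.sum_congr rfl fun q _ => ?_
        rw [← map_mul]
        exact extend_units hψ e (v * ((isGrp_Qs a k).isUnit q.2).unit)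
      let c' : (GL (Fin n) F → ℂ) → ℂ := fun χ => if h : χ ∈ S then c ⟨χ, h⟩ else 0
      have hc' : ∀ s : S, c' s.1 = c s := fun s => dif_pos s.2
      have key : ∀ x, ∑ q : Qs F a k, ∑ χ ∈ S,
          c' χ * χ (x * R ((isGrp_Qs a k).isUnit q.2).unit) = 0 := by
        intro x
        have h1 := hvan (R.symm x).1 (R.symm x).isUnit
        have h2 := hR (hcl c) (R.symm x)
        rw [MulEquiv.apply_symm_apply] at h2
        refine Eq.trans (Finset.sum_congr rfl fun q _ => ?_) (h2.symm.trans h1)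
        rw [← Finset.sum_coe_sort, Fintype.linearCombination_apply, Finset.sum_apply]
        exact Finset.sum_congr rfl fun s _ => by rw [hc']; rfl
      funext s
      obtain ⟨v, hv, hv'⟩ := hne s.1 s.2
      have h3 := IrrChar.smul_sum_eq_zero (fun q : Qs F a k => R ((isGrp_Qs a k).isUnit q.2).unit)
        S hS c' key s.2 (R hv.unit)
      rw [hc', ← hR (hS s.1 s.2).isClass] at h3
      exact (mul_eq_zero.1 h3).resolve_right hv'
    · intro M hM
      refine ⟨fun x => ?_, fun z => ?_⟩
      · have := congrFun hc (⟨M, hW M hM⟩, Sum.inl x)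
        rw [← hO]
        exact this
      · have := congrFun hc (⟨M, hW M hM⟩, Sum.inr z)
        rw [← hO, ← hΦ]
        exact this
  have := LinearMap.finrank_le_finrank_of_injective hN
  simpa only [Module.finrank_fintype_fun_eq_card, Fintype.card_coe, Fintype.card_prod,
    Fintype.card_sum] using this

theorem card_le_of_not_dvd (hF : Odd (Fintype.card F)) {m k n : ℕ} (hn : 2 * m + k = n)
    (S : Finset (GL (Fin n) F → ℂ)) (hS : ∀ χ ∈ S, IrrChar.IsIrr χ)
    (hdvd : ∀ χ ∈ S, ¬ ∃ D : ℕ, χ 1 = (D : ℂ) ∧ 2 ^ m ∣ D)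
    (W : Finset (Multiset (ℕ × Fˣ))) (hW : ∀ M, wt M ≤ k → M ∈ W) :
    S.card ≤ W.card * (Fintype.card (Matrix (T (2 * m) 0) (T (2 * m) 0) F) +
      Fintype.card (Matrix (T (2 * m) 0 ⊕ Unit) (T (2 * m) 0 ⊕ Unit) F)) := by
  refine card_le_of_exists_sum_Qs_ne_zero hn S hS (fun χ hχ => ?_) W hW
  have hirr := hS χ hχ
  obtain ⟨X, _, _, _, ρ, rfl, -⟩ := hirr.exists_rep
  refine exists_sum_Qs_ne_zero hF le_rfl hn ρ (fun h => hdvd _ hχ ⟨_, ρ.char_one, h⟩)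
    ⟨extend n ρ.character, extend_mem hirr.isClass⟩ fun g => extend_coe hirr.isClass g

end Mirabolic

theorem IrrChar.finite_setOf_irr {G : Type} [Group G] [Fintype G] :
    {χ : G → ℂ | IrrChar.IsIrr χ}.Finite :=
  Set.finite_coe_iff.1 IrrChar.finite_irr

namespace Mirabolic

variable {F : Type} [Field F]

/-- `wt` as an additive homomorphism. -/
def wtHom (F : Type) [Field F] : Multiset (ℕ × Fˣ) →+ ℕ :=
  Multiset.sumAddMonoidHom.comp (Multiset.mapAddMonoidHom fun p => p.1 + 1)

theorem wtHom_apply (M : Multiset (ℕ × Fˣ)) : wtHom F M = wt M := rfl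

theorem le_wt {M : Multiset (ℕ × Fˣ)} {p : ℕ × Fˣ} (hp : p ∈ M) : p.1 + 1 ≤ wt M :=
  Multiset.le_sum_of_mem (Multiset.mem_map_of_mem (fun p : ℕ × Fˣ => p.1 + 1) hp)

theorem card_le_wt (M : Multiset (ℕ × Fˣ)) : M.card ≤ wt M := by
  induction M using Multiset.induction with
  | empty => simp
  | cons p M ih =>
    have : wt (p ::ₘ M) = p.1 + 1 + wt M := by simp [wt]
    rw [this, Multiset.card_cons]
    omega

variable [Fintype F] [DecidableEq F]

/-- The multiset with prescribed multiplicities. -/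
def ofCount {n : ℕ} (e : Fin n × Fˣ → ℕ) : Multiset (ℕ × Fˣ) :=
  ∑ i, e i • {(i.1.1, i.2)}

theorem wt_ofCount {n : ℕ} (e : Fin n × Fˣ → ℕ) :
    wt (ofCount e) = ∑ i, e i * (i.1.1 + 1) := by
  rw [← wtHom_apply, ofCount, map_sum]
  refine Finset.sum_congr rfl fun i _ => ?_
  rw [map_nsmul, wtHom_apply, smul_eq_mul]
  simp [wt]

theorem ofCount_count {n : ℕ} {M : Multiset (ℕ × Fˣ)} (hM : wt M ≤ n) :
    ofCount (fun i : Fin n × Fˣ => M.count (i.1.1, i.2)) = M := by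
  ext ⟨j, t⟩
  rw [ofCount, Multiset.count_sum']
  simp only [Multiset.count_nsmul, Multiset.count_singleton, Prod.mk.injEq]
  by_cases hj : j < n
  · rw [Finset.sum_eq_single (⟨j, hj⟩, t)]
    · simp
    · rintro ⟨⟨i, hi⟩, s⟩ _ h
      rw [if_neg, mul_zero]
      rintro ⟨rfl, rfl⟩
      exact h rfl
    · simp
  · rw [Multiset.count_eq_zero_of_notMem, Finset.sum_eq_zero]
    · rintro ⟨⟨i, hi⟩, s⟩ _
      rw [if_neg, mul_zero]
      rintro ⟨rfl, rfl⟩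
      exact hj hi
    · intro h
      have := le_wt h
      simp only at this
      omega

/-- The multisets of weight at most `n`. -/
def lowWt (F : Type) [Field F] [Fintype F] [DecidableEq F] (n : ℕ) : Finset (Multiset (ℕ × Fˣ)) :=
  ((Fintype.piFinset fun _ : Fin n × Fˣ => Finset.range (n + 1)).filter
    fun e => ∑ i, e i * (i.1.1 + 1) ≤ n).image ofCount

theorem mem_lowWt {n : ℕ} {M : Multiset (ℕ × Fˣ)} (hM : wt M ≤ n) : M ∈ lowWt F n := by
  refine Finset.mem_image.2 ⟨_, Finset.mem_filter.2 ⟨Fintype.mem_piFinset.2 fun i => ?_, ?_⟩,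
    ofCount_count hM⟩
  · exact Finset.mem_range_succ_iff.2
      ((Multiset.count_le_card _ _).trans ((card_le_wt M).trans hM))
  · rw [← wt_ofCount, ofCount_count hM]
    exact hM

theorem geom_sum_le_exp {y : ℝ} (h0 : 0 ≤ y) (h1 : y ≤ 2 / 3) (n : ℕ) :
    ∑ t ∈ Finset.range n, y ^ t ≤ Real.exp (3 * y) := by
  have h := mul_neg_geom_sum y n
  have h2 : (1 - y) * ∑ t ∈ Finset.range n, y ^ t ≤ (1 - y) * (3 * y + 1) := by
    rw [h]
    nlinarith [pow_nonneg h0 n]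
  exact (le_of_mul_le_mul_left h2 (by linarith)).trans (Real.add_one_le_exp _)

theorem sum_pow_succ_le (n : ℕ) : ∑ j : Fin n, (2 / 3 : ℝ) ^ (j.1 + 1) ≤ 2 := by
  rw [Fin.sum_univ_eq_sum_range fun j => (2 / 3 : ℝ) ^ (j + 1)]
  have h := mul_neg_geom_sum (2 / 3 : ℝ) n
  simp only [pow_succ, ← Finset.sum_mul]
  have : (0 : ℝ) ≤ (2 / 3) ^ n := by positivity
  linarith

theorem card_lowWt_le (n : ℕ) :
    ((lowWt F n).card : ℝ) ≤ Real.exp (6 * Fintype.card Fˣ) * (3 / 2) ^ n := by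
  have h1 : ((lowWt F n).card : ℝ) ≤ ∑ e ∈ Fintype.piFinset fun _ : Fin n × Fˣ =>
      Finset.range (n + 1), (3 / 2 : ℝ) ^ n * ∏ i, ((2 / 3 : ℝ) ^ (i.1.1 + 1)) ^ e i := by
    refine (Nat.cast_le.2 Finset.card_image_le).trans ?_
    rw [Finset.card_filter, Nat.cast_sum]
    refine Finset.sum_le_sum fun e _ => ?_
    have h2 : ∏ i, ((2 / 3 : ℝ) ^ (i.1.1 + 1)) ^ e i =
        (2 / 3 : ℝ) ^ ∑ i, e i * (i.1.1 + 1) := by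
      rw [← Finset.prod_pow_eq_pow_sum]
      exact Finset.prod_congr rfl fun i _ => by rw [← pow_mul, mul_comm]
    rw [h2]
    split_ifs with h
    · have h3 : (2 / 3 : ℝ) ^ n ≤ (2 / 3) ^ ∑ i, e i * (i.1.1 + 1) :=
        pow_le_pow_of_le_one (by norm_num) (by norm_num) h
      calc ((1 : ℕ) : ℝ) = (3 / 2) ^ n * (2 / 3) ^ n := by
            rw [← mul_pow]
            norm_num
        _ ≤ _ := mul_le_mul_of_nonneg_left h3 (by positivity)
    · rw [Nat.cast_zero]
      positivity
  refine h1.trans ?_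
  rw [← Finset.mul_sum, mul_comm]
  refine mul_le_mul_of_nonneg_right ?_ (by positivity)
  rw [← Finset.prod_univ_sum (fun _ : Fin n × Fˣ => Finset.range (n + 1))
    fun i t => ((2 / 3 : ℝ) ^ (i.1.1 + 1)) ^ t]
  calc ∏ i : Fin n × Fˣ, ∑ t ∈ Finset.range (n + 1), ((2 / 3 : ℝ) ^ (i.1.1 + 1)) ^ t
      ≤ ∏ i : Fin n × Fˣ, Real.exp (3 * (2 / 3 : ℝ) ^ (i.1.1 + 1)) := by
        refine Finset.prod_le_prod (fun i _ => Finset.sum_nonneg fun t _ => by positivity)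
          fun i _ => geom_sum_le_exp (by positivity) ?_ _
        exact pow_le_of_le_one (by norm_num) (by norm_num) (Nat.succ_ne_zero _)
    _ = Real.exp (3 * ((∑ j : Fin n, (2 / 3 : ℝ) ^ (j.1 + 1)) * Fintype.card Fˣ)) := by
        rw [← Real.exp_sum, ← Finset.mul_sum, Fintype.sum_prod_type]
        simp only [Finset.sum_const, Finset.card_univ, nsmul_eq_mul, Finset.mul_sum,
          mul_comm]
    _ ≤ Real.exp (6 * Fintype.card Fˣ) := by
        refine Real.exp_le_exp.2 ?_
        nlinarith [sum_pow_succ_le n, (Nat.cast_nonneg (Fintype.card Fˣ) : (0 : ℝ) ≤ _)]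

end Mirabolic

theorem pow_div_pow_half_le (n : ℕ) :
    (3 / 2 : ℝ) ^ n / 3 ^ (n / 2) ≤ 3 / 2 * (3 / 4) ^ (n / 2) := by
  have h1 : (3 / 2 : ℝ) ^ n ≤ (3 / 2) ^ (2 * (n / 2) + 1) :=
    pow_le_pow_right₀ (by norm_num) (by omega)
  rw [div_le_iff₀ (by positivity), mul_assoc, ← mul_pow]
  refine h1.trans (le_of_eq ?_)
  rw [pow_succ, pow_mul]
  norm_num
  ring

theorem tendsto_pow_div_pow_half (C : ℝ) :
    Tendsto (fun n : ℕ => C * (3 / 2 * (3 / 4 : ℝ) ^ (n / 2))) atTop (𝓝 0) := by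
  have h1 : Tendsto (fun n : ℕ => n / 2) atTop atTop :=
    Nat.tendsto_div_const_atTop (by norm_num)
  have h2 := (tendsto_pow_atTop_nhds_zero_of_lt_one (r := (3 / 4 : ℝ)) (by norm_num)
    (by norm_num)).comp h1
  simpa using (h2.const_mul (3 / 2)).const_mul C

theorem Mirabolic.card_not_dvd_le {F : Type} [Field F] [Fintype F] [DecidableEq F]
    (hF : Odd (Fintype.card F)) (m : ℕ) : ∃ C : ℝ, ∀ n, 2 * m ≤ n →
      (Nat.card {χ : GL (Fin n) F → ℂ // (IrrChar.IsIrr χ ∧ ∀ x, χ x⁻¹ = χ x) ∧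
        ¬ ∃ D : ℕ, χ 1 = (D : ℂ) ∧ 2 ^ m ∣ D} : ℝ) ≤ C * (3 / 2) ^ n := by
  refine ⟨Real.exp (6 * Fintype.card Fˣ) *
    (Fintype.card (Matrix (T (2 * m) 0) (T (2 * m) 0) F) +
      Fintype.card (Matrix (T (2 * m) 0 ⊕ Unit) (T (2 * m) 0 ⊕ Unit) F) : ℕ), fun n hn => ?_⟩
  have hfin : {χ : GL (Fin n) F → ℂ | (IrrChar.IsIrr χ ∧ ∀ x, χ x⁻¹ = χ x) ∧
      ¬ ∃ D : ℕ, χ 1 = (D : ℂ) ∧ 2 ^ m ∣ D}.Finite :=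
    IrrChar.finite_setOf_irr.subset fun χ h => h.1.1
  have h1 := card_le_of_not_dvd hF (Nat.add_sub_cancel' hn) hfin.toFinset
    (fun χ h => ((Set.Finite.mem_toFinset hfin).1 h).1.1)
    (fun χ h => ((Set.Finite.mem_toFinset hfin).1 h).2) (lowWt F (n - 2 * m))
    fun M hM => mem_lowWt hM
  rw [← Set.ncard_eq_toFinset_card _ hfin] at h1
  refine (Nat.cast_le.2 h1).trans ?_
  rw [Nat.cast_mul, mul_right_comm]
  refine mul_le_mul_of_nonneg_right ((card_lowWt_le _).trans ?_) (Nat.cast_nonneg _)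
  exact mul_le_mul_of_nonneg_left (pow_le_pow_right₀ (by norm_num) (Nat.sub_le _ _))
    (Real.exp_pos _).le

/-- For a fixed odd prime power `q` and `m ≥ 0`, the proportion of self-dual irreducible complex
characters of `GL_n(𝔽_q)` whose degree `χ(1)` is divisible by `2^m`, among all self-dual
irreducible complex characters of `GL_n(𝔽_q)`, tends to `1` as `n → ∞`. -/
theorem stmt3 (q : ℕ) (hq : Odd q) (hqpp : IsPrimePow q)
    (F : Type) [Field F] [Fintype F] [DecidableEq F] (hF : Fintype.card F = q) (m : ℕ) :
    Filter.Tendsto (fun n : ℕ =>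
      (Nat.card {χ : GL (Fin n) F → ℂ //
          (∃ V : FDRep ℂ (GL (Fin n) F), Simple V ∧ χ = V.character) ∧
          (∀ x, χ x⁻¹ = χ x) ∧
          ∃ D : ℕ, χ 1 = (D : ℂ) ∧ 2 ^ m ∣ D} : ℝ) /
      (Nat.card {χ : GL (Fin n) F → ℂ //
          (∃ V : FDRep ℂ (GL (Fin n) F), Simple V ∧ χ = V.character) ∧
          ∀ x, χ x⁻¹ = χ x} : ℝ))
      Filter.atTop (𝓝 1) := by
  subst hF
  obtain ⟨C, hC⟩ := Mirabolic.card_not_dvd_le hq m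
  have hcard : 3 ≤ Fintype.card F := by
    have := Fintype.one_lt_card (α := F)
    obtain ⟨r, hr⟩ := hq
    omega
  have hlim := (tendsto_pow_div_pow_half C).const_sub 1
  rw [sub_zero] at hlim
  refine tendsto_of_tendsto_of_tendsto_of_le_of_le' hlim tendsto_const_nhds ?_ ?_
  all_goals
    filter_upwards [eventually_ge_atTop (2 * m)] with n hn
    let A : Set (GL (Fin n) F → ℂ) := {χ | IrrChar.IsIrr χ ∧ ∀ x, χ x⁻¹ = χ x}
    let B : Set (GL (Fin n) F → ℂ) := {χ | IrrChar.IsIrr χ ∧ (∀ x, χ x⁻¹ = χ x) ∧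
      ∃ D : ℕ, χ 1 = (D : ℂ) ∧ 2 ^ m ∣ D}
    have hA : A.Finite :=
      IrrChar.finite_setOf_irr.subset fun χ h => h.1
    have hBA : B ⊆ A := fun χ h => ⟨h.1, h.2.1⟩
    have hA3 : 3 ^ (n / 2) ≤ A.ncard :=
      (Nat.pow_le_pow_left hcard _).trans (RealClasses.card_pow_le_card_selfDual n)
    have hA3' : (3 : ℝ) ^ (n / 2) ≤ (A.ncard : ℝ) := by exact_mod_cast hA3
    have hpos : (0 : ℝ) < A.ncard := lt_of_lt_of_le (by positivity) hA3'
  · change _ ≤ (B.ncard : ℝ) / (A.ncard : ℝ)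
    have hdiff : ((A \ B).ncard : ℝ) ≤ C * (3 / 2) ^ n := by
      have : A \ B = {χ : GL (Fin n) F → ℂ | (IrrChar.IsIrr χ ∧ ∀ x, χ x⁻¹ = χ x) ∧
          ¬ ∃ D : ℕ, χ 1 = (D : ℂ) ∧ 2 ^ m ∣ D} := by
        ext χ
        simp only [A, B, Set.mem_sdiff, Set.mem_ofPred_eq]
        exact ⟨fun h => ⟨h.1, fun h' => h.2 ⟨h.1.1, h.1.2, h'⟩⟩, fun h => ⟨h.1, fun h' => h.2 h'.2.2⟩⟩
      rw [this]
      exact hC n hn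
    have hsum : ((A \ B).ncard : ℝ) + B.ncard = A.ncard := by
      exact_mod_cast Set.ncard_sdiff_add_ncard_of_subset hBA hA
    have hC0 : 0 ≤ C := by
      have h0 : (0 : ℝ) < (3 / 2) ^ n := by positivity
      exact nonneg_of_mul_nonneg_left ((Nat.cast_nonneg _).trans hdiff) h0
    have h1 : ((A \ B).ncard : ℝ) / A.ncard ≤ C * (3 / 2 * (3 / 4 : ℝ) ^ (n / 2)) := by
      calc ((A \ B).ncard : ℝ) / A.ncard ≤ C * (3 / 2) ^ n / 3 ^ (n / 2) :=
            div_le_div₀ (by positivity) hdiff (by positivity) hA3'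
        _ = C * ((3 / 2) ^ n / 3 ^ (n / 2)) := mul_div_assoc _ _ _
        _ ≤ _ := mul_le_mul_of_nonneg_left (pow_div_pow_half_le n) hC0
    have h2 : (B.ncard : ℝ) / A.ncard = 1 - (A \ B).ncard / A.ncard := by
      rw [eq_sub_iff_add_eq, ← add_div, add_comm, hsum, div_self hpos.ne']
    rw [h2]
    linarith
  · change (B.ncard : ℝ) / (A.ncard : ℝ) ≤ 1
    rw [div_le_one hpos]
    exact_mod_cast Set.ncard_le_ncard hBA hA
end

section
/- For every prime number ℓ and every real number r > 0, lim_{n→∞} #{λ ⊢ n : v_ℓ(f_λ) < r + log n / log ℓ} / p(n) = 0, where p(n) denotes the number of partitions of n. -/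
open Filter Topology

/-- The multiset of hook lengths of a partition: for the cell `(i,j)` (with `1 ≤ i` and
`1 ≤ j ≤ λ_i`, where `λ_1 ≥ λ_2 ≥ ⋯` are the parts in decreasing order), the hook length is
`(λ_i − j) + (λ′_j − i) + 1`, where `λ′_j = #{i : λ_i ≥ j}` is the conjugate partition. -/
def hookLengths {m : ℕ} (lam : Nat.Partition m) : Multiset ℕ :=
  let L : List ℕ := (lam.parts.sort (· ≤ ·)).reverse
  (↑((List.range L.length).flatMap fun i =>
      (List.range (L.getD i 0)).map fun j =>
        (L.getD i 0 - (j + 1)) +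
          ((lam.parts.filter fun p => j + 1 ≤ p).card - (i + 1)) + 1) : Multiset ℕ)

/-- The hook-length formula value `f_λ = n! / ∏_{h ∈ ℋ(λ)} h` (the degree of the irreducible
representation of `S_n` attached to `λ`), as a rational number. -/
def fHook {m : ℕ} (lam : Nat.Partition m) : ℚ :=
  (m.factorial : ℚ) / ((hookLengths lam).map fun h => (h : ℚ)).prod

/-- Distinct natural numbers sum to at least `0 + 1 + ⋯`. -/
theorem sum_range_card_le_sum (F : Finset ℕ) : ∑ i ∈ Finset.range F.card, i ≤ ∑ x ∈ F, x := by
  induction F using Finset.induction_on_max with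
  | empty => simp
  | insert a s h ih =>
    have ha : a ∉ s := fun h' => lt_irrefl _ (h a h')
    have hs : s.card ≤ a := by
      simpa using Finset.card_le_card (fun x hx => Finset.mem_range.2 (h x hx) : s ⊆ Finset.range a)
    rw [Finset.card_insert_of_notMem ha, Finset.sum_range_succ, Finset.sum_insert ha]
    omega

/-- The gaps `c` of `B` below its elements `b` with `c ≡ b [MOD m]` are at most `1 / m` of
all the gaps: this is the bound on the `m`-weight in terms of the bead positions of an abacus. -/
theorem mul_sum_card_gaps_add_le (B : Finset ℕ) {m : ℕ} (hm : 0 < m) :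
    m * ∑ b ∈ B, ((Finset.range b).filter fun c => c ∉ B ∧ c ≡ b [MOD m]).card
      + ∑ i ∈ Finset.range B.card, i ≤ ∑ b ∈ B, b := by
  set g : ℕ → ℕ := fun b => ((Finset.range b).filter fun c => c ∈ B ∧ c ≡ b [MOD m]).card with hg
  have key : ∀ b, ((Finset.range b).filter fun c => c ∉ B ∧ c ≡ b [MOD m]).card + g b = b / m := by
    intro b
    have h1 := Nat.count_modEq_card b hm b
    simp only [lt_irrefl, if_false, add_zero] at h1
    rw [← h1, Nat.count_eq_card_filter_range, hg]
    simp only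
    rw [← Finset.card_filter_add_card_filter_not
      (s := (Finset.range b).filter fun c => c ≡ b [MOD m]) (fun c => c ∈ B),
      Finset.filter_filter, Finset.filter_filter, add_comm]
    simp only [and_comm]
  have hmono : ∀ b ∈ B, ∀ b', b < b' → b % m = b' % m → g b < g b' := by
    intro b hb b' hbb' h
    apply Finset.card_lt_card
    rw [Finset.ssubset_iff]
    refine ⟨b, by simp, ?_⟩
    intro c hc
    rw [Finset.mem_insert, Finset.mem_filter, Finset.mem_range] at hc
    rw [Finset.mem_filter, Finset.mem_range]
    rcases hc with rfl | ⟨h1, h2, h3⟩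
    · exact ⟨hbb', hb, h⟩
    · exact ⟨h1.trans hbb', h2, h3.trans h⟩
  set φ : ℕ → ℕ := fun b => b % m + m * g b with hφ
  have hinj : Set.InjOn φ B := by
    intro b hb b' hb' h
    have hmod : b % m = b' % m := by
      have := congrArg (· % m) h
      simpa [hφ] using this
    have hgg : g b = g b' := by
      simp only [hφ, hmod, add_right_inj] at h
      exact Nat.eq_of_mul_eq_mul_left hm h
    rcases lt_trichotomy b b' with h' | h' | h'
    · exact absurd hgg (hmono b hb b' h' hmod).ne
    · exact h'
    · exact absurd hgg (hmono b' hb' b h' hmod.symm).ne'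
  have hsum := sum_range_card_le_sum (B.image φ)
  rw [Finset.card_image_of_injOn hinj, Finset.sum_image hinj] at hsum
  have hpt : ∀ b ∈ B, m * ((Finset.range b).filter fun c => c ∉ B ∧ c ≡ b [MOD m]).card + φ b
      = b := by
    intro b _
    have h1 := Nat.mod_add_div b m
    rw [← key b, mul_add] at h1
    simp only [hφ]
    omega
  calc _ ≤ m * ∑ b ∈ B, ((Finset.range b).filter fun c => c ∉ B ∧ c ≡ b [MOD m]).card
        + ∑ b ∈ B, φ b := by gcongr
    _ = _ := by rw [Finset.mul_sum, ← Finset.sum_add_distrib, Finset.sum_congr rfl hpt]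

/-- In a weakly decreasing list, the entries that are at least `t` come first. -/
theorem le_getD_iff_lt_countP {l : List ℕ} (hl : l.Pairwise (· ≥ ·)) (t : ℕ) {i : ℕ}
    (hi : i < l.length) : t ≤ l.getD i 0 ↔ i < l.countP (t ≤ ·) := by
  induction l generalizing i with
  | nil => simp at hi
  | cons a l ih =>
    rw [List.pairwise_cons] at hl
    by_cases hta : t ≤ a
    · cases i with
      | zero => simp [hta]
      | succ i =>
        have := ih hl.2 (i := i) (by simpa using hi)
        simp only [List.getD_cons_succ, this, List.countP_cons, hta]
        simp
    · have h0 : (a :: l).countP (t ≤ ·) = 0 := by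
        rw [List.countP_eq_zero]
        intro x hx
        rcases List.mem_cons.1 hx with rfl | hx
        · simpa using hta
        · have := hl.1 x hx
          simp only [decide_eq_true_eq]
          omega
      rw [h0]
      have hmem : (a :: l).getD i 0 ∈ a :: l := by
        rw [List.getD_eq_getElem _ _ hi]
        exact List.getElem_mem hi
      have hle : (a :: l).getD i 0 ≤ a := by
        rcases List.mem_cons.1 hmem with h | h
        · exact h.le
        · exact hl.1 _ h
      simp only [Nat.not_lt_zero, iff_false]
      omega

/-- The parts of a partition in decreasing order. -/
def Nat.Partition.rows {n : ℕ} (lam : n.Partition) : List ℕ :=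
  (lam.parts.sort (· ≤ ·)).reverse

/-- The hook length of the cell in row `i` and column `j`, both counted from `0`. -/
def Nat.Partition.hook {n : ℕ} (lam : n.Partition) (i j : ℕ) : ℕ :=
  (lam.rows.getD i 0 - (j + 1)) + ((lam.parts.filter fun p => j + 1 ≤ p).card - (i + 1)) + 1

namespace Nat.Partition

variable {n : ℕ} (lam : n.Partition)

theorem coe_rows : (lam.rows : Multiset ℕ) = lam.parts := by
  simp [rows]

theorem pairwise_rows : lam.rows.Pairwise (· ≥ ·) := by
  rw [rows, List.pairwise_reverse]
  exact Multiset.pairwise_sort _ _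

theorem length_rows : lam.rows.length = lam.parts.card := by
  simp [rows]

theorem sum_rows : ∑ i ∈ Finset.range lam.rows.length, lam.rows.getD i 0 = n := by
  conv_rhs => rw [← lam.parts_sum, ← lam.coe_rows, Multiset.sum_coe]
  rw [Finset.sum_range, ← Fin.sum_univ_getElem]
  exact Finset.sum_congr rfl fun i _ => by simp

theorem lt_rows_iff {i : ℕ} (hi : i < lam.rows.length) (j : ℕ) :
    j + 1 ≤ lam.rows.getD i 0 ↔ i < (lam.parts.filter fun p => j + 1 ≤ p).card := by
  rw [le_getD_iff_lt_countP lam.pairwise_rows (j + 1) hi, ← Multiset.countP_eq_card_filter,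
    ← lam.coe_rows, Multiset.coe_countP]

theorem countP_hookLengths (p : ℕ → Prop) [DecidablePred p] :
    (hookLengths lam).countP p = ∑ i ∈ Finset.range lam.rows.length,
      ((Finset.range (lam.rows.getD i 0)).filter fun j => p (lam.hook i j)).card := by
  have hrow : ∀ i, (((List.range (lam.rows.getD i 0)).map (lam.hook i)).countP (p ·)) =
      ((Finset.range (lam.rows.getD i 0)).filter fun j => p (lam.hook i j)).card := by
    intro i
    rw [List.countP_map, List.countP_eq_length_filter]
    rfl
  have : hookLengths lam = (↑((List.range lam.rows.length).flatMap fun i =>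
      (List.range (lam.rows.getD i 0)).map (lam.hook i)) : Multiset ℕ) := rfl
  rw [this, Multiset.coe_countP, List.countP_flatMap, Finset.sum_eq_multiset_sum,
    Finset.range_val, Multiset.range, Multiset.map_coe, Multiset.sum_coe]
  exact congrArg List.sum (List.map_congr_left fun i _ => hrow i)

theorem mem_hookLengths {h : ℕ} (hh : h ∈ hookLengths lam) :
    ∃ i < lam.rows.length, ∃ j < lam.rows.getD i 0, lam.hook i j = h := by
  have : hookLengths lam = (↑((List.range lam.rows.length).flatMap fun i =>
      (List.range (lam.rows.getD i 0)).map (lam.hook i)) : Multiset ℕ) := rfl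
  rw [this] at hh
  simpa using hh

theorem getD_rows_mem {i : ℕ} (hi : i < lam.rows.length) : lam.rows.getD i 0 ∈ lam.parts := by
  rw [← lam.coe_rows, Multiset.mem_coe, List.getD_eq_getElem _ _ hi]
  exact List.getElem_mem hi

theorem lt_of_mem_hookLengths {M : ℕ} (h1 : ∀ x ∈ lam.parts, x ≤ M) (h2 : lam.parts.card ≤ M)
    {h : ℕ} (hh : h ∈ hookLengths lam) : 0 < h ∧ h < 2 * M := by
  obtain ⟨i, hi, j, hj, rfl⟩ := lam.mem_hookLengths hh
  have ha := h1 _ (lam.getD_rows_mem hi)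
  have hb : (lam.parts.filter fun p => j + 1 ≤ p).card ≤ lam.parts.card :=
    Multiset.card_le_card (Multiset.filter_le _ _)
  rw [lam.length_rows] at hi
  unfold hook
  omega

/-- The bead position of row `i`. -/
def bead (i : ℕ) : ℕ := lam.rows.getD i 0 + (lam.rows.length - 1 - i)

theorem bead_strictAnti {i k : ℕ} (hik : i < k) (hk : k < lam.rows.length) :
    lam.bead k < lam.bead i := by
  have : lam.rows.getD k 0 ≤ lam.rows.getD i 0 := by
    rw [List.getD_eq_getElem _ _ hk, List.getD_eq_getElem _ _ (hik.trans hk)]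
    exact List.pairwise_iff_getElem.1 lam.pairwise_rows i k _ hk hik
  unfold bead
  omega

theorem bead_injOn : Set.InjOn lam.bead (Finset.range lam.rows.length) := by
  intro i hi k hk h
  simp only [Finset.coe_range, Set.mem_Iio] at hi hk
  rcases lt_trichotomy i k with h' | h' | h'
  · exact absurd h (lam.bead_strictAnti h' hk).ne'
  · exact h'
  · exact absurd h (lam.bead_strictAnti h' hi).ne

theorem card_hook_dvd_le {i : ℕ} (hi : i < lam.rows.length) (m : ℕ) :
    ((Finset.range (lam.rows.getD i 0)).filter fun j => m ∣ lam.hook i j).card ≤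
      ((Finset.range (lam.bead i)).filter fun c =>
        c ∉ (Finset.range lam.rows.length).image lam.bead ∧ c ≡ lam.bead i [MOD m]).card := by
  have hcol : ∀ j, (lam.parts.filter fun p => j + 1 ≤ p).card ≤ lam.rows.length := fun j => by
    rw [lam.length_rows]
    exact Multiset.card_le_card (Multiset.filter_le _ _)
  have hanti : ∀ j k, j ≤ k → (lam.parts.filter fun p => k + 1 ≤ p).card ≤
      (lam.parts.filter fun p => j + 1 ≤ p).card := fun j k hjk =>
    Multiset.card_le_card (Multiset.monotone_filter_right _ fun p hp => by omega)
  apply Finset.card_le_card_of_injOn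
    fun j => j + (lam.rows.length - (lam.parts.filter fun p => j + 1 ≤ p).card)
  · intro j hj
    simp only [Finset.coe_filter, Finset.mem_range, Set.mem_ofPred_eq] at hj ⊢
    obtain ⟨hj, hd⟩ := hj
    have hij := (lam.lt_rows_iff hi j).1 hj
    have hcj := hcol j
    have heq : lam.bead i = j + (lam.rows.length -
        (lam.parts.filter fun p => j + 1 ≤ p).card) + lam.hook i j := by
      unfold bead hook
      omega
    refine ⟨?_, ?_, ?_⟩
    · have : 0 < lam.hook i j := by unfold hook; omega
      omega
    · rw [Finset.mem_image]
      rintro ⟨k, hk, hkj⟩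
      rw [Finset.mem_range] at hk
      have := lam.lt_rows_iff hk j
      unfold bead at hkj
      omega
    · rw [heq]
      exact (Nat.modEq_iff_dvd' (by omega)).2 (by simpa using hd)
  · intro j _ k _ hjk
    simp only at hjk
    have h1 := hcol j
    have h2 := hcol k
    rcases le_total j k with h | h
    · have := hanti j k h
      omega
    · have := hanti k j h
      omega

/-- At most `n / m` hook lengths of a partition of `n` are divisible by `m`. -/
theorem countP_dvd_hookLengths_le {m : ℕ} (hm : 0 < m) :
    (hookLengths lam).countP (m ∣ ·) ≤ n / m := by
  rw [Nat.le_div_iff_mul_le hm, countP_hookLengths]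
  have hB := mul_sum_card_gaps_add_le ((Finset.range lam.rows.length).image lam.bead) hm
  rw [Finset.sum_image lam.bead_injOn, Finset.sum_image lam.bead_injOn,
    Finset.card_image_of_injOn lam.bead_injOn, Finset.card_range] at hB
  have hsum : ∑ i ∈ Finset.range lam.rows.length, lam.bead i =
      n + ∑ i ∈ Finset.range lam.rows.length, i := by
    simp only [bead]
    rw [Finset.sum_add_distrib, lam.sum_rows, Finset.sum_range_reflect (fun i => i)]
  rw [hsum] at hB
  have hle := Finset.sum_le_sum fun i (hi : i ∈ Finset.range lam.rows.length) =>
    lam.card_hook_dvd_le (Finset.mem_range.1 hi) m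
  have := Nat.mul_le_mul_left m hle
  rw [mul_comm]
  omega

end Nat.Partition

theorem padicValNat_multiset_prod_eq {p k : ℕ} [Fact p.Prime] (H : Multiset ℕ)
    (hH : ∀ h ∈ H, 0 < h ∧ h < p ^ k) :
    padicValNat p H.prod = ∑ j ∈ Finset.Ico 1 k, H.countP (p ^ j ∣ ·) := by
  induction H using Multiset.induction_on with
  | empty => simp
  | cons a H ih =>
    have ha := hH a (Multiset.mem_cons_self a H)
    have hH' : ∀ h ∈ H, 0 < h ∧ h < p ^ k := fun h hh => hH h (Multiset.mem_cons_of_mem hh)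
    have h0 : H.prod ≠ 0 := Multiset.prod_ne_zero fun h => by simpa using (hH' 0 h).1
    have hv : padicValNat p a = ∑ j ∈ Finset.Ico 1 k, if p ^ j ∣ a then 1 else 0 := by
      rw [← Finset.card_filter]
      have : (Finset.Ico 1 k).filter (fun j => p ^ j ∣ a) = Finset.Ico 1 (padicValNat p a + 1) := by
        ext j
        simp only [Finset.mem_filter, Finset.mem_Ico]
        rw [padicValNat_dvd_iff_le ha.1.ne']
        have : padicValNat p a < k := by
          by_contra! hk
          have := Nat.le_of_dvd ha.1 ((padicValNat_dvd_iff_le ha.1.ne').2 hk)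
          omega
        omega
      simp [this]
    rw [Multiset.prod_cons, padicValNat.mul ha.1.ne' h0, ih hH', hv, ← Finset.sum_add_distrib]
    refine Finset.sum_congr rfl fun j _ => ?_
    rw [Multiset.countP_cons, add_comm]

/-- If all parts, and the number of parts, are at most `M`, then the large powers of `ℓ` divide
no hook length but contribute to the valuation of `n!`. -/
theorem div_le_padicValRat_fHook {ℓ : ℕ} [Fact ℓ.Prime] {n M : ℕ} (hM : 0 < M)
    (lam : n.Partition) (h1 : ∀ x ∈ lam.parts, x ≤ M) (h2 : lam.parts.card ≤ M) :
    ((n / (2 * M * ℓ) : ℕ) : ℤ) ≤ padicValRat ℓ (fHook lam) := by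
  have hℓ : ℓ.Prime := Fact.out
  set k := Nat.log ℓ (2 * M) + 1 with hk
  have hlt : 2 * M < ℓ ^ k := Nat.lt_pow_succ_log_self hℓ.one_lt _
  have hle : ℓ ^ k ≤ 2 * M * ℓ := by
    rw [hk, pow_succ]
    exact Nat.mul_le_mul_right _ (Nat.pow_log_le_self _ (by omega))
  have hH : ∀ h ∈ hookLengths lam, 0 < h ∧ h < ℓ ^ k := fun h hh => by
    have := lam.lt_of_mem_hookLengths h1 h2 hh
    omega
  have h0 : (hookLengths lam).prod ≠ 0 := Multiset.prod_ne_zero fun h => by simpa using (hH 0 h).1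
  have hf : fHook lam = ((n.factorial : ℕ) : ℚ) / (((hookLengths lam).prod : ℕ) : ℚ) := by
    rw [fHook, Nat.cast_multiset_prod]
    simp [Multiset.bind_def, Multiset.pure_def]
  rw [hf, padicValRat.div (by exact_mod_cast n.factorial_ne_zero) (by exact_mod_cast h0),
    padicValRat.of_nat, padicValRat.of_nat]
  have hb : Nat.log ℓ n < k + 1 + Nat.log ℓ n := by omega
  rw [padicValNat_factorial hb, padicValNat_multiset_prod_eq _ hH]
  have hs : ∑ j ∈ Finset.Ico 1 k, (hookLengths lam).countP (ℓ ^ j ∣ ·) ≤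
      ∑ j ∈ Finset.Ico 1 k, n / ℓ ^ j :=
    Finset.sum_le_sum fun j _ => lam.countP_dvd_hookLengths_le (pow_pos hℓ.pos j)
  have hs2 : ∑ j ∈ Finset.Ico 1 k, n / ℓ ^ j + n / ℓ ^ k ≤
      ∑ j ∈ Finset.Ico 1 (k + 1 + Nat.log ℓ n), n / ℓ ^ j := by
    rw [← Finset.sum_Ico_succ_top (by omega)]
    exact Finset.sum_le_sum_of_subset (Finset.Ico_subset_Ico_right (by omega))
  have hs3 : n / (2 * M * ℓ) ≤ n / ℓ ^ k := Nat.div_le_div_left hle (pow_pos hℓ.pos k)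
  omega

namespace Nat.Partition

theorem sq_card_toFinset_le {n : ℕ} (lam : n.Partition) : lam.parts.toFinset.card ^ 2 ≤ 2 * n := by
  have h0 : 0 ∉ lam.parts.toFinset := fun h => by
    simpa using lam.parts_pos (Multiset.mem_toFinset.1 h)
  have h1 := sum_range_card_le_sum (insert 0 lam.parts.toFinset)
  rw [Finset.card_insert_of_notMem h0, Finset.sum_insert h0, zero_add] at h1
  have h2 : ∑ x ∈ lam.parts.toFinset, x ≤ n := by
    conv_rhs => rw [← lam.parts_sum, Finset.sum_multiset_count]
    refine Finset.sum_le_sum fun x hx => ?_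
    exact Nat.le_mul_of_pos_left _ (Multiset.count_pos.2 (Multiset.mem_toFinset.1 hx))
  have h3 := Finset.sum_range_id_mul_two (lam.parts.toFinset.card + 1)
  simp only [add_tsub_cancel_right] at h3
  nlinarith

theorem exists_parts_eq (n : ℕ) : ∃ P : Multiset ℕ → n.Partition,
    ∀ s : Multiset ℕ, (∀ i ∈ s, 0 < i) → s.sum = n → (P s).parts = s := by
  classical
  refine ⟨fun s => if h : (∀ i ∈ s, 0 < i) ∧ s.sum = n then ⟨s, fun hi => h.1 _ hi, h.2⟩
    else indiscrete n, fun s h1 h2 => ?_⟩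
  simp only
  rw [dif_pos ⟨h1, h2⟩]

open Classical in
/-- Few partitions have a part larger than `2 * K`: such a part can be split into three in at least
`K ^ 2` ways. -/
theorem card_large_part_mul_le {n D : ℕ} (hD : ∀ mu : n.Partition, mu.parts.toFinset.card ≤ D)
    (K : ℕ) :
    (Finset.univ.filter fun lam : n.Partition => ∃ x ∈ lam.parts, 2 * K < x).card * K ^ 2 ≤
      Fintype.card n.Partition * D ^ 3 := by
  have hx : ∀ lam : n.Partition, ∃ x, (∃ x ∈ lam.parts, 2 * K < x) → x ∈ lam.parts ∧ 2 * K < x := by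
    intro lam
    by_cases h : ∃ x ∈ lam.parts, 2 * K < x
    · exact ⟨h.choose, fun _ => h.choose_spec⟩
    · exact ⟨0, fun h' => absurd h' h⟩
  choose f hf using hx
  obtain ⟨P, hPparts⟩ := exists_parts_eq n
  set S : n.Partition × ℕ × ℕ → Multiset ℕ := fun t =>
    (t.2.1 + 1) ::ₘ (t.2.2 + 1) ::ₘ (f t.1 - (t.2.1 + 1) - (t.2.2 + 1)) ::ₘ t.1.parts.erase (f t.1)
    with hS
  set A := Finset.univ.filter fun lam : n.Partition => ∃ x ∈ lam.parts, 2 * K < x with hA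
  have hkey : ∀ t ∈ A ×ˢ Finset.range K ×ˢ Finset.range K,
      f t.1 ∈ t.1.parts ∧ t.2.1 + 1 + (t.2.2 + 1) < f t.1 ∧ (P (S t)).parts = S t := by
    rintro ⟨lam, a, b⟩ ht
    simp only [hA, Finset.mem_product, Finset.mem_filter, Finset.mem_univ, true_and,
      Finset.mem_range] at ht
    obtain ⟨h1, h2⟩ := hf lam ht.1
    have h3 := congrArg Multiset.sum (Multiset.cons_erase h1)
    rw [Multiset.sum_cons, lam.parts_sum] at h3
    refine ⟨h1, by simp only; omega, hPparts _ ?_ ?_⟩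
    · intro i hi
      simp only [hS, Multiset.mem_cons] at hi
      rcases hi with rfl | rfl | rfl | hi
      · omega
      · omega
      · omega
      · exact lam.parts_pos (Multiset.mem_of_mem_erase hi)
    · simp only [hS, Multiset.sum_cons]
      omega
  have hcard : (A ×ˢ Finset.range K ×ˢ Finset.range K).card ≤
      ((Finset.univ : Finset n.Partition).sigma fun mu =>
        mu.parts.toFinset ×ˢ mu.parts.toFinset ×ˢ mu.parts.toFinset).card := by
    apply Finset.card_le_card_of_injOn fun t =>
      ⟨P (S t), (t.2.1 + 1, t.2.2 + 1, f t.1 - (t.2.1 + 1) - (t.2.2 + 1))⟩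
    · intro t ht
      have := (hkey t ht).2.2
      rw [Finset.mem_coe, Finset.mem_sigma]
      simp only [this]
      simp [hS]
    · intro t ht u hu htu
      obtain ⟨h1, h2, h3⟩ := hkey t ht
      obtain ⟨h4, h5, h6⟩ := hkey u hu
      simp only [Sigma.mk.injEq, heq_eq_eq, Prod.mk.injEq] at htu
      obtain ⟨h7, h8, h9, h10⟩ := htu
      have ha : t.2.1 = u.2.1 := by omega
      have hb : t.2.2 = u.2.2 := by omega
      have hx : f t.1 = f u.1 := by omega
      have he : S t = S u := by rw [← h3, ← h6, h7]
      simp only [hS, ha, hb, hx, Multiset.cons_inj_right] at he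
      have hl : t.1 = u.1 := by
        ext1
        rw [← Multiset.cons_erase h1, ← Multiset.cons_erase h4, hx, he]
      exact Prod.ext hl (Prod.ext ha hb)
  rw [Finset.card_product, Finset.card_product, Finset.card_range, Finset.card_sigma] at hcard
  rw [sq]
  refine hcard.trans ?_
  rw [← Finset.card_univ, ← smul_eq_mul]
  refine Finset.sum_le_card_nsmul _ _ _ fun mu _ => ?_
  rw [Finset.card_product, Finset.card_product]
  calc _ ≤ D * (D * D) := by gcongr <;> exact hD mu
    _ = D ^ 3 := by ring

open Classical in
/-- Few partitions have a part `s ≤ S` of multiplicity at least `K`: up to `K` copies of `s` can be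
merged into one part. -/
theorem card_large_count_mul_le {n D : ℕ} (hD : ∀ mu : n.Partition, mu.parts.toFinset.card ≤ D)
    (S K : ℕ) :
    (Finset.univ.filter fun lam : n.Partition =>
      ∃ s ∈ Finset.Icc 1 S, K ≤ lam.parts.count s).card * K ≤
      Fintype.card n.Partition * (S * D) := by
  have hx : ∀ lam : n.Partition, ∃ s, (∃ s ∈ Finset.Icc 1 S, K ≤ lam.parts.count s) →
      s ∈ Finset.Icc 1 S ∧ K ≤ lam.parts.count s := by
    intro lam
    by_cases h : ∃ s ∈ Finset.Icc 1 S, K ≤ lam.parts.count s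
    · exact ⟨h.choose, fun _ => h.choose_spec⟩
    · exact ⟨0, fun h' => absurd h' h⟩
  choose f hf using hx
  obtain ⟨P, hPparts⟩ := exists_parts_eq n
  set R : n.Partition × ℕ → Multiset ℕ := fun t =>
    ((t.2 + 1) * f t.1) ::ₘ (t.1.parts - Multiset.replicate (t.2 + 1) (f t.1)) with hR
  set A := Finset.univ.filter fun lam : n.Partition =>
    ∃ s ∈ Finset.Icc 1 S, K ≤ lam.parts.count s with hA
  have hkey : ∀ t ∈ A ×ˢ Finset.range K, f t.1 ∈ Finset.Icc 1 S ∧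
      t.1.parts - Multiset.replicate (t.2 + 1) (f t.1) + Multiset.replicate (t.2 + 1) (f t.1) =
        t.1.parts ∧ (P (R t)).parts = R t := by
    rintro ⟨lam, k⟩ ht
    simp only [hA, Finset.mem_product, Finset.mem_filter, Finset.mem_univ, true_and,
      Finset.mem_range] at ht
    obtain ⟨h1, h2⟩ := hf lam ht.1
    have h3 : lam.parts - Multiset.replicate (k + 1) (f lam) + Multiset.replicate (k + 1) (f lam) =
        lam.parts :=
      tsub_add_cancel_of_le (Multiset.le_count_iff_replicate_le.1 (by omega))
    have h4 := congrArg Multiset.sum h3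
    rw [Multiset.sum_add, Multiset.sum_replicate, lam.parts_sum, smul_eq_mul] at h4
    refine ⟨h1, h3, hPparts _ ?_ ?_⟩
    · intro i hi
      simp only [hR, Multiset.mem_cons] at hi
      rcases hi with rfl | hi
      · exact Nat.mul_pos (Nat.succ_pos _) (Finset.mem_Icc.1 h1).1
      · exact lam.parts_pos (Multiset.mem_of_le (Multiset.sub_le_self _ _) hi)
    · simp only [hR, Multiset.sum_cons]
      omega
  have hcard : (A ×ˢ Finset.range K).card ≤
      ((Finset.univ : Finset n.Partition).sigma fun mu =>
        Finset.Icc 1 S ×ˢ mu.parts.toFinset).card := by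
    apply Finset.card_le_card_of_injOn fun t => ⟨P (R t), (f t.1, (t.2 + 1) * f t.1)⟩
    · intro t ht
      obtain ⟨h1, -, h3⟩ := hkey t ht
      have h1' := Finset.mem_Icc.1 h1
      rw [Finset.mem_coe, Finset.mem_sigma]
      simp only [h3]
      simp [hR, h1'.1, h1'.2]
    · intro t ht u hu htu
      obtain ⟨h1, h2, h3⟩ := hkey t ht
      obtain ⟨h4, h5, h6⟩ := hkey u hu
      simp only [Sigma.mk.injEq, heq_eq_eq, Prod.mk.injEq] at htu
      obtain ⟨h7, h8, h9⟩ := htu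
      rw [h8] at h9
      have hk : t.2 = u.2 := by
        have := Nat.eq_of_mul_eq_mul_right (Finset.mem_Icc.1 h4).1 h9
        omega
      have he : R t = R u := by rw [← h3, ← h6, h7]
      simp only [hR, hk, h8, Multiset.cons_inj_right] at he
      have hl : t.1 = u.1 := by
        ext1
        rw [← h2, ← h5, hk, h8, he]
      exact Prod.ext hl hk
  rw [Finset.card_product, Finset.card_range, Finset.card_sigma] at hcard
  refine hcard.trans ?_
  rw [← Finset.card_univ, ← smul_eq_mul]
  refine Finset.sum_le_card_nsmul _ _ _ fun mu _ => ?_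
  rw [Finset.card_product, Nat.card_Icc, Nat.add_sub_cancel]
  exact Nat.mul_le_mul_left _ (hD mu)

/-- A partition with many parts has a small part of high multiplicity. -/
theorem exists_le_count_of_lt_card {n S K c : ℕ} (lam : n.Partition) (hn : n ≤ c * S)
    (hcard : S * K + c < lam.parts.card) : ∃ s ∈ Finset.Icc 1 S, K ≤ lam.parts.count s := by
  by_contra! hlt
  have hsplit := congrArg Multiset.card (Multiset.filter_add_not (fun p => p ≤ S) lam.parts)
  rw [Multiset.card_add] at hsplit
  have hsmall : (lam.parts.filter fun p => p ≤ S).card ≤ S * K := by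
    have hsub : (lam.parts.filter fun p => p ≤ S).toFinset ⊆ Finset.Icc 1 S := by
      intro x hx
      rw [Multiset.mem_toFinset, Multiset.mem_filter] at hx
      exact Finset.mem_Icc.2 ⟨lam.parts_pos hx.1, hx.2⟩
    rw [← Multiset.toFinset_sum_count_eq]
    calc _ ≤ (lam.parts.filter fun p => p ≤ S).toFinset.card • K :=
          Finset.sum_le_card_nsmul _ _ _ fun x hx =>
            (Multiset.count_le_of_le _ (Multiset.filter_le _ _)).trans (hlt x (hsub hx)).le
      _ ≤ S * K := by
          rw [smul_eq_mul]
          exact Nat.mul_le_mul_right _ (by simpa using Finset.card_le_card hsub)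
  have hlarge : (lam.parts.filter fun p => ¬ p ≤ S).card ≤ c := by
    have h1 : (lam.parts.filter fun p => ¬ p ≤ S).card • (S + 1) ≤
        (lam.parts.filter fun p => ¬ p ≤ S).sum :=
      Multiset.card_nsmul_le_sum fun x hx => by
        have := (Multiset.mem_filter.1 hx).2
        omega
    have h2 := congrArg Multiset.sum (Multiset.filter_add_not (fun p => p ≤ S) lam.parts)
    rw [Multiset.sum_add, lam.parts_sum] at h2
    rw [smul_eq_mul] at h1
    by_contra h3
    have h4 : (c + 1) * (S + 1) ≤ (lam.parts.filter fun p => ¬ p ≤ S).card * (S + 1) :=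
      Nat.mul_le_mul_right _ (not_le.1 h3)
    have h5 : (c + 1) * (S + 1) = c * S + c + S + 1 := by ring
    omega
  omega

open Classical in
/-- Almost all partitions of `n` have `O(n ^ (9 / 10))` parts, all of size `O(n ^ (9 / 10))`. -/
theorem card_large_mul_le {n q : ℕ} (hq : 0 < q) (hn : n ≤ 1024 * q ^ 10) :
    (Finset.univ.filter fun lam : n.Partition =>
      ¬ ((∀ x ∈ lam.parts, x ≤ 1026 * q ^ 9) ∧ lam.parts.card ≤ 1026 * q ^ 9)).card * q ≤
      Fintype.card n.Partition * 150000 := by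
  have hD : ∀ mu : n.Partition, mu.parts.toFinset.card ≤ 46 * q ^ 5 := fun mu => by
    refine (Nat.pow_le_pow_iff_left two_ne_zero).1 ?_
    have := mu.sq_card_toFinset_le
    calc _ ≤ 2 * n := this
      _ ≤ (46 * q ^ 5) ^ 2 := by
        have : (46 * q ^ 5) ^ 2 = 2116 * q ^ 10 := by ring
        omega
  have h1 := card_large_part_mul_le hD (q ^ 9)
  set A := Finset.univ.filter fun lam : n.Partition => ∃ x ∈ lam.parts, 2 * q ^ 9 < x
  set B := Finset.univ.filter fun lam : n.Partition =>
      ∃ s ∈ Finset.Icc 1 (1024 * q), q ^ 8 ≤ lam.parts.count s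
  have h2 : B.card * q ^ 8 ≤ Fintype.card n.Partition * (1024 * q * (46 * q ^ 5)) := by
    convert card_large_count_mul_le hD (1024 * q) (q ^ 8)
  set p := Fintype.card n.Partition
  have hsub : (Finset.univ.filter fun lam : n.Partition =>
      ¬ ((∀ x ∈ lam.parts, x ≤ 1026 * q ^ 9) ∧ lam.parts.card ≤ 1026 * q ^ 9)) ⊆ A ∪ B := by
    intro lam hlam
    simp only [Finset.mem_filter, Finset.mem_univ, true_and, A, B, Finset.mem_union] at hlam ⊢
    rw [not_and_or] at hlam
    have hq9 : 0 < q ^ 9 := by positivity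
    rcases hlam with h | h
    · push Not at h
      obtain ⟨x, hx, hx'⟩ := h
      exact Or.inl ⟨x, hx, by omega⟩
    · refine Or.inr (lam.exists_le_count_of_lt_card (c := q ^ 9) ?_ ?_)
      · calc n ≤ 1024 * q ^ 10 := hn
          _ = q ^ 9 * (1024 * q) := by ring
      · have : 1024 * q * q ^ 8 = 1024 * q ^ 9 := by ring
        omega
  have hAB := (Finset.card_le_card hsub).trans (Finset.card_union_le A B)
  clear_value A B p
  have hA : A.card * q ≤ p * 97336 := by
    have h3 : A.card * q ^ 3 ≤ p * 97336 := by
      refine Nat.le_of_mul_le_mul_right ?_ (pow_pos hq 15)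
      calc _ = A.card * (q ^ 9) ^ 2 := by ring
        _ ≤ p * (46 * q ^ 5) ^ 3 := h1
        _ = _ := by ring
    exact (Nat.mul_le_mul_left _ (Nat.le_self_pow (by norm_num) q)).trans h3
  have hB : B.card * q ≤ p * 47104 := by
    have h3 : B.card * q ^ 2 ≤ p * 47104 := by
      refine Nat.le_of_mul_le_mul_right ?_ (pow_pos hq 6)
      calc _ = B.card * q ^ 8 := by ring
        _ ≤ p * (1024 * q * (46 * q ^ 5)) := h2
        _ = _ := by ring
    exact (Nat.mul_le_mul_left _ (Nat.le_self_pow (by norm_num) q)).trans h3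
  calc _ ≤ (A.card + B.card) * q := Nat.mul_le_mul_right q hAB
    _ ≤ p * 97336 + p * 47104 := by rw [add_mul]; exact Nat.add_le_add hA hB
    _ ≤ p * 150000 := by omega

end Nat.Partition

theorem eventually_add_log_le {ℓ : ℕ} (hℓ : ℓ.Prime) (r : ℝ) :
    ∀ᶠ q : ℕ in atTop, r + 10 * Real.log (q + 1) / Real.log ℓ ≤ ((q / (2052 * ℓ) : ℕ) : ℝ) := by
  have hlog : 0 < Real.log ℓ := Real.log_pos (by exact_mod_cast hℓ.one_lt)
  have hℓ0 : (0 : ℝ) < ℓ := by exact_mod_cast hℓ.pos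
  set c : ℝ := Real.log ℓ / 10 / (4104 * ℓ) with hc
  have hc0 : 0 < c := by positivity
  have hx : Tendsto (fun q : ℕ => (q : ℝ) + 1) atTop atTop :=
    tendsto_atTop_add_const_right _ _ tendsto_natCast_atTop_atTop
  have h1 := hx.eventually (Real.isLittleO_log_id_atTop.def hc0)
  have h2 := (tendsto_natCast_atTop_atTop (R := ℝ)).eventually_ge_atTop
    ((r + 2) * (4104 * ℓ))
  filter_upwards [h1, h2] with q hq1 hq2
  have hq0 : (0 : ℝ) ≤ q := q.cast_nonneg
  simp only [id, Real.norm_eq_abs] at hq1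
  rw [abs_of_pos (show (0 : ℝ) < q + 1 by positivity)] at hq1
  have hq3 := (le_abs_self _).trans hq1
  have h3 : 10 * Real.log (q + 1) / Real.log ℓ ≤ (q + 1) / (4104 * ℓ) := by
    rw [div_le_iff₀ hlog]
    calc 10 * Real.log (q + 1) ≤ 10 * (c * (q + 1)) := by gcongr
      _ = _ := by rw [hc]; field_simp
  have h4 : r + 2 ≤ q / (4104 * ℓ) := by rwa [le_div_iff₀ (by positivity)]
  have h5 : (q : ℝ) / (2052 * ℓ) < ((q / (2052 * ℓ) : ℕ) : ℝ) + 1 := by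
    have := Nat.lt_div_mul_add (a := q) (b := 2052 * ℓ) (by have := hℓ.pos; omega)
    rw [div_lt_iff₀ (by positivity)]
    have h6 : (q : ℝ) < ((q / (2052 * ℓ) * (2052 * ℓ) + 2052 * ℓ : ℕ) : ℝ) := by exact_mod_cast this
    push_cast at h6
    linarith
  have h6 : (q : ℝ) / (2052 * ℓ) = q / (4104 * ℓ) + q / (4104 * ℓ) := by field_simp; ring
  have h7 : ((q : ℝ) + 1) / (4104 * ℓ) ≤ q / (4104 * ℓ) + 1 := by
    rw [add_div]
    have : (1 : ℝ) / (4104 * ℓ) ≤ 1 := by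
      rw [div_le_one (by positivity)]
      have : (1 : ℝ) ≤ ℓ := by exact_mod_cast hℓ.one_lt.le
      linarith
    linarith
  linarith

/-- For every prime `ℓ` and real `r > 0`, the proportion of partitions `λ ⊢ n` with
`v_ℓ(f_λ) < r + log n / log ℓ` tends to `0` as `n → ∞`. -/
theorem stmt4 (ℓ : ℕ) (hℓ : ℓ.Prime) (r : ℝ) (hr : 0 < r) :
    Filter.Tendsto (fun n : ℕ =>
      (Nat.card {lam : Nat.Partition n //
          ((padicValRat ℓ (fHook lam) : ℝ) < r + Real.log n / Real.log ℓ)} : ℝ) /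
        (Fintype.card (Nat.Partition n) : ℝ))
      Filter.atTop (𝓝 0) := by
  classical
  have : Fact ℓ.Prime := ⟨hℓ⟩
  have hlog : 0 < Real.log ℓ := Real.log_pos (by exact_mod_cast hℓ.one_lt)
  set q : ℕ → ℕ := fun n => ⌊(n : ℝ) ^ (1 / 10 : ℝ)⌋₊ with hq
  have hqt : Tendsto q atTop atTop :=
    tendsto_nat_floor_atTop.comp
      ((tendsto_rpow_atTop (by norm_num)).comp tendsto_natCast_atTop_atTop)
  have hpow : ∀ n : ℕ, ((n : ℝ) ^ (1 / 10 : ℝ)) ^ 10 = n := fun n => by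
    rw [← Real.rpow_natCast, ← Real.rpow_mul n.cast_nonneg]
    norm_num
  have hqle : ∀ n, q n ^ 10 ≤ n := fun n => by
    have h : ((q n : ℕ) : ℝ) ≤ (n : ℝ) ^ (1 / 10 : ℝ) := Nat.floor_le (by positivity)
    have := pow_le_pow_left₀ (Nat.cast_nonneg _) h 10
    rw [hpow] at this
    exact_mod_cast this
  have hqlt : ∀ n, n < (q n + 1) ^ 10 := fun n => by
    have h : (n : ℝ) ^ (1 / 10 : ℝ) < (q n : ℝ) + 1 := Nat.lt_floor_add_one _
    have := pow_lt_pow_left₀ h (by positivity) (n := 10) (by norm_num)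
    rw [hpow] at this
    exact_mod_cast this
  have hlim : Tendsto (fun n => (150000 : ℝ) / (q n : ℝ)) atTop (𝓝 0) :=
    (tendsto_natCast_atTop_atTop.comp hqt).const_div_atTop _
  refine squeeze_zero' (Eventually.of_forall fun n => by positivity) ?_ hlim
  filter_upwards [hqt.eventually (eventually_add_log_le hℓ r), hqt.eventually_ge_atTop 1]
    with n hv hq1
  have hn0 : 0 < n := lt_of_lt_of_le (pow_pos hq1 10) (hqle n)
  have hn : n ≤ 1024 * q n ^ 10 := by
    calc n ≤ (q n + 1) ^ 10 := (hqlt n).le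
      _ ≤ (2 * q n) ^ 10 := by gcongr; omega
      _ = 1024 * q n ^ 10 := by ring
  have hcount := Nat.Partition.card_large_mul_le hq1 hn
  have hlogn : Real.log n ≤ 10 * Real.log (q n + 1) := by
    rw [show (10 : ℝ) = ((10 : ℕ) : ℝ) by norm_num, ← Real.log_pow]
    refine Real.log_le_log (by exact_mod_cast hn0) ?_
    exact_mod_cast (hqlt n).le
  have hdiv : q n / (2052 * ℓ) ≤ n / (2 * (1026 * q n ^ 9) * ℓ) := by
    rw [show 2 * (1026 * q n ^ 9) * ℓ = q n ^ 9 * (2052 * ℓ) by ring,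
      ← Nat.div_div_eq_div_mul n (q n ^ 9)]
    refine Nat.div_le_div_right ?_
    rw [Nat.le_div_iff_mul_le (by positivity)]
    calc _ = q n ^ 10 := by ring
      _ ≤ n := hqle n
  have hle : Nat.card {lam : Nat.Partition n //
        ((padicValRat ℓ (fHook lam) : ℝ) < r + Real.log n / Real.log ℓ)} ≤
      (Finset.univ.filter fun lam : n.Partition =>
        ¬ ((∀ x ∈ lam.parts, x ≤ 1026 * q n ^ 9) ∧ lam.parts.card ≤ 1026 * q n ^ 9)).card := by
    rw [Nat.card_eq_fintype_card, Fintype.card_subtype]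
    refine Finset.card_le_card fun lam hlam => ?_
    simp only [Finset.mem_filter, Finset.mem_univ, true_and] at hlam ⊢
    rintro ⟨h1, h2⟩
    have h3 := div_le_padicValRat_fHook (ℓ := ℓ) (by positivity) lam h1 h2
    have h4 : ((q n / (2052 * ℓ) : ℕ) : ℤ) ≤ padicValRat ℓ (fHook lam) :=
      le_trans (by exact_mod_cast hdiv) h3
    have h5 : ((q n / (2052 * ℓ) : ℕ) : ℝ) ≤ (padicValRat ℓ (fHook lam) : ℝ) := by
      have := (Int.cast_le (R := ℝ)).2 h4
      rwa [Int.cast_natCast] at this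
    have h6 : Real.log n / Real.log ℓ ≤ 10 * Real.log (q n + 1) / Real.log ℓ := by gcongr
    linarith
  have hp : (0 : ℝ) < Fintype.card n.Partition := by exact_mod_cast Fintype.card_pos
  rw [div_le_div_iff₀ hp (by exact_mod_cast hq1)]
  have hfin := (Nat.mul_le_mul_right (q n) hle).trans hcount
  rw [mul_comm (150000 : ℝ)]
  exact_mod_cast hfin
end
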